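/- Let n ≥ 6 and 2 ≤ i ≤ n−1, and let Φ_i : 𝒦ⁿ → 𝒦ⁿ be a translation invariant, even Minkowski valuation of degree i commuting with SO(n) whose generating function is the support function of an origin-symmetric, SO(n−1) invariant convex body L of class C²₊ (boundary a C² submanifold with everywhere positive Gaussian curvature). Then there exists ε > 0 such that if K ∈ 𝒦ⁿ has a C² support function and satisfies ‖h_{γK} − h_{𝔹ⁿ}‖_{C²(𝕊^{n−1})} < ε for some γ > 0, then there exists a sequence of positive numbers (γ_m)_{m=1}^∞ such that d_H(γ_m Φ_i^m K, 𝔹ⁿ) → 0 as m → ∞. -/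

import Mathlib

open scoped InnerProductSpace Pointwise
open MeasureTheory Metric Filter Topology

noncomputable section

/-- Euclidean space `ℝⁿ`. -/
abbrev En (n : ℕ) := EuclideanSpace ℝ (Fin n)

namespace MinkIter

variable {n : ℕ}

/-- The unit sphere `𝕊^{n-1}` as a subtype. -/
abbrev Sph (n : ℕ) := Metric.sphere (0 : En n) 1

/-- Spherical Lebesgue measure on `𝕊^{n-1}`. -/
def sphVol (n : ℕ) : Measure (Sph n) := (volume : Measure (En n)).toSphere

/-- A fixed pole `ē ∈ 𝕊^{n-1}`. -/
def pole (n : ℕ) : En n :=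
  if h : 0 < n then EuclideanSpace.single (⟨0, h⟩ : Fin n) 1 else 0

/-- The support function of a convex body, as a function on all of `ℝⁿ`. -/
def supp (K : ConvexBody (En n)) (x : En n) : ℝ :=
  sSup ((fun y => ⟪x, y⟫_ℝ) '' (K : Set (En n)))

/-- The Euclidean unit ball `𝔹ⁿ` as a convex body. -/
def ballB (n : ℕ) : ConvexBody (En n) :=
  ⟨closedBall 0 1, convex_closedBall 0 1, isCompact_closedBall 0 1, ⟨0, by simp⟩⟩

/-- The dilate `c • K` of a convex body. -/
def scale (c : ℝ) (K : ConvexBody (En n)) : ConvexBody (En n) :=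
  ⟨c • (K : Set (En n)), K.convex.smul c, K.isCompact.smul c, K.nonempty.smul_set⟩

/-- The translate `K + x` of a convex body. -/
def translate (K : ConvexBody (En n)) (x : En n) : ConvexBody (En n) :=
  ⟨(fun y => x + y) '' (K : Set (En n)), K.convex.translate x,
    K.isCompact.image (continuous_add_left x), K.nonempty.image _⟩

/-- A linear isometry of `ℝⁿ` is a rotation (element of `SO(n)`) if it preserves
orientation. -/
def IsRotation (ρ : En n ≃ₗᵢ[ℝ] En n) : Prop :=
  0 < LinearMap.det (ρ.toLinearEquiv.toLinearMap)

/-- The image `ρ K` of a convex body under a linear isometry. -/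
def rotate (ρ : En n ≃ₗᵢ[ℝ] En n) (K : ConvexBody (En n)) : ConvexBody (En n) :=
  ⟨ρ '' (K : Set (En n)), K.convex.linear_image ρ.toLinearEquiv.toLinearMap,
    K.isCompact.image ρ.continuous, K.nonempty.image _⟩

/-- `Φ` is a Minkowski valuation: `ΦK + ΦL = Φ(K ∪ L) + Φ(K ∩ L)` whenever `K ∪ L`
is convex (Minkowski addition on the left). -/
def IsMinkowskiValuation (Φ : ConvexBody (En n) → ConvexBody (En n)) : Prop :=
  ∀ (K L : ConvexBody (En n)) (hu : Convex ℝ ((K : Set (En n)) ∪ (L : Set (En n))))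
    (hi : ((K : Set (En n)) ∩ (L : Set (En n))).Nonempty),
    Φ K + Φ L =
      Φ ⟨(K : Set (En n)) ∪ (L : Set (En n)), hu, K.isCompact.union L.isCompact,
          K.nonempty.inl⟩ +
      Φ ⟨(K : Set (En n)) ∩ (L : Set (En n)), K.convex.inter L.convex,
          K.isCompact.inter_right L.isCompact.isClosed, hi⟩

/-- `Φ` is translation invariant. -/
def TranslationInvariant (Φ : ConvexBody (En n) → ConvexBody (En n)) : Prop :=
  ∀ (K : ConvexBody (En n)) (x : En n), Φ (translate K x) = Φ K

/-- `Φ` is (positively) homogeneous of degree `i`. -/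
def HasDegree (i : ℕ) (Φ : ConvexBody (En n) → ConvexBody (En n)) : Prop :=
  ∀ (K : ConvexBody (En n)) (c : ℝ), 0 ≤ c → Φ (scale c K) = scale (c ^ i) (Φ K)

/-- `Φ` commutes with `SO(n)`. -/
def RotationEquivariant (Φ : ConvexBody (En n) → ConvexBody (En n)) : Prop :=
  ∀ ρ : En n ≃ₗᵢ[ℝ] En n, IsRotation ρ → ∀ K, Φ (rotate ρ K) = rotate ρ (Φ K)

/-- `Φ` is even: `Φ(-K) = ΦK`. -/
def IsEven (Φ : ConvexBody (En n) → ConvexBody (En n)) : Prop :=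
  ∀ K, Φ (scale (-1) K) = Φ K

/-- `Φ` is monotone w.r.t. set inclusion. -/
def MonotoneVal (Φ : ConvexBody (En n) → ConvexBody (En n)) : Prop :=
  ∀ K L : ConvexBody (En n), (K : Set (En n)) ⊆ (L : Set (En n)) →
    (Φ K : Set (En n)) ⊆ (Φ L : Set (En n))

/-- `Φ` is non-trivial: `ΦK ≠ {o}` for some `K`. -/
def NontrivialVal (Φ : ConvexBody (En n) → ConvexBody (En n)) : Prop :=
  ∃ K : ConvexBody (En n), (Φ K : Set (En n)) ≠ {0}

/-- The mixed volume `V(K₁,…,Kₙ)`, via polarization of the volume. -/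
def mixedVol (Ks : Fin n → ConvexBody (En n)) : ℝ :=
  ((n.factorial : ℝ))⁻¹ *
    ∑ S : Finset (Fin n), (-1 : ℝ) ^ (n - S.card) *
      (volume ((∑ k ∈ S, Ks k : ConvexBody (En n)) : Set (En n))).toReal

/-- `κ_m`, the volume of the `m`-dimensional unit ball. -/
def kappa (m : ℕ) : ℝ := (volume (closedBall (0 : En m) 1)).toReal

/-- `ω_m`, the surface area of the `m`-dimensional unit ball. -/
def omegaS (m : ℕ) : ℝ := m * kappa m

/-- The `j`-th intrinsic volume `V_j(K) = binom(n,j) V(K[j],𝔹ⁿ[n-j]) / κ_{n-j}`. -/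
def intrinsicVol (j : ℕ) (K : ConvexBody (En n)) : ℝ :=
  (n.choose j : ℝ) / kappa (n - j) *
    mixedVol (fun k : Fin n => if (k : ℕ) < j then K else ballB n)

/-- `μ` is the area measure of order `i` of `K`: for every convex body `L`,
`∫ h_L dμ = n V(L, K[i], 𝔹ⁿ[n-1-i])`. -/
def IsAreaMeasure (i : ℕ) (K : ConvexBody (En n)) (μ : Measure (Sph n)) : Prop :=
  ∀ L : ConvexBody (En n),
    (∫ v : Sph n, supp L (v : En n) ∂μ) =
      n * mixedVol (fun k : Fin n =>
        if (k : ℕ) = 0 then L else if (k : ℕ) ≤ i then K else ballB n)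

/-- `Φ` is generated by the zonal function with profile `g : [-1,1] → ℝ`, i.e.
`h_{ΦK} = S_i(K,·) ∗ g` where `∗` is the spherical convolution. -/
def GeneratedBy (i : ℕ) (Φ : ConvexBody (En n) → ConvexBody (En n)) (g : ℝ → ℝ) : Prop :=
  ∀ (K : ConvexBody (En n)) (μ : Measure (Sph n)), IsAreaMeasure i K μ →
    ∀ u : En n, ‖u‖ = 1 →
      supp (Φ K) u = ∫ v : Sph n, g ⟪u, (v : En n)⟫_ℝ ∂μ

/-- `L` is a body of revolution: invariant under all rotations fixing the pole. -/
def IsZonalBody (L : ConvexBody (En n)) : Prop :=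
  ∀ ρ : En n ≃ₗᵢ[ℝ] En n, IsRotation ρ → ρ (pole n) = pole n → rotate ρ L = L

/-- The quadratic form of the Hessian of `F` at `u` in direction `w`. -/
def hessQ (F : En n → ℝ) (u w : En n) : ℝ := iteratedFDeriv ℝ 2 F u ![w, w]

/-- `(j,l)` entry of the Hessian of `F` at `u`. -/
def hessE (F : En n → ℝ) (u : En n) (j l : Fin n) : ℝ :=
  iteratedFDeriv ℝ 2 F u ![EuclideanSpace.single j 1, EuclideanSpace.single l 1]

/-- A convex body is of class `C^k₊` if its support function is of class `C^k`
away from the origin and the restriction of its Hessian to `u^⊥` is positive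
definite for every unit vector `u`. -/
def IsCkPlus (k : ℕ∞) (L : ConvexBody (En n)) : Prop :=
  ContDiffOn ℝ k (supp L) {0}ᶜ ∧
    ∀ u : En n, ‖u‖ = 1 → ∀ w : En n, w ≠ 0 → ⟪u, w⟫_ℝ = 0 → 0 < hessQ (supp L) u w

/-- `Φ` is a `C^∞₊` regular Minkowski valuation of degree `i`: it is generated by
the support function of a body of revolution of class `C^∞₊`. -/
def CInfRegular (i : ℕ) (Φ : ConvexBody (En n) → ConvexBody (En n)) : Prop :=
  ∃ (L : ConvexBody (En n)) (g : ℝ → ℝ), IsZonalBody L ∧ IsCkPlus ⊤ L ∧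
    (∀ u : En n, ‖u‖ = 1 → supp L u = g ⟪u, pole n⟫_ℝ) ∧ GeneratedBy i Φ g

/-- The `C²(𝕊^{n-1})` distance of two functions. -/
def C2dist (F G : En n → ℝ) : ℝ :=
  ⨆ u : Sph n, (|F (u : En n) - G (u : En n)| +
    ‖fderiv ℝ F (u : En n) - fderiv ℝ G (u : En n)‖ +
    ‖iteratedFDeriv ℝ 2 F (u : En n) - iteratedFDeriv ℝ 2 G (u : En n)‖)

/-- The Legendre polynomial of dimension `d` and degree `k` (Rodrigues formula). -/
def legendreP (d k : ℕ) (t : ℝ) : ℝ :=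
  (-1 : ℝ) ^ k *
    (Real.Gamma (((d : ℝ) - 1) / 2) / (2 ^ k * Real.Gamma (((d : ℝ) - 1) / 2 + k))) *
    (1 - t ^ 2) ^ (-(((d : ℝ) - 3) / 2)) *
    iteratedDeriv k (fun s : ℝ => (1 - s ^ 2) ^ ((((d : ℝ) - 3) / 2) + (k : ℝ))) t

/-- The multiplier `a_k^d[h]` of a zonal function with profile `h : [-1,1] → ℝ`. -/
def multInt (d k : ℕ) (h : ℝ → ℝ) : ℝ :=
  omegaS (d - 1) *
    ∫ t in (-1 : ℝ)..1, legendreP d k t * h t * (1 - t ^ 2) ^ (((d : ℝ) - 3) / 2)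

/-- The multiplier `a_k^n[f] = ∫_{𝕊^{n-1}} f(u) P_k^n(ē·u) du` of a zonal function
`f` on the sphere. -/
def multSph (k : ℕ) (f : En n → ℝ) : ℝ :=
  ∫ u : Sph n, f (u : En n) * legendreP n k ⟪pole n, (u : En n)⟫_ℝ ∂(sphVol n)

/-- The projection `π₀ f` of `f` onto the constants (its mean value). -/
def proj0 (f : En n → ℝ) : ℝ :=
  (omegaS n)⁻¹ * ∫ u : Sph n, f (u : En n) ∂(sphVol n)

/-- The `L²(𝕊^{n-1})` norm. -/
def sphL2 (f : En n → ℝ) : ℝ :=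
  Real.sqrt (∫ u : Sph n, (f (u : En n)) ^ 2 ∂(sphVol n))

/-- The sup norm on the sphere. -/
def supSph (f : En n → ℝ) : ℝ := ⨆ u : Sph n, |f (u : En n)|

/-- `M ∈ UBounds α f` iff `M` witnesses `‖f‖_{𝒰_α} ≤ M`: `‖f‖_∞ ≤ M` and for every
`k ≥ 1` there is a polynomial of degree at most `k` with `‖f - p_k‖_{L²} ≤ M k^{-α}`. -/
def UBounds (α : ℝ) (f : En n → ℝ) : Set ℝ :=
  {M | (∀ u : En n, ‖u‖ = 1 → |f u| ≤ M) ∧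
    ∀ k : ℕ, 0 < k → ∃ p : MvPolynomial (Fin n) ℝ, p.totalDegree ≤ k ∧
      sphL2 (fun x => f x - MvPolynomial.eval (fun j => x j) p) ≤ M * (k : ℝ) ^ (-α)}

/-- `f ∈ 𝒰_α`. -/
def MemU (α : ℝ) (f : En n → ℝ) : Prop := (UBounds α f).Nonempty

/-- The norm `‖f‖_{𝒰_α}`. -/
def UNorm (α : ℝ) (f : En n → ℝ) : ℝ := sInf (UBounds α f)

/-- The convolution transform `T_g f` with zonal kernel of profile `g`, extended
1-homogeneously to `ℝⁿ`: `(T_g f)(u) = ∫_{𝕊^{n-1}} g(u·v) f(v) dv` for unit `u`. -/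
def Tg (g : ℝ → ℝ) (f : En n → ℝ) (x : En n) : ℝ :=
  ‖x‖ * ∫ v : Sph n, g ⟪‖x‖⁻¹ • x, (v : En n)⟫_ℝ * f (v : En n) ∂(sphVol n)

/-- The 0-homogeneous extension of a function on the sphere. -/
def zeroExt (f : En n → ℝ) (x : En n) : ℝ := f (‖x‖⁻¹ • x)

/-- The spherical Laplacian `Δ_𝕊 f`, i.e. the Euclidean Laplacian of the
0-homogeneous extension. -/
def sphLap (f : En n → ℝ) (u : En n) : ℝ := ∑ j : Fin n, hessE (zeroExt f) u j j

/-- The operator `□_n f = f + Δ_𝕊 f /(n-1)`. -/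
def boxN (f : En n → ℝ) (u : En n) : ℝ := f u + ((n : ℝ) - 1)⁻¹ * sphLap f u

/-- The mixed discriminant of `m` symmetric `m × m` matrices, via polarization of
the determinant. -/
def mixedDisc {m : ℕ} (A : Fin m → Matrix (Fin m) (Fin m) ℝ) : ℝ :=
  ((m.factorial : ℝ))⁻¹ *
    ∑ S : Finset (Fin m), (-1 : ℝ) ^ (m - S.card) * (∑ k ∈ S, A k).det

/-- The rank one matrix `u ⊗ u`. -/
def outer (u : En n) : Matrix (Fin n) (Fin n) ℝ := Matrix.of fun j l => u j * u l

/-- The matrix of the orthogonal projection onto `u^⊥`. -/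
def projMat (u : En n) : Matrix (Fin n) (Fin n) ℝ := 1 - outer u

/-- The Hessian matrix of `F` at `u`. -/
def hessMat (F : En n → ℝ) (u : En n) : Matrix (Fin n) (Fin n) ℝ :=
  Matrix.of fun j l => hessE F u j l

/-- The mixed discriminant `D_{n-1}(B₁|_{u^⊥},…,B_{n-1}|_{u^⊥})` of the restrictions
to `u^⊥` of matrices annihilating `u`, computed via the identity
`D_{n-1}(B₁|_{u^⊥},…) = n · D_n(u ⊗ u, B₁,…,B_{n-1})`. -/
def restrDisc (u : En n) (B : Fin (n - 1) → Matrix (Fin n) (Fin n) ℝ) : ℝ :=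
  n * mixedDisc (fun k : Fin n =>
    if h : (k : ℕ) = 0 then outer u else B ⟨(k : ℕ) - 1, by have := k.isLt; omega⟩)

/-- Total variation distance between two Borel measures on the sphere. -/
def dTV (μ ν : Measure (Sph n)) : ℝ :=
  ⨆ A : {A : Set (Sph n) // MeasurableSet A}, |(μ A).toReal - (ν A).toReal|

/-- Lévy–Prokhorov distance between two Borel measures on the sphere. -/
def dLP (μ ν : Measure (Sph n)) : ℝ :=
  sInf {ε : ℝ | 0 < ε ∧ ∀ A : Set (Sph n), MeasurableSet A →
    μ A ≤ ν (Metric.thickening ε A) + ENNReal.ofReal ε ∧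
    ν A ≤ μ (Metric.thickening ε A) + ENNReal.ofReal ε}

/-- Two convex bodies are homothetic: one is a translate of a positive dilate of
the other. -/
def Homothetic (K L : ConvexBody (En n)) : Prop :=
  ∃ (c : ℝ) (x : En n), 0 < c ∧ (L : Set (En n)) = x +ᵥ c • (K : Set (En n))

/-- The dimension of a convex body (dimension of its affine hull). -/
def bodyDim (K : ConvexBody (En n)) : ℕ :=
  Module.finrank ℝ (vectorSpan ℝ (K : Set (En n)))

/-- `K` is a Euclidean ball. -/
def IsBall (K : ConvexBody (En n)) : Prop :=
  ∃ (c : En n) (r : ℝ), 0 < r ∧ (K : Set (En n)) = closedBall c r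

/-- The mean width `w(K) = (2/ω_n) ∫_{𝕊^{n-1}} h_K`. -/
def meanWidth (K : ConvexBody (En n)) : ℝ :=
  2 / omegaS n * ∫ u : Sph n, supp K (u : En n) ∂(sphVol n)

/-- `N(n,k)`, the dimension of the space of spherical harmonics of dimension `n`
and degree `k`. -/
def Nnk (n k : ℕ) : ℝ :=
  (((n : ℝ) + 2 * k - 2) / ((n : ℝ) + k - 2)) * (Nat.choose (n + k - 2) (n - 2) : ℝ)

lemma bddAbove_inner_image (K : ConvexBody (En n)) (x : En n) :
    BddAbove ((fun y => ⟪x, y⟫_ℝ) '' (K : Set (En n))) :=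
  (K.isCompact.image (by fun_prop)).bddAbove

lemma inner_le_supp {K : ConvexBody (En n)} {x y : En n} (hy : y ∈ (K : Set (En n))) :
    ⟪x, y⟫_ℝ ≤ supp K x :=
  le_csSup (bddAbove_inner_image K x) ⟨y, hy, rfl⟩

lemma supp_le {K : ConvexBody (En n)} {x : En n} {c : ℝ}
    (h : ∀ y ∈ (K : Set (En n)), ⟪x, y⟫_ℝ ≤ c) : supp K x ≤ c :=
  csSup_le (K.nonempty.image _) (by rintro _ ⟨y, hy, rfl⟩; exact h y hy)

lemma exists_inner_eq_supp (K : ConvexBody (En n)) (x : En n) :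
    ∃ y ∈ (K : Set (En n)), ⟪x, y⟫_ℝ = supp K x := by
  have := (K.isCompact.image (f := fun y => ⟪x, y⟫_ℝ) (by fun_prop)).sSup_mem
    (K.nonempty.image _)
  exact this

lemma supp_add_le (K : ConvexBody (En n)) (x y : En n) :
    supp K (x + y) ≤ supp K x + supp K y :=
  supp_le fun z hz => by
    rw [inner_add_left]; exact add_le_add (inner_le_supp hz) (inner_le_supp hz)

@[simp] lemma supp_zero_right (K : ConvexBody (En n)) : supp K 0 = 0 := by
  obtain ⟨y, _, h⟩ := exists_inner_eq_supp K 0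
  rw [← h, inner_zero_left]

lemma supp_smul (K : ConvexBody (En n)) {c : ℝ} (hc : 0 ≤ c) (x : En n) :
    supp K (c • x) = c * supp K x := by
  apply le_antisymm
  · refine supp_le fun y hy => ?_
    rw [real_inner_smul_left]; exact mul_le_mul_of_nonneg_left (inner_le_supp hy) hc
  · obtain ⟨y, hy, h⟩ := exists_inner_eq_supp K x
    rw [← h, ← real_inner_smul_left]; exact inner_le_supp hy

lemma supp_add (K L : ConvexBody (En n)) (x : En n) :
    supp (K + L) x = supp K x + supp L x := by
  apply le_antisymm
  · refine supp_le fun y hy => ?_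
    rw [ConvexBody.coe_add] at hy
    obtain ⟨a, ha, b, hb, rfl⟩ := Set.mem_add.1 hy
    rw [inner_add_right]; exact add_le_add (inner_le_supp ha) (inner_le_supp hb)
  · obtain ⟨a, ha, h⟩ := exists_inner_eq_supp K x
    obtain ⟨b, hb, h'⟩ := exists_inner_eq_supp L x
    rw [← h, ← h', ← inner_add_right]
    exact inner_le_supp (by rw [ConvexBody.coe_add]; exact Set.add_mem_add ha hb)

@[simp] lemma supp_zero (x : En n) : supp (0 : ConvexBody (En n)) x = 0 := by
  obtain ⟨y, hy, h⟩ := exists_inner_eq_supp (0 : ConvexBody (En n)) x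
  have : y = 0 := by simpa using hy
  rw [← h, this, inner_zero_right]

lemma supp_scale_gen (K : ConvexBody (En n)) (c : ℝ) (x : En n) :
    supp (scale c K) x = supp K (c • x) := by
  apply le_antisymm
  · refine supp_le fun y hy => ?_
    obtain ⟨a, ha, rfl⟩ := hy
    have : ⟪x, c • a⟫_ℝ = ⟪c • x, a⟫_ℝ := by
      rw [real_inner_smul_left, real_inner_smul_right]
    change ⟪x, c • a⟫_ℝ ≤ _
    rw [this]; exact inner_le_supp ha
  · obtain ⟨a, ha, h⟩ := exists_inner_eq_supp K (c • x)
    rw [← h, real_inner_smul_left, ← real_inner_smul_right]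
    exact inner_le_supp ⟨a, ha, rfl⟩

lemma supp_scale (K : ConvexBody (En n)) {c : ℝ} (hc : 0 ≤ c) (x : En n) :
    supp (scale c K) x = c * supp K x := by
  rw [supp_scale_gen, supp_smul K hc]

lemma supp_rotate (ρ : En n ≃ₗᵢ[ℝ] En n) (K : ConvexBody (En n)) (x : En n) :
    supp (rotate ρ K) x = supp K (ρ.symm x) := by
  have key : ∀ a, ⟪x, ρ a⟫_ℝ = ⟪ρ.symm x, a⟫_ℝ := fun a => by
    rw [← ρ.inner_map_map (ρ.symm x) a, ρ.apply_symm_apply]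
  apply le_antisymm
  · refine supp_le fun y hy => ?_
    obtain ⟨a, ha, rfl⟩ := hy
    rw [key]; exact inner_le_supp ha
  · obtain ⟨a, ha, h⟩ := exists_inner_eq_supp K (ρ.symm x)
    rw [← h, ← key]
    exact inner_le_supp ⟨a, ha, rfl⟩

@[simp] lemma supp_ballB (x : En n) : supp (ballB n) x = ‖x‖ := by
  apply le_antisymm
  · refine supp_le fun y hy => ?_
    have : ‖y‖ ≤ 1 := mem_closedBall_zero_iff.1 hy
    calc ⟪x, y⟫_ℝ ≤ ‖x‖ * ‖y‖ := real_inner_le_norm x y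
      _ ≤ ‖x‖ * 1 := by gcongr
      _ = ‖x‖ := mul_one _
  · by_cases hx : x = 0
    · simp [hx]
    have hx' : ‖x‖ ≠ 0 := norm_ne_zero_iff.2 hx
    have h1 : (‖x‖⁻¹ • x) ∈ ((ballB n : ConvexBody (En n)) : Set (En n)) := by
      change _ ∈ closedBall (0 : En n) 1
      simp [norm_smul, hx']
    have := inner_le_supp (x := x) h1
    rwa [real_inner_smul_right, real_inner_self_eq_norm_sq, sq, ← mul_assoc,
      inv_mul_cancel₀ hx', one_mul] at this

lemma mem_of_inner_le_supp {K : ConvexBody (En n)} {y : En n}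
    (h : ∀ x, ⟪x, y⟫_ℝ ≤ supp K x) : y ∈ (K : Set (En n)) := by
  by_contra hy
  obtain ⟨f, u, h1, h2⟩ := geometric_hahn_banach_closed_point K.convex
    K.isCompact.isClosed hy
  let x := (InnerProductSpace.toDual ℝ (En n)).symm f
  have hx : ∀ z, ⟪x, z⟫_ℝ = f z := fun z => InnerProductSpace.toDual_symm_apply
  have h3 := h x
  rw [hx] at h3
  obtain ⟨z, hz, hz'⟩ := exists_inner_eq_supp K x
  have := h1 z hz
  rw [hx] at hz'
  linarith

lemma subset_of_supp_le {K L : ConvexBody (En n)} (h : ∀ x, supp K x ≤ supp L x) :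
    (K : Set (En n)) ⊆ L := fun _ hy =>
  mem_of_inner_le_supp fun x => (inner_le_supp hy).trans (h x)

lemma supp_mono {K L : ConvexBody (En n)} (h : (K : Set (En n)) ⊆ L) (x : En n) :
    supp K x ≤ supp L x :=
  supp_le fun _ hy => inner_le_supp (h hy)

lemma body_ext {K L : ConvexBody (En n)} (h : ∀ x, supp K x = supp L x) : K = L :=
  SetLike.coe_injective
    ((subset_of_supp_le fun x => (h x).le).antisymm (subset_of_supp_le fun x => (h x).ge))

lemma supp_eq_norm_mul (K : ConvexBody (En n)) (x : En n) :
    supp K x = ‖x‖ * supp K (‖x‖⁻¹ • x) := by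
  by_cases hx : x = 0
  · simp [hx]
  rw [supp_smul K (by positivity), ← mul_assoc, mul_inv_cancel₀ (norm_ne_zero_iff.2 hx), one_mul]

lemma supp_le_of_sphere {K L : ConvexBody (En n)}
    (h : ∀ u : Sph n, supp K (u : En n) ≤ supp L (u : En n)) (x : En n) :
    supp K x ≤ supp L x := by
  by_cases hx : x = 0
  · simp [hx]
  rw [supp_eq_norm_mul K, supp_eq_norm_mul L]
  have : ‖‖x‖⁻¹ • x‖ = 1 := by simp [norm_smul, norm_ne_zero_iff.2 hx]
  exact mul_le_mul_of_nonneg_left (h ⟨‖x‖⁻¹ • x, by simpa using this⟩) (norm_nonneg _)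

lemma exists_supp_le_norm (K : ConvexBody (En n)) :
    ∃ R : ℝ, 0 < R ∧ ∀ x, |supp K x| ≤ R * ‖x‖ := by
  obtain ⟨R, hR⟩ := K.isCompact.isBounded.exists_norm_le
  refine ⟨max R 1, by positivity, fun x => ?_⟩
  obtain ⟨y, hy, h⟩ := exists_inner_eq_supp K x
  rw [← h]
  calc |⟪x, y⟫_ℝ| ≤ ‖x‖ * ‖y‖ := abs_real_inner_le_norm x y
    _ ≤ ‖x‖ * max R 1 := by gcongr; exact (hR y hy).trans (le_max_left _ _)
    _ = _ := mul_comm _ _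

lemma continuous_supp (K : ConvexBody (En n)) : Continuous (supp K) := by
  obtain ⟨R, hR0, hR⟩ := exists_supp_le_norm K
  refine (LipschitzWith.of_le_add_mul ⟨R, hR0.le⟩ fun x y => ?_).continuous
  have h1 := supp_add_le K y (x - y)
  rw [add_sub_cancel] at h1
  have h2 := (le_abs_self _).trans (hR (x - y))
  rw [dist_eq_norm]
  change _ ≤ _ + R * _
  linarith

/-- The convex body with a given sublinear support function. -/
def ofSublinear (p : En n → ℝ) (R : ℝ) (hadd : ∀ x y, p (x + y) ≤ p x + p y)
    (hsmul : ∀ c : ℝ, 0 < c → ∀ x, p (c • x) = c * p x) (hR : ∀ x, p x ≤ R * ‖x‖) :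
    ConvexBody (En n) where
  carrier := {y | ∀ x, ⟪x, y⟫_ℝ ≤ p x}
  convex' := by
    intro y hy z hz a b ha hb hab x
    rw [inner_add_right, real_inner_smul_right, real_inner_smul_right]
    calc a * ⟪x, y⟫_ℝ + b * ⟪x, z⟫_ℝ ≤ a * p x + b * p x := by
          gcongr
          · exact hy x
          · exact hz x
      _ = p x := by rw [← add_mul, hab, one_mul]
  isCompact' := by
    refine Metric.isCompact_of_isClosed_isBounded ?_ ?_
    · rw [Set.ofPred_forall]
      exact isClosed_iInter fun x => isClosed_le (by fun_prop) continuous_const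
    · refine (Metric.isBounded_closedBall (x := (0 : En n)) (r := |R|)).subset fun y hy => ?_
      have h1 := (hy y).trans (hR y)
      rw [real_inner_self_eq_norm_sq, sq] at h1
      rw [mem_closedBall_zero_iff]
      by_contra h
      push Not at h
      have h0 : 0 < ‖y‖ := (abs_nonneg R).trans_lt h
      have := (mul_le_mul_iff_left₀ h0).1 h1
      exact absurd (this.trans (le_abs_self R)) (not_le.2 h)
  nonempty' := by
    have h0 : 0 ≤ p 0 := by have := hadd 0 0; rw [add_zero] at this; linarith
    obtain ⟨f, -, hf⟩ := exists_extension_of_le_sublinear (E := En n) ⟨⊥, 0⟩ p hsmul hadd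
      (by rintro ⟨x, hx⟩; obtain rfl := (Submodule.mem_bot ℝ).1 hx; simpa using h0)
    refine ⟨(InnerProductSpace.toDual ℝ (En n)).symm f.toContinuousLinearMap, fun x => ?_⟩
    rw [real_inner_comm, InnerProductSpace.toDual_symm_apply]
    exact hf x

lemma supp_ofSublinear (p : En n → ℝ) (R : ℝ) (hadd : ∀ x y, p (x + y) ≤ p x + p y)
    (hsmul : ∀ c : ℝ, 0 < c → ∀ x, p (c • x) = c * p x) (hR : ∀ x, p x ≤ R * ‖x‖) (x : En n) :
    supp (ofSublinear p R hadd hsmul hR) x = p x := by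
  refine le_antisymm (supp_le fun y hy => hy x) ?_
  have h0 : p 0 = 0 := by have := hsmul 2 two_pos 0; rw [smul_zero] at this; linarith
  have hneg : ∀ c : ℝ, c * p x ≤ p (c • x) := fun c => by
    rcases lt_trichotomy c 0 with hc | rfl | hc
    · have h1 := hadd (c • x) ((-c) • x)
      rw [← add_smul, add_neg_cancel, zero_smul, h0, hsmul (-c) (by linarith)] at h1
      linarith
    · simp [h0]
    · rw [hsmul c hc]
  by_cases hx : x = 0
  · rw [hx, h0, supp_zero_right]
  let fp : En n →ₗ.[ℝ] ℝ := LinearPMap.mkSpanSingleton x (p x) hx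
  obtain ⟨f, hf1, hf⟩ := exists_extension_of_le_sublinear (E := En n) fp p hsmul hadd
      (by
        rintro ⟨y, hy⟩
        obtain ⟨c, rfl⟩ := Submodule.mem_span_singleton.1 hy
        change (LinearPMap.mkSpanSingleton x (p x) hx) ⟨c • x, hy⟩ ≤ p (c • x)
        refine (LinearPMap.mkSpanSingleton'_apply x (p x) _ c hy).trans_le ?_
        simpa using hneg c)
  have hfx : f x = p x := by
    have h1 := hf1 ⟨x, Submodule.mem_span_singleton_self x⟩
    rw [LinearPMap.mkSpanSingleton_apply] at h1
    exact h1
  rw [← hfx]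
  have hm : (InnerProductSpace.toDual ℝ (En n)).symm f.toContinuousLinearMap ∈
      ((ofSublinear p R hadd hsmul hR : ConvexBody (En n)) : Set (En n)) := fun z => by
    rw [real_inner_comm, InnerProductSpace.toDual_symm_apply]
    exact hf z
  have := inner_le_supp (x := x) hm
  rwa [real_inner_comm, InnerProductSpace.toDual_symm_apply] at this

lemma supp_sum {ι : Type*} (s : Finset ι) (Ks : ι → ConvexBody (En n)) (x : En n) :
    supp (∑ k ∈ s, Ks k) x = ∑ k ∈ s, supp (Ks k) x := by
  classical
  induction s using Finset.induction_on with
  | empty => simp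
  | insert a s ha ih => rw [Finset.sum_insert ha, Finset.sum_insert ha, supp_add, ih]

section

lemma sum_superset_neg_one_pow {m : ℕ} (T : Finset (Fin m)) :
    ∑ S : Finset (Fin m), (if T ⊆ S then (-1 : ℝ) ^ (m - S.card) else 0) =
      if T = Finset.univ then 1 else 0 := by
  classical
  have h1 : ∑ S : Finset (Fin m), (if T ⊆ S then (-1 : ℝ) ^ (m - S.card) else 0) =
      ∑ S : Finset (Fin m), (if S ⊆ Tᶜ then (-1 : ℝ) ^ S.card else 0) := by
    refine Fintype.sum_bijective compl compl_bijective _ _ fun S => ?_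
    simp only [Finset.compl_subset_compl, Finset.card_compl, Fintype.card_fin]
  rw [h1, ← Finset.sum_filter]
  have h2 : Finset.univ.filter (fun S : Finset (Fin m) => S ⊆ Tᶜ) = Tᶜ.powerset := by
    ext S; simp
  rw [h2]
  have h3 := Finset.sum_powerset_neg_one_pow_card (x := Tᶜ)
  have h4 : ∑ S ∈ Tᶜ.powerset, (-1 : ℝ) ^ S.card = ((∑ S ∈ Tᶜ.powerset, (-1 : ℤ) ^ S.card : ℤ) : ℝ) := by
    push_cast; rfl
  rw [h4, h3]
  by_cases h : T = Finset.univ <;> simp [h, Finset.compl_eq_empty_iff]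

lemma det_sum_rows {m : ℕ} (A : Fin m → Matrix (Fin m) (Fin m) ℝ) (S : Finset (Fin m)) :
    (∑ k ∈ S, A k).det = ∑ r : Fin m → Fin m,
      if Finset.univ.image r ⊆ S then (Matrix.of fun j => A (r j) j).det else 0 := by
  classical
  have h1 : (∑ k ∈ S, A k).det = Matrix.detRowAlternating.toMultilinearMap
      (fun j => ∑ k ∈ S, A k j) := by
    change Matrix.det _ = Matrix.det _
    congr 1
    ext j l
    simp [Matrix.sum_apply]
  rw [h1, MultilinearMap.map_sum_finset, ← Finset.sum_filter]
  refine Finset.sum_congr ?_ fun r _ => rfl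
  ext r
  simp [Finset.image_subset_iff, Fintype.mem_piFinset]

lemma mixedDisc_eq_sum_perm {m : ℕ} (A : Fin m → Matrix (Fin m) (Fin m) ℝ) :
    mixedDisc A = ((m.factorial : ℝ))⁻¹ *
      ∑ σ : Equiv.Perm (Fin m), (Matrix.of fun j => A (σ j) j).det := by
  classical
  unfold mixedDisc
  congr 1
  simp_rw [det_sum_rows, Finset.mul_sum]
  rw [Finset.sum_comm]
  have h1 : ∀ r : Fin m → Fin m, ∑ S : Finset (Fin m), (-1 : ℝ) ^ (m - S.card) *
      (if Finset.univ.image r ⊆ S then (Matrix.of fun j => A (r j) j).det else 0) =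
      if Function.Bijective r then (Matrix.of fun j => A (r j) j).det else 0 := fun r => by
    have h2 : ∀ S : Finset (Fin m), (-1 : ℝ) ^ (m - S.card) *
      (if Finset.univ.image r ⊆ S then (Matrix.of fun j => A (r j) j).det else 0) =
      (if Finset.univ.image r ⊆ S then (-1 : ℝ) ^ (m - S.card) else 0) *
        (Matrix.of fun j => A (r j) j).det := fun S => by split_ifs <;> simp
    simp_rw [h2]
    rw [← Finset.sum_mul, sum_superset_neg_one_pow]
    have h3 : Finset.univ.image r = Finset.univ ↔ Function.Bijective r := by
      rw [← Finite.surjective_iff_bijective, Finset.eq_univ_iff_forall]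
      simp [Function.Surjective]
    simp [h3]
  simp_rw [h1]
  rw [← Finset.sum_filter]
  symm
  refine Finset.sum_bij' (fun σ _ => (σ : Fin m → Fin m))
    (fun r hr => Equiv.ofBijective r (Finset.mem_filter.1 hr).2) ?_ ?_ ?_ ?_ ?_
  · intro σ _; exact Finset.mem_filter.2 ⟨Finset.mem_univ _, σ.bijective⟩
  · intro r _; simp
  · intro σ _; ext; simp
  · intro r _; rfl
  · intro σ _; rfl

lemma of_update_eq {m : ℕ} (A : Fin m → Matrix (Fin m) (Fin m) ℝ) (k : Fin m)
    (X : Matrix (Fin m) (Fin m) ℝ) (σ : Equiv.Perm (Fin m)) :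
    (Matrix.of fun j => Function.update A k X (σ j) j) =
      Matrix.updateRow (Matrix.of fun j => A (σ j) j) (σ.symm k) (X (σ.symm k)) := by
  ext j l
  by_cases h : j = σ.symm k
  · subst h; simp
  · have h' : σ j ≠ k := fun h2 => h (by rw [← h2, Equiv.symm_apply_apply])
    simp [Matrix.updateRow_ne h, Function.update_of_ne h']

lemma mixedDisc_update_add {m : ℕ} (A : Fin m → Matrix (Fin m) (Fin m) ℝ) (k : Fin m)
    (X Y : Matrix (Fin m) (Fin m) ℝ) :
    mixedDisc (Function.update A k (X + Y)) =
      mixedDisc (Function.update A k X) + mixedDisc (Function.update A k Y) := by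
  simp only [mixedDisc_eq_sum_perm, of_update_eq, ← mul_add, ← Finset.sum_add_distrib]
  congr 1
  refine Finset.sum_congr rfl fun σ _ => ?_
  exact Matrix.det_updateRow_add _ _ _ _

lemma mixedDisc_update_smul {m : ℕ} (A : Fin m → Matrix (Fin m) (Fin m) ℝ) (k : Fin m)
    (c : ℝ) (X : Matrix (Fin m) (Fin m) ℝ) :
    mixedDisc (Function.update A k (c • X)) = c * mixedDisc (Function.update A k X) := by
  simp only [mixedDisc_eq_sum_perm, of_update_eq]
  rw [mul_left_comm c, Finset.mul_sum Finset.univ _ c]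
  congr 1
  refine Finset.sum_congr rfl fun σ _ => ?_
  exact Matrix.det_updateRow_smul _ _ _ _

lemma mixedDisc_const {m : ℕ} (A : Matrix (Fin m) (Fin m) ℝ) :
    mixedDisc (fun _ => A) = A.det := by
  rw [mixedDisc_eq_sum_perm]
  have : (Matrix.of fun j => A j) = A := rfl
  simp only [this, Finset.sum_const, Finset.card_univ, Fintype.card_perm, Fintype.card_fin,
    nsmul_eq_mul]
  rw [← mul_assoc, inv_mul_cancel₀ (by positivity), one_mul]

lemma mixedDisc_eq_zero_of_outer {m : ℕ} (A : Fin m → Matrix (Fin m) (Fin m) ℝ) {j k : Fin m}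
    (hjk : j ≠ k) (u : En m) {a b : ℝ} (hj : A j = a • outer u) (hk : A k = b • outer u) :
    mixedDisc A = 0 := by
  rw [mixedDisc_eq_sum_perm, Finset.sum_eq_zero, mul_zero]
  intro σ _
  set M := Matrix.of fun l => A (σ l) l with hM
  have hj' : M (σ.symm j) = (a * u (σ.symm j)) • (fun l => u l) := by
    ext l; simp [hM, hj, outer, mul_assoc]
  have hk' : M (σ.symm k) = (b * u (σ.symm k)) • (fun l => u l) := by
    ext l; simp [hM, hk, outer, mul_assoc]
  have hne : σ.symm j ≠ σ.symm k := fun h => hjk (σ.symm.injective h)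
  have h1 : M = (M.updateRow (σ.symm j) (fun l => u l)).updateRow (σ.symm j)
      ((a * u (σ.symm j)) • (fun l => u l)) := by
    rw [Matrix.updateRow_idem, ← hj', Matrix.updateRow_eq_self]
  rw [h1, Matrix.det_updateRow_smul, Matrix.updateRow_idem]
  set N := M.updateRow (σ.symm j) (fun l => u l) with hN
  have h2 : N = (N.updateRow (σ.symm k) (fun l => u l)).updateRow (σ.symm k)
      ((b * u (σ.symm k)) • (fun l => u l)) := by
    rw [Matrix.updateRow_idem, ← hk']
    have : M (σ.symm k) = N (σ.symm k) := by rw [hN, Matrix.updateRow_ne hne.symm]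
    rw [this, Matrix.updateRow_eq_self]
  rw [h2, Matrix.det_updateRow_smul, Matrix.updateRow_idem,
    Matrix.det_zero_of_row_eq hne, mul_zero, mul_zero]
  rw [Matrix.updateRow_self, Matrix.updateRow_ne hne, hN, Matrix.updateRow_self]

lemma continuous_mixedDisc {m : ℕ} :
    Continuous (mixedDisc : (Fin m → Matrix (Fin m) (Fin m) ℝ) → ℝ) := by
  unfold mixedDisc
  refine continuous_const.mul (continuous_finsetSum _ fun S _ => continuous_const.mul ?_)
  exact (continuous_finsetSum _ fun k _ => continuous_apply k).matrix_det

open scoped MatrixOrder Matrix.Norms.L2Operator in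
lemma mixedDisc_nonneg {m : ℕ} (A : Fin m → Matrix (Fin m) (Fin m) ℝ)
    (hA : ∀ k, (A k).PosSemidef) : 0 ≤ mixedDisc A := by
  classical
  have h1 : ∀ k, ∃ C : Matrix (Fin m) (Fin m) ℝ, A k = C.transpose * C := fun k => by
    obtain ⟨C, hC⟩ := CStarAlgebra.nonneg_iff_eq_star_mul_self.mp (hA k).nonneg
    exact ⟨C, by rw [hC, Matrix.star_eq_conjTranspose,
      Matrix.conjTranspose_eq_transpose_of_trivial]⟩
  choose C hC using h1
  rw [mixedDisc_eq_sum_perm]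
  refine mul_nonneg (by positivity) ?_
  have h2 : ∀ σ : Equiv.Perm (Fin m), (Matrix.of fun j => A (σ j) j).det =
      ∑ l : Fin m → Fin m, (∏ j, C (σ j) (l (σ j)) j) *
        (Matrix.of fun j => C (σ j) (l (σ j))).det := fun σ => by
    have h3 : (Matrix.of fun j => A (σ j) j).det = Matrix.detRowAlternating.toMultilinearMap
      (fun j => ∑ l : Fin m, C (σ j) l j • C (σ j) l) := by
      change Matrix.det _ = Matrix.det _
      congr 1
      ext j l
      simp [hC, Matrix.mul_apply, Finset.sum_apply]
    rw [h3, MultilinearMap.map_sum]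
    rw [← (Equiv.arrowCongr σ (Equiv.refl (Fin m))).symm.sum_comp]
    refine Finset.sum_congr rfl fun l _ => ?_
    rw [MultilinearMap.map_smul_univ]
    rfl
  simp_rw [h2]
  rw [Finset.sum_comm]
  refine Finset.sum_nonneg fun l _ => ?_
  have h4 : ∀ σ : Equiv.Perm (Fin m), (Matrix.of fun j => C (σ j) (l (σ j))).det =
      (Equiv.Perm.sign σ : ℝ) * (Matrix.of fun j => C j (l j)).det := fun σ => by
    rw [← Matrix.det_permute]; rfl
  simp_rw [h4]
  have h5 : ∑ σ : Equiv.Perm (Fin m), (∏ j, C (σ j) (l (σ j)) j) *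
      ((Equiv.Perm.sign σ : ℝ) * (Matrix.of fun j => C j (l j)).det) =
      (Matrix.of fun j => C j (l j)).det * (Matrix.of fun j => C j (l j)).det := by
    nth_rw 2 [Matrix.det_apply']
    rw [Finset.sum_mul]
    refine Finset.sum_congr rfl fun σ _ => ?_
    simp only [Matrix.of_apply]
    ring
  rw [h5]
  exact mul_self_nonneg _

lemma mixedVol_comp_perm (Ks : Fin n → ConvexBody (En n)) (τ : Equiv.Perm (Fin n)) :
    mixedVol (fun k => Ks (τ k)) = mixedVol Ks := by
  unfold mixedVol
  congr 1
  refine Fintype.sum_equiv (Equiv.finsetCongr τ) _ _ fun S => ?_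
  simp [Equiv.finsetCongr_apply, Finset.sum_map]

end

/-- The Hessian matrix expressed through the second Fréchet derivative. -/
def hmat (f : En n → ℝ) (x : En n) : Matrix (Fin n) (Fin n) ℝ :=
  Matrix.of fun j l => fderiv ℝ (fderiv ℝ f) x (EuclideanSpace.single j 1)
    (EuclideanSpace.single l 1)

/-- `f` is a `C²` convex function whose gradient image is dense in `K`. -/
structure Rep (K : ConvexBody (En n)) (f : En n → ℝ) : Prop where
  c2 : ContDiff ℝ 2 f
  le : ∀ x v, fderiv ℝ f x v ≤ supp K v
  psd : ∀ x v, 0 ≤ fderiv ℝ (fderiv ℝ f) x v v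
  low : ∃ C, ∀ x, supp K x - C ≤ f x

lemma hasDerivAt_line {f : En n → ℝ} (hf : Differentiable ℝ f) (x v : En n) (t : ℝ) :
    HasDerivAt (fun s : ℝ => f (x + s • v)) (fderiv ℝ f (x + t • v) v) t := by
  have h2 : HasDerivAt (fun s : ℝ => x + s • v) v t := by
    simpa using ((hasDerivAt_id t).smul_const v).const_add x
  exact (hf (x + t • v)).hasFDerivAt.comp_hasDerivAt t h2

lemma differentiable_fderiv {f : En n → ℝ} (hf : ContDiff ℝ 2 f) :
    Differentiable ℝ (fderiv ℝ f) :=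
  (hf.fderiv_right (m := 1) (by norm_num)).differentiable one_ne_zero

lemma hasDerivAt_line_fderiv {f : En n → ℝ} (hf : ContDiff ℝ 2 f) (x v w : En n) (t : ℝ) :
    HasDerivAt (fun s : ℝ => fderiv ℝ f (x + s • v) w)
      (fderiv ℝ (fderiv ℝ f) (x + t • v) v w) t := by
  have h2 : HasDerivAt (fun s : ℝ => x + s • v) v t := by
    simpa using ((hasDerivAt_id t).smul_const v).const_add x
  have h3 := (differentiable_fderiv hf (x + t • v)).hasFDerivAt.comp_hasDerivAt t h2
  exact h3.clm_apply (hasDerivAt_const t w) |>.congr_deriv (by simp)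

lemma sum_single (v : En n) : v = ∑ j, v j • EuclideanSpace.single j (1 : ℝ) := by
  ext l
  simp [Finset.sum_apply, Pi.single_apply]

lemma snd_symm {f : En n → ℝ} (hf : ContDiff ℝ 2 f) (x v w : En n) :
    fderiv ℝ (fderiv ℝ f) x v w = fderiv ℝ (fderiv ℝ f) x w v :=
  (hf.contDiffAt.isSymmSndFDerivAt (by simp)) v w

lemma hmat_quad (f : En n → ℝ) (x v w : En n) :
    fderiv ℝ (fderiv ℝ f) x v w = ∑ j, ∑ l, v j * w l * hmat f x j l := by
  conv_lhs => rw [sum_single v, sum_single w]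
  simp only [map_sum, map_smul, _root_.sum_apply, _root_.smul_apply,
    smul_eq_mul, hmat, Matrix.of_apply]
  rw [Finset.sum_comm]
  simp only [Finset.mul_sum]
  refine Finset.sum_congr rfl fun j _ => Finset.sum_congr rfl fun l _ => ?_
  ring

lemma hmat_posSemidef {f : En n → ℝ} (hf : ContDiff ℝ 2 f) {x : En n}
    (h : ∀ v, 0 ≤ fderiv ℝ (fderiv ℝ f) x v v) : (hmat f x).PosSemidef := by
  refine Matrix.PosSemidef.of_dotProduct_mulVec_nonneg ?_ fun v => ?_
  · ext j l
    simp only [hmat, Matrix.conjTranspose_apply, Matrix.of_apply, star_trivial]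
    exact snd_symm hf _ _ _
  · have := h (WithLp.toLp 2 v)
    rw [hmat_quad] at this
    simpa [dotProduct, Matrix.mulVec, Finset.mul_sum, mul_assoc, mul_comm, mul_left_comm] using this

lemma Rep.posSemidef {K : ConvexBody (En n)} {f : En n → ℝ} (h : Rep K f) (x : En n) :
    (hmat f x).PosSemidef := hmat_posSemidef h.c2 (h.psd x)

lemma continuous_hmat {f : En n → ℝ} (hf : ContDiff ℝ 2 f) : Continuous (hmat f) := by
  have h1 : Continuous (fderiv ℝ (fderiv ℝ f)) :=
    (hf.fderiv_right (m := 1) (by norm_num)).continuous_fderiv one_ne_zero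
  refine continuous_matrix fun j l => ?_
  exact (h1.clm_apply continuous_const).clm_apply continuous_const

/-- The identification of the dual of `ℝⁿ` with `ℝⁿ`. -/
def dualVec (n : ℕ) : (En n →L[ℝ] ℝ) →L[ℝ] En n :=
  ((EuclideanSpace.equiv (Fin n) ℝ).symm : (Fin n → ℝ) →L[ℝ] En n).comp
    (ContinuousLinearMap.pi fun j =>
      ContinuousLinearMap.apply ℝ ℝ (EuclideanSpace.single j (1 : ℝ)))

lemma dualVec_apply (φ : En n →L[ℝ] ℝ) (j : Fin n) :
    dualVec n φ j = φ (EuclideanSpace.single j 1) := rfl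

lemma inner_dualVec (φ : En n →L[ℝ] ℝ) (v : En n) : ⟪v, dualVec n φ⟫_ℝ = φ v := by
  conv_rhs => rw [sum_single v]
  simp [PiLp.inner_apply, dualVec_apply, mul_comm]

lemma det_dualVec_comp {f : En n → ℝ} (x : En n) :
    ((dualVec n).comp (fderiv ℝ (fderiv ℝ f) x)).det = (hmat f x).det := by
  rw [ContinuousLinearMap.det, ← LinearMap.det_toMatrix (EuclideanSpace.basisFun (Fin n) ℝ).toBasis,
    ← Matrix.det_transpose]
  congr 1

lemma hasFDerivAt_gradient {f : En n → ℝ} (hf : ContDiff ℝ 2 f) (x : En n) :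
    HasFDerivAt (fun y => dualVec n (fderiv ℝ f y))
      ((dualVec n).comp (fderiv ℝ (fderiv ℝ f) x)) x :=
  (dualVec n).hasFDerivAt.comp x (differentiable_fderiv hf x).hasFDerivAt

lemma gradient_injOn {f : En n → ℝ} (hf : ContDiff ℝ 2 f)
    (hpsd : ∀ x v, 0 ≤ fderiv ℝ (fderiv ℝ f) x v v) :
    Set.InjOn (fun y => dualVec n (fderiv ℝ f y)) {x | (hmat f x).det ≠ 0} := by
  intro x hx y _ hxy
  by_contra hne
  set w := y - x with hw
  have hw0 : w ≠ 0 := sub_ne_zero.2 (Ne.symm hne)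
  let φ : ℝ → ℝ := fun s => fderiv ℝ f (x + s • w) w
  have hφ : ∀ t, HasDerivAt φ (fderiv ℝ (fderiv ℝ f) (x + t • w) w w) t := fun t =>
    hasDerivAt_line_fderiv hf x w w t
  have hmono : Monotone φ := by
    refine monotone_of_deriv_nonneg (fun t => (hφ t).differentiableAt) fun t => ?_
    rw [(hφ t).deriv]; exact hpsd _ _
  have h01 : φ 0 = φ 1 := by
    have h3 : ⟪w, dualVec n (fderiv ℝ f x)⟫_ℝ = ⟪w, dualVec n (fderiv ℝ f y)⟫_ℝ := by
      rw [show dualVec n (fderiv ℝ f x) = dualVec n (fderiv ℝ f y) from hxy]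
    rw [inner_dualVec, inner_dualVec] at h3
    simpa [φ, hw] using h3
  have hconst : ∀ t ∈ Set.Icc (0 : ℝ) 1, φ t = φ 0 := fun t ht =>
    le_antisymm (by rw [h01]; exact hmono ht.2) (hmono ht.1)
  have h4 : HasDerivWithinAt φ 0 (Set.Icc 0 1) 0 :=
    (hasDerivWithinAt_const (0 : ℝ) (Set.Icc 0 1) (φ 0)).congr (fun t ht => hconst t ht) rfl
  have h5 := (uniqueDiffOn_Icc (zero_lt_one' ℝ) 0 ⟨le_rfl, zero_le_one⟩).eq_deriv _ h4
    (hφ 0).hasDerivWithinAt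
  rw [zero_smul, add_zero] at h5
  have hP := hmat_posSemidef hf (hpsd x)
  have h6 : (hmat f x).mulVec w.ofLp = 0 := by
    rw [← hP.dotProduct_mulVec_zero_iff, h5, hmat_quad]
    simp [dotProduct, Matrix.mulVec, Finset.mul_sum, mul_comm, mul_left_comm]
  exact hx (Matrix.exists_mulVec_eq_zero_iff.1 ⟨w, fun h => hw0 (by ext j; exact congrFun h j), h6⟩)

lemma Rep.volume_eq {K : ConvexBody (En n)} {f : En n → ℝ} (h : Rep K f) :
    volume (K : Set (En n)) = ∫⁻ x, ENNReal.ofReal (hmat f x).det := by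
  set G := fun y => dualVec n (fderiv ℝ f y) with hG
  have hGd : ∀ x, HasFDerivAt G ((dualVec n).comp (fderiv ℝ (fderiv ℝ f) x)) x :=
    hasFDerivAt_gradient h.c2
  set s := {x | (hmat f x).det ≠ 0} with hs
  have hdetc : Continuous fun x => (hmat f x).det := (continuous_hmat h.c2).matrix_det
  have hsm : MeasurableSet s := (hdetc.measurable (measurableSet_singleton 0)).compl
  have hinj : Set.InjOn G s := gradient_injOn h.c2 h.psd
  have h1 := lintegral_abs_det_fderiv_eq_addHaar_image volume hsm
    (fun x _ => (hGd x).hasFDerivWithinAt) hinj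
  simp_rw [det_dualVec_comp, abs_of_nonneg ((h.posSemidef _).det_nonneg)] at h1
  have h2 : ∫⁻ x in s, ENNReal.ofReal (hmat f x).det = ∫⁻ x, ENNReal.ofReal (hmat f x).det := by
    have h0 : ∫⁻ x in sᶜ, ENNReal.ofReal (hmat f x).det = 0 := by
      refine setLIntegral_eq_zero hsm.compl fun x hx => ?_
      have : (hmat f x).det = 0 := by simpa [hs] using hx
      simp [this]
    have h4 := lintegral_add_compl (μ := volume) (fun x => ENNReal.ofReal (hmat f x).det) hsm
    rwa [h0, add_zero] at h4
  have h3 : volume (G '' sᶜ) = 0 :=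
    addHaar_image_eq_zero_of_det_fderivWithin_eq_zero volume
      (fun x _ => (hGd x).hasFDerivWithinAt) fun x hx => by
        rw [det_dualVec_comp]; simpa [hs] using hx
  have hsub : Set.range G ⊆ K := by
    rintro _ ⟨x, rfl⟩
    exact mem_of_inner_le_supp fun v => by
      rw [hG]; simp only []; rw [inner_dualVec]; exact h.le x v
  have hint : interior (K : Set (En n)) ⊆ Set.range G := by
    intro y hy
    obtain ⟨C, hC⟩ := h.low
    obtain ⟨r, hr, hball⟩ := Metric.nhds_basis_closedBall.mem_iff.1 (mem_interior_iff_mem_nhds.1 hy)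
    have hlow : ∀ x, r * ‖x‖ - C ≤ f x - ⟪x, y⟫_ℝ := fun x => by
      have h5 : ⟪x, y⟫_ℝ + r * ‖x‖ ≤ supp K x := by
        by_cases hx : x = 0
        · simp [hx]
        have hx' : ‖x‖ ≠ 0 := norm_ne_zero_iff.2 hx
        have h6 := inner_le_supp (x := x) (hball (a := y + (r * ‖x‖⁻¹) • x) (by
          rw [mem_closedBall, dist_eq_norm, add_sub_cancel_left, norm_smul, norm_mul,
            norm_inv, norm_norm, mul_assoc, inv_mul_cancel₀ hx', mul_one,
            Real.norm_of_nonneg hr.le]))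
        rw [inner_add_right, real_inner_smul_right, real_inner_self_eq_norm_sq] at h6
        have : r * ‖x‖⁻¹ * ‖x‖ ^ 2 = r * ‖x‖ := by field_simp
        linarith
      have := hC x
      linarith
    have htend : Tendsto (fun x => f x - ⟪x, y⟫_ℝ) (cocompact (En n)) atTop := by
      refine tendsto_atTop_mono hlow ?_
      exact tendsto_atTop_add_const_right _ _
        (tendsto_norm_cocompact_atTop.const_mul_atTop hr)
    obtain ⟨x, hx⟩ := Continuous.exists_forall_le
      (h.c2.continuous.sub (by fun_prop : Continuous fun x => ⟪x, y⟫_ℝ)) htend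
    refine ⟨x, ?_⟩
    have hd : HasFDerivAt (fun x => f x - ⟪x, y⟫_ℝ) (fderiv ℝ f x - innerSL ℝ y) x := by
      refine ((h.c2.differentiable two_ne_zero) x).hasFDerivAt.sub ?_
      have := (innerSL ℝ y).hasFDerivAt (x := x)
      refine this.congr_of_eventuallyEq (Eventually.of_forall fun z => ?_)
      simp [real_inner_comm]
    have h0 : fderiv ℝ f x - innerSL ℝ y = 0 :=
      (IsMinOn.isLocalMin (s := Set.univ) (isMinOn_univ_iff.2 hx) univ_mem).hasFDerivAt_eq_zero hd
    refine ext_inner_left ℝ fun v => ?_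
    rw [hG]; simp only []
    rw [inner_dualVec, sub_eq_zero.1 h0, innerSL_apply_apply, real_inner_comm]
  have hvol : volume (interior (K : Set (En n))) = volume (K : Set (En n)) := by
    have := K.convex.addHaar_frontier volume
    refine le_antisymm (measure_mono interior_subset) ?_
    calc volume (K : Set (En n)) ≤ volume (interior (K : Set (En n)) ∪ frontier (K : Set (En n))) := by
          refine measure_mono ?_
          rw [← closure_eq_interior_union_frontier]; exact subset_closure
      _ ≤ _ := measure_union_le _ _
      _ = _ := by rw [this, add_zero]
  rw [← h2, h1]
  refine le_antisymm ?_ (measure_mono ((Set.image_subset_range _ _).trans hsub))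
  rw [← hvol]
  calc volume (interior (K : Set (En n))) ≤ volume (G '' s ∪ G '' sᶜ) := by
        refine measure_mono ?_
        rw [← Set.image_union, Set.union_compl_self, Set.image_univ]; exact hint
    _ ≤ _ := measure_union_le _ _
    _ = _ := by rw [h3, add_zero]

lemma fderiv_line_le {f p : En n → ℝ} (hf : Differentiable ℝ f) {x v : En n}
    (h : ∀ t : ℝ, 0 < t → f (x + t • v) ≤ f x + t * p v) : fderiv ℝ f x v ≤ p v := by
  have h1 : HasDerivWithinAt (fun s : ℝ => f (x + s • v)) (fderiv ℝ f x v) (Set.Ioi 0) 0 := by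
    have := hasDerivAt_line hf x v 0
    rw [zero_smul, add_zero] at this
    exact this.hasDerivWithinAt
  rw [hasDerivWithinAt_iff_tendsto_slope' (by simp)] at h1
  refine le_of_tendsto h1 ?_
  filter_upwards [self_mem_nhdsWithin] with t ht
  have ht : 0 < t := ht
  rw [slope_def_field, sub_zero, zero_smul, add_zero, div_le_iff₀ ht]
  linarith [h t ht]

lemma snd_nonneg_of_convex {f : En n → ℝ} (hf : ContDiff ℝ 2 f) (hc : ConvexOn ℝ Set.univ f)
    (x v : En n) : 0 ≤ fderiv ℝ (fderiv ℝ f) x v v := by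
  have hd : ∀ t, HasDerivAt (fun s : ℝ => f (x + s • v)) (fderiv ℝ f (x + t • v) v) t :=
    hasDerivAt_line (hf.differentiable two_ne_zero) x v
  have hcv : ConvexOn ℝ Set.univ (fun s : ℝ => f (x + s • v)) := by
    refine ⟨convex_univ, fun s _ t _ a b ha hb hab => ?_⟩
    have h1 := hc.2 (Set.mem_univ (x + s • v)) (Set.mem_univ (x + t • v)) ha hb hab
    have h2 : a • (x + s • v) + b • (x + t • v) = x + (a • s + b • t) • v := by
      have : x = (a + b) • x := by rw [hab, one_smul]
      conv_rhs => rw [this]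
      simp only [smul_eq_mul]
      module
    rwa [h2] at h1
  have hm := hcv.monotoneOn_deriv fun t _ => (hd t).differentiableAt
  have heq : deriv (fun s : ℝ => f (x + s • v)) = fun t => fderiv ℝ f (x + t • v) v :=
    funext fun t => (hd t).deriv
  rw [heq, monotoneOn_univ] at hm
  have h3 := hasDerivAt_line_fderiv hf x v v 0
  rw [zero_smul, add_zero] at h3
  rw [← h3.deriv]
  exact hm.deriv_nonneg

lemma exists_rep (K : ConvexBody (En n)) : ∃ f, Rep K f := by
  let φ : ContDiffBump (0 : En n) := ⟨1, 2, one_pos, one_lt_two⟩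
  let ρ := φ.normed volume
  have hρ0 : ∀ t, 0 ≤ ρ t := φ.nonneg_normed
  have hρ1 : ∫ t, ρ t = 1 := φ.integral_normed
  have hρs : HasCompactSupport ρ := φ.hasCompactSupport_normed
  have hρc : Continuous ρ := φ.continuous_normed
  have hint : ∀ g : En n → ℝ, Continuous g → Integrable fun t => ρ t * g t := fun g hg =>
    (hρc.mul hg).integrable_of_hasCompactSupport hρs.mul_right
  let f : En n → ℝ := fun x => ∫ t, ρ t * supp K (x - t)
  have hc : ∀ x, Continuous fun t => supp K (x - t) := fun x =>
    (continuous_supp K).comp (by fun_prop)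
  have hf2 : ContDiff ℝ 2 f :=
    hρs.contDiff_convolution_left (ContinuousLinearMap.lsmul ℝ ℝ) (n := 2)
      φ.contDiff_normed (continuous_supp K).locallyIntegrable
  have hadd : ∀ x v, f (x + v) ≤ f x + supp K v := fun x v => by
    have h1 : f x + supp K v = ∫ t, (ρ t * supp K (x - t) + ρ t * supp K v) := by
      rw [integral_add (hint _ (hc x)) (hint _ continuous_const), integral_mul_const, hρ1, one_mul]
    rw [h1]
    refine integral_mono (hint _ (hc _)) ((hint _ (hc x)).add (hint _ continuous_const)) fun t => ?_
    simp only []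
    rw [← mul_add, show x + v - t = (x - t) + v by abel]
    exact mul_le_mul_of_nonneg_left (supp_add_le _ _ _) (hρ0 t)
  have hconv : ConvexOn ℝ Set.univ f := by
    refine ⟨convex_univ, fun x _ y _ a b ha hb hab => ?_⟩
    simp only [smul_eq_mul, f]
    rw [← integral_const_mul, ← integral_const_mul,
      ← integral_add ((hint _ (hc x)).const_mul a) ((hint _ (hc y)).const_mul b)]
    refine integral_mono (hint _ (hc _)) (((hint _ (hc x)).const_mul a).add
      ((hint _ (hc y)).const_mul b)) fun t => ?_
    have h2 : a • x + b • y - t = a • (x - t) + b • (y - t) := by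
      have : t = (a + b) • t := by rw [hab, one_smul]
      conv_lhs => rw [this]
      module
    have h3 := supp_add_le K (a • (x - t)) (b • (y - t))
    rw [supp_smul K ha, supp_smul K hb] at h3
    simp only [h2]
    nlinarith [mul_le_mul_of_nonneg_left h3 (hρ0 t)]
  refine ⟨f, hf2, fun x v => ?_, snd_nonneg_of_convex hf2 hconv, ∫ t, ρ t * supp K t, fun x => ?_⟩
  · refine fderiv_line_le (p := supp K) (hf2.differentiable two_ne_zero) fun t ht => ?_
    rw [← supp_smul K ht.le]; exact hadd _ _
  · have h1 : supp K x - ∫ t, ρ t * supp K t = ∫ t, (ρ t * supp K x - ρ t * supp K t) := by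
      rw [integral_sub (hint _ continuous_const) (hint _ (continuous_supp K)), integral_mul_const,
        hρ1, one_mul]
    rw [h1]
    refine integral_mono ((hint _ continuous_const).sub (hint _ (continuous_supp K)))
      (hint _ (hc x)) fun t => ?_
    have := supp_add_le K (x - t) t
    rw [sub_add_cancel] at this
    simp only []
    nlinarith [mul_le_mul_of_nonneg_left this (hρ0 t)]

lemma fderiv_fderiv_add {f g : En n → ℝ} (hf : ContDiff ℝ 2 f) (hg : ContDiff ℝ 2 g) (x : En n) :
    fderiv ℝ (fderiv ℝ (fun y => f y + g y)) x =
      fderiv ℝ (fderiv ℝ f) x + fderiv ℝ (fderiv ℝ g) x := by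
  have : fderiv ℝ (fun y => f y + g y) = fun y => fderiv ℝ f y + fderiv ℝ g y :=
    funext fun y => fderiv_fun_add (hf.differentiable two_ne_zero y)
      (hg.differentiable two_ne_zero y)
  rw [this, fderiv_fun_add (differentiable_fderiv hf x) (differentiable_fderiv hg x)]

lemma hmat_add {f g : En n → ℝ} (hf : ContDiff ℝ 2 f) (hg : ContDiff ℝ 2 g) (x : En n) :
    hmat (fun y => f y + g y) x = hmat f x + hmat g x := by
  ext j l
  simp only [hmat, fderiv_fderiv_add hf hg, Matrix.of_apply, Matrix.add_apply]
  rfl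

lemma Rep.add {K L : ConvexBody (En n)} {f g : En n → ℝ} (hf : Rep K f) (hg : Rep L g) :
    Rep (K + L) (fun x => f x + g x) where
  c2 := hf.c2.add hg.c2
  le x v := by
    rw [fderiv_fun_add (hf.c2.differentiable two_ne_zero x)
      (hg.c2.differentiable two_ne_zero x), supp_add]
    exact add_le_add (hf.le x v) (hg.le x v)
  psd x v := by
    rw [fderiv_fderiv_add hf.c2 hg.c2]
    exact add_nonneg (hf.psd x v) (hg.psd x v)
  low := by
    obtain ⟨C, hC⟩ := hf.low
    obtain ⟨D, hD⟩ := hg.low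
    refine ⟨C + D, fun x => ?_⟩
    rw [supp_add]; linarith [hC x, hD x]

lemma Rep.zero : Rep (0 : ConvexBody (En n)) (fun _ => 0) where
  c2 := contDiff_const
  le x v := by simp
  psd x v := by simp
  low := ⟨0, fun x => by simp⟩

lemma Rep.sum {ι : Type*} (s : Finset ι) {Ks : ι → ConvexBody (En n)} {f : ι → En n → ℝ}
    (h : ∀ k, Rep (Ks k) (f k)) :
    Rep (∑ k ∈ s, Ks k) (fun x => ∑ k ∈ s, f k x) ∧
      ∀ x, hmat (fun x => ∑ k ∈ s, f k x) x = ∑ k ∈ s, hmat (f k) x := by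
  classical
  induction s using Finset.induction_on with
  | empty =>
    simp only [Finset.sum_empty]
    refine ⟨Rep.zero, fun x => ?_⟩
    ext j l; simp [hmat]
  | insert a s ha ih =>
    simp only [Finset.sum_insert ha]
    refine ⟨(h a).add ih.1, fun x => ?_⟩
    rw [hmat_add (h a).c2 ih.1.c2, ih.2]

lemma Rep.integrable_det {K : ConvexBody (En n)} {f : En n → ℝ} (h : Rep K f) :
    Integrable (fun x => (hmat f x).det) ∧
      (volume (K : Set (En n))).toReal = ∫ x, (hmat f x).det := by
  have hc : Continuous fun x => (hmat f x).det := (continuous_hmat h.c2).matrix_det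
  have h0 : ∀ x, 0 ≤ (hmat f x).det := fun x => (h.posSemidef x).det_nonneg
  constructor
  · refine ⟨hc.aestronglyMeasurable, ?_⟩
    rw [hasFiniteIntegral_iff_ofReal (Eventually.of_forall h0), ← h.volume_eq]
    exact K.isCompact.measure_lt_top
  · rw [integral_eq_lintegral_of_nonneg_ae (Eventually.of_forall h0) hc.aestronglyMeasurable,
      h.volume_eq]

lemma mixedVol_eq_integral {Ks : Fin n → ConvexBody (En n)} {f : Fin n → En n → ℝ}
    (h : ∀ k, Rep (Ks k) (f k)) :
    Integrable (fun x => mixedDisc (fun k => hmat (f k) x)) ∧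
      mixedVol Ks = ∫ x, mixedDisc (fun k => hmat (f k) x) := by
  have hS : ∀ S : Finset (Fin n), Integrable (fun x => (∑ k ∈ S, hmat (f k) x).det) ∧
      (volume ((∑ k ∈ S, Ks k : ConvexBody (En n)) : Set (En n))).toReal =
        ∫ x, (∑ k ∈ S, hmat (f k) x).det := fun S => by
    obtain ⟨h1, h2⟩ := Rep.sum S h
    have := h1.integrable_det
    simpa only [h2] using this
  constructor
  · unfold mixedDisc
    exact (integrable_finsetSum _ fun S _ => (hS S).1.const_mul _).const_mul _
  · unfold mixedVol mixedDisc
    rw [integral_const_mul, integral_finsetSum _ fun S _ => (hS S).1.const_mul _]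
    congr 1
    refine Finset.sum_congr rfl fun S _ => ?_
    rw [integral_const_mul, (hS S).2]

lemma mixedVol_nonneg (Ks : Fin n → ConvexBody (En n)) : 0 ≤ mixedVol Ks := by
  choose f hf using fun k => exists_rep (Ks k)
  rw [(mixedVol_eq_integral hf).2]
  exact integral_nonneg fun x => mixedDisc_nonneg _ fun k => (hf k).posSemidef x

lemma rep_update {Ks : Fin n → ConvexBody (En n)} {f : Fin n → En n → ℝ}
    (h : ∀ k, Rep (Ks k) (f k)) (k : Fin n) {X : ConvexBody (En n)} {a : En n → ℝ}
    (ha : Rep X a) (j : Fin n) : Rep (Function.update Ks k X j) (Function.update f k a j) := by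
  by_cases hj : j = k
  · subst hj; simpa using ha
  · simpa [hj] using h j

lemma hmat_update (f : Fin n → En n → ℝ) (k : Fin n) (a : En n → ℝ) (x : En n) :
    (fun j => hmat (Function.update f k a j) x) =
      Function.update (fun j => hmat (f j) x) k (hmat a x) := by
  ext1 j
  by_cases hj : j = k
  · subst hj; simp
  · simp [hj]

lemma mixedVol_update_add (Ks : Fin n → ConvexBody (En n)) (k : Fin n) (X Y : ConvexBody (En n)) :
    mixedVol (Function.update Ks k (X + Y)) =
      mixedVol (Function.update Ks k X) + mixedVol (Function.update Ks k Y) := by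
  choose f hf using fun k => exists_rep (Ks k)
  obtain ⟨a, ha⟩ := exists_rep X
  obtain ⟨b, hb⟩ := exists_rep Y
  have h1 := mixedVol_eq_integral (rep_update hf k ha)
  have h2 := mixedVol_eq_integral (rep_update hf k hb)
  have h3 := mixedVol_eq_integral (rep_update hf k (ha.add hb))
  rw [h1.2, h2.2, h3.2, ← integral_add h1.1 h2.1]
  simp only [hmat_update, hmat_add ha.c2 hb.c2, mixedDisc_update_add]

lemma mixedVol_rotate (ρ : En n ≃ₗᵢ[ℝ] En n) (Ks : Fin n → ConvexBody (En n)) :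
    mixedVol (fun k => rotate ρ (Ks k)) = mixedVol Ks := by
  unfold mixedVol
  congr 1
  refine Finset.sum_congr rfl fun S _ => ?_
  have h1 : (∑ k ∈ S, rotate ρ (Ks k)) = rotate ρ (∑ k ∈ S, Ks k) :=
    body_ext fun x => by simp only [supp_rotate, supp_sum]
  have h2 : ∀ K : ConvexBody (En n), volume ((rotate ρ K : ConvexBody (En n)) : Set (En n)) =
      volume (K : Set (En n)) := fun K => by
    have h3 : ((rotate ρ K : ConvexBody (En n)) : Set (En n)) = ρ.symm ⁻¹' (K : Set (En n)) :=
      ρ.toEquiv.image_eq_preimage_symm _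
    rw [h3, ρ.symm.measurePreserving.measure_preimage K.isCompact.measurableSet.nullMeasurableSet]
  rw [h1, h2]

lemma hasFDerivAt_smul_fun {f : En n → ℝ} (hf : ContDiff ℝ 2 f) (c : ℝ) (x : En n) :
    fderiv ℝ (fun y => c * f y) x = c • fderiv ℝ f x :=
  ((hf.differentiable two_ne_zero x).hasFDerivAt.const_mul c).fderiv

lemma fderiv_fderiv_smul {f : En n → ℝ} (hf : ContDiff ℝ 2 f) (c : ℝ) (x : En n) :
    fderiv ℝ (fderiv ℝ (fun y => c * f y)) x = c • fderiv ℝ (fderiv ℝ f) x := by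
  have : fderiv ℝ (fun y => c * f y) = fun y => c • fderiv ℝ f y :=
    funext fun y => hasFDerivAt_smul_fun hf c y
  rw [this]
  exact ((differentiable_fderiv hf x).hasFDerivAt.const_smul c).fderiv

lemma Rep.scale {K : ConvexBody (En n)} {f : En n → ℝ} (hf : Rep K f) {c : ℝ} (hc : 0 ≤ c) :
    Rep (scale c K) (fun x => c * f x) where
  c2 := contDiff_const.mul hf.c2
  le x v := by
    rw [hasFDerivAt_smul_fun hf.c2, supp_scale K hc]
    exact mul_le_mul_of_nonneg_left (hf.le x v) hc
  psd x v := by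
    rw [fderiv_fderiv_smul hf.c2]
    exact mul_nonneg hc (hf.psd x v)
  low := by
    obtain ⟨C, hC⟩ := hf.low
    refine ⟨c * C, fun x => ?_⟩
    rw [supp_scale K hc]; nlinarith [mul_le_mul_of_nonneg_left (hC x) hc]

lemma mixedVol_update_scale (Ks : Fin n → ConvexBody (En n)) (k : Fin n) (X : ConvexBody (En n))
    {c : ℝ} (hc : 0 ≤ c) :
    mixedVol (Function.update Ks k (scale c X)) = c * mixedVol (Function.update Ks k X) := by
  choose f hf using fun k => exists_rep (Ks k)
  obtain ⟨a, ha⟩ := exists_rep X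
  have h1 := mixedVol_eq_integral (rep_update hf k ha)
  have h3 := mixedVol_eq_integral (rep_update hf k (ha.scale hc))
  rw [h1.2, h3.2, ← integral_const_mul]
  have h4 : ∀ x, hmat (fun y => c * a y) x = c • hmat a x := fun x => by
    ext j l
    simp only [hmat, fderiv_fderiv_smul ha.c2, Matrix.of_apply, Matrix.smul_apply]
    rfl
  simp only [hmat_update, h4, mixedDisc_update_smul]

lemma mixedVol_const (K : ConvexBody (En n)) :
    mixedVol (fun _ => K) = (volume (K : Set (En n))).toReal := by
  obtain ⟨f, hf⟩ := exists_rep K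
  rw [(mixedVol_eq_integral fun _ => hf).2, hf.integrable_det.2]
  simp only [mixedDisc_const]

/-- The logistic function. -/
def logistic (r : ℝ) : ℝ := Real.exp r / (1 + Real.exp r)

lemma hasDerivAt_softplus (r : ℝ) :
    HasDerivAt (fun r => Real.log (1 + Real.exp r)) (logistic r) r :=
  ((Real.hasDerivAt_exp r).const_add 1).log (by positivity)

lemma hasDerivAt_logistic (r : ℝ) :
    HasDerivAt logistic (Real.exp r / (1 + Real.exp r) ^ 2) r := by
  have := (Real.hasDerivAt_exp r).div ((Real.hasDerivAt_exp r).const_add 1)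
    (by positivity : 1 + Real.exp r ≠ 0)
  refine this.congr_deriv ?_
  ring

/-- A smooth maximum of two functions. -/
def softMax (a f : En n → ℝ) (N : ℝ) (x : En n) : ℝ :=
  f x + N + Real.log (1 + Real.exp (a x - f x - N))

lemma hasFDerivAt_sub_const {a f : En n → ℝ} (ha : ContDiff ℝ 2 a) (hf : ContDiff ℝ 2 f) (N : ℝ)
    (x : En n) : HasFDerivAt (fun x => a x - f x - N) (fderiv ℝ a x - fderiv ℝ f x) x :=
  ((ha.differentiable two_ne_zero x).hasFDerivAt.sub
    (hf.differentiable two_ne_zero x).hasFDerivAt).sub_const N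

lemma fderiv_softMax {a f : En n → ℝ} (ha : ContDiff ℝ 2 a) (hf : ContDiff ℝ 2 f) (N : ℝ)
    (x : En n) : fderiv ℝ (softMax a f N) x =
      fderiv ℝ f x + logistic (a x - f x - N) • (fderiv ℝ a x - fderiv ℝ f x) :=
  (((hf.differentiable two_ne_zero x).hasFDerivAt.add_const N).add
    ((hasDerivAt_softplus _).comp_hasFDerivAt x (hasFDerivAt_sub_const ha hf N x))).fderiv

lemma fderiv_fderiv_softMax {a f : En n → ℝ} (ha : ContDiff ℝ 2 a) (hf : ContDiff ℝ 2 f) (N : ℝ)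
    (x v w : En n) : fderiv ℝ (fderiv ℝ (softMax a f N)) x v w =
      fderiv ℝ (fderiv ℝ f) x v w + logistic (a x - f x - N) *
        (fderiv ℝ (fderiv ℝ a) x v w - fderiv ℝ (fderiv ℝ f) x v w) +
      Real.exp (a x - f x - N) / (1 + Real.exp (a x - f x - N)) ^ 2 *
        ((fderiv ℝ a x - fderiv ℝ f x) v * (fderiv ℝ a x - fderiv ℝ f x) w) := by
  have h1 : fderiv ℝ (softMax a f N) = fun x =>
      fderiv ℝ f x + logistic (a x - f x - N) • (fderiv ℝ a x - fderiv ℝ f x) :=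
    funext fun x => fderiv_softMax ha hf N x
  have h2 := (differentiable_fderiv hf x).hasFDerivAt.add
    (((hasDerivAt_logistic _).comp_hasFDerivAt x (hasFDerivAt_sub_const ha hf N x)).smul
      ((differentiable_fderiv ha x).hasFDerivAt.sub (differentiable_fderiv hf x).hasFDerivAt))
  rw [h1]
  erw [h2.fderiv]
  simp
  ring

lemma Rep.softMax {K K' : ConvexBody (En n)} {a f : En n → ℝ} (ha : Rep K' a) (hf : Rep K f)
    (h : (K : Set (En n)) ⊆ K') (N : ℝ) : Rep K' (softMax a f N) where
  c2 := by
    refine (hf.c2.add contDiff_const).add (ContDiff.log ?_ fun x => by positivity)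
    exact contDiff_const.add (((ha.c2.sub hf.c2).sub contDiff_const).exp)
  le x v := by
    rw [fderiv_softMax ha.c2 hf.c2]
    set s := logistic (a x - f x - N) with hs
    have h0 : 0 ≤ s := by rw [hs, logistic]; positivity
    have h1 : s ≤ 1 := by rw [hs, logistic, div_le_one (by positivity)]; linarith
    simp only [_root_.add_apply, _root_.smul_apply, _root_.sub_apply, smul_eq_mul]
    have h2 := ha.le x v
    have h3 := (hf.le x v).trans (supp_mono h v)
    nlinarith
  psd x v := by
    rw [fderiv_fderiv_softMax ha.c2 hf.c2]
    set s := logistic (a x - f x - N) with hs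
    have h0 : 0 ≤ s := by rw [hs, logistic]; positivity
    have h1 : s ≤ 1 := by rw [hs, logistic, div_le_one (by positivity)]; linarith
    have h2 := mul_nonneg h0 (ha.psd x v)
    have h3 := mul_nonneg (sub_nonneg.2 h1) (hf.psd x v)
    have h4 : 0 ≤ Real.exp (a x - f x - N) / (1 + Real.exp (a x - f x - N)) ^ 2 *
        ((fderiv ℝ a x - fderiv ℝ f x) v * (fderiv ℝ a x - fderiv ℝ f x) v) :=
      mul_nonneg (by positivity) (mul_self_nonneg _)
    nlinarith
  low := by
    obtain ⟨C, hC⟩ := ha.low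
    refine ⟨C, fun x => (hC x).trans ?_⟩
    have : a x - f x - N ≤ Real.log (1 + Real.exp (a x - f x - N)) := by
      rw [Real.le_log_iff_exp_le (by positivity)]; linarith
    rw [MinkIter.softMax]; linarith

lemma tendsto_hmat_softMax {a f : En n → ℝ} (ha : ContDiff ℝ 2 a) (hf : ContDiff ℝ 2 f)
    (x : En n) : Tendsto (fun N : ℕ => hmat (softMax a f N) x) atTop (𝓝 (hmat f x)) := by
  refine tendsto_pi_nhds.2 fun j => tendsto_pi_nhds.2 fun l => ?_
  have h1 : Tendsto (fun N : ℕ => a x - f x - (N : ℝ)) atTop atBot :=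
    tendsto_const_nhds.add_atBot (tendsto_neg_atTop_atBot.comp tendsto_natCast_atTop_atTop)
  have h2 : Tendsto (fun N : ℕ => Real.exp (a x - f x - (N : ℝ))) atTop (𝓝 0) :=
    Real.tendsto_exp_atBot.comp h1
  have h3 : Tendsto (fun N : ℕ => logistic (a x - f x - (N : ℝ))) atTop (𝓝 0) := by
    have := h2.div (h2.const_add 1) (by norm_num)
    simp only [add_zero, zero_div] at this
    exact this
  have h4 : Tendsto (fun N : ℕ => Real.exp (a x - f x - (N : ℝ)) /
      (1 + Real.exp (a x - f x - (N : ℝ))) ^ 2) atTop (𝓝 0) := by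
    have := h2.div ((h2.const_add 1).pow 2) (by norm_num)
    simp only [zero_div] at this
    exact this
  simp only [hmat, Matrix.of_apply, fderiv_fderiv_softMax ha hf]
  have := ((h3.mul_const (fderiv ℝ (fderiv ℝ a) x (EuclideanSpace.single j 1)
    (EuclideanSpace.single l 1) - fderiv ℝ (fderiv ℝ f) x (EuclideanSpace.single j 1)
    (EuclideanSpace.single l 1))).const_add (fderiv ℝ (fderiv ℝ f) x (EuclideanSpace.single j 1)
    (EuclideanSpace.single l 1))).add (h4.mul_const
    ((fderiv ℝ a x - fderiv ℝ f x) (EuclideanSpace.single j 1) *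
      (fderiv ℝ a x - fderiv ℝ f x) (EuclideanSpace.single l 1)))
  simpa using this

lemma mixedVol_update_mono (Ks : Fin n → ConvexBody (En n)) (k : Fin n) {X Y : ConvexBody (En n)}
    (h : (X : Set (En n)) ⊆ Y) :
    mixedVol (Function.update Ks k X) ≤ mixedVol (Function.update Ks k Y) := by
  choose f hf using fun k => exists_rep (Ks k)
  obtain ⟨b, hb⟩ := exists_rep X
  obtain ⟨a, ha⟩ := exists_rep Y
  have hX := mixedVol_eq_integral (rep_update hf k hb)
  have hY := fun N : ℕ => mixedVol_eq_integral (rep_update hf k (ha.softMax hb h N))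
  have hX0 : ∀ x, 0 ≤ mixedDisc (fun j => hmat (Function.update f k b j) x) := fun x =>
    mixedDisc_nonneg _ fun j => (rep_update hf k hb j).posSemidef x
  have hY0 : ∀ (N : ℕ) x, 0 ≤ mixedDisc (fun j => hmat (Function.update f k (softMax a b N) j) x) :=
    fun N x => mixedDisc_nonneg _ fun j => (rep_update hf k (ha.softMax hb h N) j).posSemidef x
  have hXl := ofReal_integral_eq_lintegral_ofReal hX.1 (Eventually.of_forall hX0)
  have hYl := fun N => ofReal_integral_eq_lintegral_ofReal (hY N).1 (Eventually.of_forall (hY0 N))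
  rw [← hX.2] at hXl
  simp only [← (hY _).2] at hYl
  have hlim : ∀ x, Tendsto (fun N : ℕ => ENNReal.ofReal
      (mixedDisc (fun j => hmat (Function.update f k (softMax a b N) j) x))) atTop
      (𝓝 (ENNReal.ofReal (mixedDisc (fun j => hmat (Function.update f k b j) x)))) := fun x => by
    refine ENNReal.tendsto_ofReal ((continuous_mixedDisc.tendsto _).comp ?_)
    simp only [hmat_update]
    refine tendsto_pi_nhds.2 fun j => ?_
    by_cases hj : j = k
    · subst hj
      simpa using tendsto_hmat_softMax ha.c2 hb.c2 x
    · simp [hj]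
  rw [← ENNReal.ofReal_le_ofReal_iff (mixedVol_nonneg _), hXl]
  calc _ = ∫⁻ x, liminf (fun N : ℕ => ENNReal.ofReal
      (mixedDisc (fun j => hmat (Function.update f k (softMax a b N) j) x))) atTop := by
        simp only [(hlim _).liminf_eq]
    _ ≤ liminf (fun N : ℕ => ∫⁻ x, ENNReal.ofReal
      (mixedDisc (fun j => hmat (Function.update f k (softMax a b N) j) x))) atTop := by
        refine lintegral_liminf_le fun N => ?_
        refine (ENNReal.continuous_ofReal.comp (continuous_mixedDisc.comp
          (continuous_pi fun j => continuous_hmat ?_))).measurable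
        exact (rep_update hf k (ha.softMax hb h N) j).c2
    _ = _ := by simp only [← hYl, liminf_const]

/-- The segment `[-u, u]`. -/
def seg (u : En n) : ConvexBody (En n) :=
  ofSublinear (fun x => |⟪u, x⟫_ℝ|) ‖u‖
    (fun x y => by rw [inner_add_right]; exact abs_add_le _ _)
    (fun c hc x => by rw [real_inner_smul_right, abs_mul, abs_of_pos hc])
    (fun x => abs_real_inner_le_norm u x)

@[simp] lemma supp_seg (u x : En n) : supp (seg u) x = |⟪u, x⟫_ℝ| := supp_ofSublinear _ _ _ _ _ _

lemma exists_rep_seg (u : En n) :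
    ∃ f, Rep (seg u) f ∧ ∀ x, ∃ c : ℝ, hmat f x = c • outer u := by
  let q : ℝ → ℝ := fun s => √(1 + s ^ 2)
  have hq0 : ∀ s, 0 < q s := fun s => Real.sqrt_pos.2 (by positivity)
  have hqs : ∀ s, q s ^ 2 = 1 + s ^ 2 := fun s => Real.sq_sqrt (by positivity)
  have hq : ∀ s, HasDerivAt q (s / q s) s := fun s => by
    have h1 : HasDerivAt (fun s : ℝ => 1 + s ^ 2) (2 * s) s := by
      simpa using (hasDerivAt_pow 2 s).const_add 1
    refine (h1.sqrt (by positivity)).congr_deriv ?_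
    change 2 * s / (2 * q s) = _
    rw [mul_div_mul_left _ _ two_ne_zero]
  have hq2 : ∀ s, HasDerivAt (fun s => s / q s) ((1 * q s - s * (s / q s)) / q s ^ 2) s := fun s =>
    (hasDerivAt_id s).div (hq s) (hq0 s).ne'
  have hq2' : ∀ s, 0 ≤ (1 * q s - s * (s / q s)) / q s ^ 2 := fun s => by
    refine div_nonneg ?_ (by positivity)
    have : 1 * q s - s * (s / q s) = 1 / q s := by
      have := (hq0 s).ne'
      field_simp
      rw [hqs]; ring
    rw [this]; exact (one_div_pos.2 (hq0 s)).le
  let f : En n → ℝ := fun x => q ⟪u, x⟫_ℝ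
  have hin : ∀ x, HasFDerivAt (fun x : En n => ⟪u, x⟫_ℝ) (innerSL ℝ u) x := fun x =>
    (innerSL ℝ u).hasFDerivAt
  have hf1 : fderiv ℝ f = fun x => (⟪u, x⟫_ℝ / q ⟪u, x⟫_ℝ) • innerSL ℝ u :=
    funext fun x => ((hq _).comp_hasFDerivAt x (hin x)).fderiv
  have hf2 : ∀ x v w, fderiv ℝ (fderiv ℝ f) x v w =
      ((1 * q ⟪u, x⟫_ℝ - ⟪u, x⟫_ℝ * (⟪u, x⟫_ℝ / q ⟪u, x⟫_ℝ)) / q ⟪u, x⟫_ℝ ^ 2) *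
        (⟪u, v⟫_ℝ * ⟪u, w⟫_ℝ) := fun x v w => by
    rw [hf1]
    have := ((hq2 ⟪u, x⟫_ℝ).comp_hasFDerivAt x (hin x)).smul_const (innerSL ℝ u)
    erw [this.fderiv]
    simp
    ring
  refine ⟨f, ⟨?_, fun x v => ?_, fun x v => ?_, 0, fun x => ?_⟩, fun x =>
    ⟨(1 * q ⟪u, x⟫_ℝ - ⟪u, x⟫_ℝ * (⟪u, x⟫_ℝ / q ⟪u, x⟫_ℝ)) / q ⟪u, x⟫_ℝ ^ 2, ?_⟩⟩
  · refine ContDiff.sqrt ?_ fun x => by positivity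
    exact contDiff_const.add ((innerSL ℝ u).contDiff.pow 2)
  · rw [hf1, supp_seg]
    simp only [_root_.smul_apply, innerSL_apply_apply, smul_eq_mul]
    refine (le_abs_self _).trans ?_
    rw [abs_mul]
    refine mul_le_of_le_one_left (abs_nonneg _) ?_
    rw [abs_div, abs_of_pos (hq0 _), div_le_one (hq0 _)]
    exact Real.abs_le_sqrt (by linarith)
  · rw [hf2]; exact mul_nonneg (hq2' _) (mul_self_nonneg _)
  · rw [supp_seg, sub_zero]; exact Real.abs_le_sqrt (by linarith)
  · ext j l
    simp only [hmat, Matrix.of_apply]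
    rw [hf2]
    simp [outer, EuclideanSpace.inner_single_right]

lemma mixedVol_seg_seg (Ks : Fin n → ConvexBody (En n)) {j k : Fin n} (hjk : j ≠ k) (u : En n)
    (hj : Ks j = seg u) (hk : Ks k = seg u) : mixedVol Ks = 0 := by
  obtain ⟨a, ha, hac⟩ := exists_rep_seg u
  have h1 : ∀ l, ∃ f, Rep (Ks l) f ∧ (l = j ∨ l = k → f = a) := fun l => by
    by_cases hl : l = j ∨ l = k
    · refine ⟨a, ?_, fun _ => rfl⟩
      rcases hl with rfl | rfl
      · rwa [hj]
      · rwa [hk]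
    · obtain ⟨f, hf⟩ := exists_rep (Ks l)
      exact ⟨f, hf, fun h => absurd h hl⟩
  choose f hf hfa using h1
  rw [(mixedVol_eq_integral hf).2]
  have : ∀ x, mixedDisc (fun l => hmat (f l) x) = 0 := fun x => by
    obtain ⟨c, hc⟩ := hac x
    exact mixedDisc_eq_zero_of_outer _ hjk u (by simp only [hfa j (Or.inl rfl)]; exact hc)
      (by simp only [hfa k (Or.inr rfl)]; exact hc)
  simp [this]

section

/-- The support function as a continuous function on the sphere. -/
def suppC (K : ConvexBody (En n)) : C(Sph n, ℝ) :=
  ⟨fun v => supp K v, (continuous_supp K).comp continuous_subtype_val⟩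

@[simp] lemma suppC_apply (K : ConvexBody (En n)) (v : Sph n) : suppC K v = supp K v := rfl

lemma suppC_add (K L : ConvexBody (En n)) : suppC (K + L) = suppC K + suppC L :=
  ContinuousMap.ext fun v => supp_add K L v

lemma supp_add_ball_le {K L : ConvexBody (En n)} {a : ℝ} (ha : 0 ≤ a)
    (h : ∀ v : Sph n, supp K v ≤ supp L v + a) (x : En n) :
    supp K x ≤ supp (L + scale a (ballB n)) x := by
  refine supp_le_of_sphere (fun u => ?_) x
  rw [supp_add, supp_scale _ ha, supp_ballB, norm_eq_of_mem_sphere, mul_one]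
  exact h u

/-- Differences of support functions. -/
def diffSet (n : ℕ) : Set C(Sph n, ℝ) := {f | ∃ K L, f = suppC K - suppC L}

/-- A body whose support function is the maximum of the two given ones. -/
def maxBody (K L : ConvexBody (En n)) : ConvexBody (En n) :=
  ofSublinear (fun x => max (supp K x) (supp L x))
    (max (exists_supp_le_norm K).choose (exists_supp_le_norm L).choose)
    (fun x y => max_le
      ((supp_add_le K x y).trans (add_le_add (le_max_left _ _) (le_max_left _ _)))
      ((supp_add_le L x y).trans (add_le_add (le_max_right _ _) (le_max_right _ _))))
    (fun c hc x => by rw [supp_smul K hc.le, supp_smul L hc.le, mul_max_of_nonneg _ _ hc.le])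
    (fun x => max_le
      (((le_abs_self _).trans ((exists_supp_le_norm K).choose_spec.2 x)).trans
        (mul_le_mul_of_nonneg_right (le_max_left _ _) (norm_nonneg _)))
      (((le_abs_self _).trans ((exists_supp_le_norm L).choose_spec.2 x)).trans
        (mul_le_mul_of_nonneg_right (le_max_right _ _) (norm_nonneg _))))

lemma supp_maxBody (K L : ConvexBody (En n)) (x : En n) :
    supp (maxBody K L) x = max (supp K x) (supp L x) := supp_ofSublinear _ _ _ _ _ _

/-- The one point body. -/
def pt (x : En n) : ConvexBody (En n) :=
  ⟨{x}, convex_singleton x, isCompact_singleton, Set.singleton_nonempty x⟩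

@[simp] lemma supp_pt (x y : En n) : supp (pt x) y = ⟪y, x⟫_ℝ := by
  simp [supp, pt]

lemma max_sub_sub (a b c d : ℝ) : max (a - b) (c - d) = max (a + d) (c + b) - (b + d) := by
  rcases le_total (a - b) (c - d) with h | h
  · rw [max_eq_right h, max_eq_right (by linarith)]; ring
  · rw [max_eq_left h, max_eq_left (by linarith)]; ring

lemma closure_diffSet : closure (diffSet n) = ⊤ := by
  have hneg : ∀ f ∈ diffSet n, -f ∈ diffSet n := by
    rintro f ⟨K, L, rfl⟩
    exact ⟨L, K, by rw [neg_sub]⟩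
  have hsup : ∀ᵉ (f ∈ diffSet n) (g ∈ diffSet n), f ⊔ g ∈ diffSet n := by
    rintro f ⟨K, L, rfl⟩ g ⟨M, N, rfl⟩
    refine ⟨maxBody (K + N) (M + L), L + N, ContinuousMap.ext fun v => ?_⟩
    simp only [ContinuousMap.sup_apply, ContinuousMap.sub_apply, suppC_apply, supp_maxBody,
      supp_add, max_sub_sub]
  refine ContinuousMap.sublattice_closure_eq_top _ ⟨0, 0, 0, by simp⟩ ?_ hsup ?_
  · intro f hf g hg
    have := hneg _ (hsup _ (hneg f hf) _ (hneg g hg))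
    have h2 : f ⊓ g = -(-f ⊔ -g) := by rw [neg_sup, neg_neg, neg_neg]
    rwa [h2]
  · intro v x y
    have key : ∀ a c : ℝ, ∃ f ∈ diffSet n, ∀ w : Sph n, f w = a + c * ⟪(x : En n), w⟫_ℝ := by
      intro a c
      refine ⟨_, ⟨pt (c • (x : En n)) + scale (max a 0) (ballB n), scale (max (-a) 0) (ballB n), rfl⟩,
        fun w => ?_⟩
      simp only [ContinuousMap.sub_apply, suppC_apply, supp_add, supp_pt,
        supp_scale _ (le_max_right _ _), supp_ballB, norm_eq_of_mem_sphere, mul_one,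
        real_inner_smul_right, real_inner_comm (x : En n)]
      rcases le_total a 0 with h | h
      · rw [max_eq_right h, max_eq_left (by linarith)]; ring
      · rw [max_eq_left h, max_eq_right (by linarith)]; ring
    by_cases hxy : x = y
    · subst hxy
      obtain ⟨f, hf, h⟩ := key (v x) 0
      exact ⟨f, hf, by simp [h], by simp [h]⟩
    · have hx : ⟪(x : En n), x⟫_ℝ = 1 := by
        rw [real_inner_self_eq_norm_sq, norm_eq_of_mem_sphere, one_pow]
      have hne : ⟪(x : En n), y⟫_ℝ ≠ 1 := fun h =>
        hxy (Subtype.ext ((inner_eq_one_iff_of_norm_eq_one (norm_eq_of_mem_sphere x)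
          (norm_eq_of_mem_sphere y)).1 h))
      have hne' : 1 - ⟪(x : En n), y⟫_ℝ ≠ 0 := sub_ne_zero.2 (Ne.symm hne)
      obtain ⟨f, hf, h⟩ := key (v x - (v x - v y) / (1 - ⟪(x : En n), y⟫_ℝ))
        ((v x - v y) / (1 - ⟪(x : En n), y⟫_ℝ))
      refine ⟨f, hf, by rw [h, hx]; ring, ?_⟩
      rw [h]; field_simp; ring

lemma eq_of_eq_on_supp {F G : C(Sph n, ℝ) → ℝ} (hF : Continuous F) (hG : Continuous G)
    (h : ∀ K L, F (suppC K - suppC L) = G (suppC K - suppC L)) (f : C(Sph n, ℝ)) : F f = G f := by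
  have h1 : IsClosed {f | F f = G f} := isClosed_eq hF hG
  have h2 : closure (diffSet n) ⊆ {f | F f = G f} := h1.closure_subset_iff.2 (by
    rintro f ⟨K, L, rfl⟩; exact h K L)
  exact h2 (by rw [closure_diffSet]; trivial)

/-- A functional on convex bodies behaving like a first mixed volume. -/
structure IsMixedFunctional (V : ConvexBody (En n) → ℝ) : Prop where
  add : ∀ K L, V (K + L) = V K + V L
  smul : ∀ K (c : ℝ), 0 ≤ c → V (scale c K) = c * V K
  mono : ∀ K L : ConvexBody (En n), (K : Set (En n)) ⊆ L → V K ≤ V L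

namespace IsMixedFunctional

variable {V : ConvexBody (En n) → ℝ} (hV : IsMixedFunctional V)

include hV

lemma le_of_supp_le {K L : ConvexBody (En n)} {a : ℝ} (ha : 0 ≤ a)
    (h : ∀ v : Sph n, supp K v ≤ supp L v + a) : V K ≤ V L + a * V (ballB n) := by
  rw [← hV.smul _ a ha, ← hV.add]
  exact hV.mono _ _ (subset_of_supp_le (supp_add_ball_le ha h))

lemma zero : V 0 = 0 := by
  have := hV.add 0 0
  rw [add_zero] at this; linarith

end IsMixedFunctional

/-- The sublinear majorant of a mixed functional on continuous functions. -/
def majorant (V : ConvexBody (En n) → ℝ) (f : C(Sph n, ℝ)) : ℝ :=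
  sInf {r | ∃ K L, f ≤ suppC K - suppC L ∧ r = V K - V L}

lemma majorant_bddBelow {V : ConvexBody (En n) → ℝ} (hV : IsMixedFunctional V) (f : C(Sph n, ℝ)) :
    BddBelow {r | ∃ K L, f ≤ suppC K - suppC L ∧ r = V K - V L} := by
  refine ⟨-(‖f‖ * V (ballB n)), ?_⟩
  rintro r ⟨K, L, h, rfl⟩
  have := hV.le_of_supp_le (K := L) (L := K) (norm_nonneg f) fun v => by
    have h1 : f v ≤ supp K v - supp L v := h v
    have h2 := (abs_le.1 (f.norm_coe_le_norm v)).1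
    linarith
  linarith

lemma majorant_le {V : ConvexBody (En n) → ℝ} (hV : IsMixedFunctional V) {f : C(Sph n, ℝ)}
    {K L : ConvexBody (En n)} (h : f ≤ suppC K - suppC L) : majorant V f ≤ V K - V L :=
  csInf_le (majorant_bddBelow hV f) ⟨K, L, h, rfl⟩

lemma majorant_nonempty (V : ConvexBody (En n) → ℝ) (f : C(Sph n, ℝ)) :
    {r | ∃ K L, f ≤ suppC K - suppC L ∧ r = V K - V L}.Nonempty := by
  refine ⟨_, scale ‖f‖ (ballB n), 0, fun v => ?_, rfl⟩
  have h2 := (abs_le.1 (f.norm_coe_le_norm v)).2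
  simpa [supp_scale _ (norm_nonneg f)] using h2

lemma exists_positive_functional {V : ConvexBody (En n) → ℝ} (hV : IsMixedFunctional V) :
    ∃ G : C(Sph n, ℝ) →ₗ[ℝ] ℝ, (∀ f, 0 ≤ f → 0 ≤ G f) ∧ ∀ K, G (suppC K) = V K := by
  have hadd : ∀ f g, majorant V (f + g) ≤ majorant V f + majorant V g := fun f g => by
    refine le_of_forall_pos_le_add fun ε hε => ?_
    obtain ⟨_, ⟨K, L, h, rfl⟩, h1⟩ :=
      Real.lt_sInf_add_pos (majorant_nonempty V f) (half_pos hε)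
    obtain ⟨_, ⟨K', L', h', rfl⟩, h1'⟩ :=
      Real.lt_sInf_add_pos (majorant_nonempty V g) (half_pos hε)
    have h2 := majorant_le hV (f := f + g) (K := K + K') (L := L + L') (by
      rw [suppC_add, suppC_add]
      calc f + g ≤ (suppC K - suppC L) + (suppC K' - suppC L') := add_le_add h h'
        _ = _ := by abel)
    rw [hV.add, hV.add] at h2
    change _ < majorant V f + _ at h1
    change _ < majorant V g + _ at h1'
    linarith
  have hle : ∀ c : ℝ, 0 < c → ∀ f, majorant V (c • f) ≤ c * majorant V f := fun c hc f => by
    refine le_of_forall_pos_le_add fun ε hε => ?_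
    obtain ⟨_, ⟨K, L, h, rfl⟩, h1⟩ :=
      Real.lt_sInf_add_pos (majorant_nonempty V f) (div_pos hε hc)
    have h2 := majorant_le hV (f := c • f) (K := scale c K) (L := scale c L) (fun v => by
      have := mul_le_mul_of_nonneg_left (h v) hc.le
      simpa [supp_scale _ hc.le, mul_sub] using this)
    rw [hV.smul _ c hc.le, hV.smul _ c hc.le] at h2
    change _ < majorant V f + _ at h1
    have h3 := mul_lt_mul_of_pos_left h1 hc
    have h4 : c * (majorant V f + ε / c) = c * majorant V f + ε := by field_simp
    linarith
  have hsmul : ∀ c : ℝ, 0 < c → ∀ f, majorant V (c • f) = c * majorant V f := fun c hc f => by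
    refine le_antisymm (hle c hc f) ?_
    have := hle c⁻¹ (inv_pos.2 hc) (c • f)
    rw [inv_smul_smul₀ hc.ne', ← div_eq_inv_mul, le_div_iff₀ hc] at this
    linarith
  have h0 : majorant V 0 = 0 := by
    have := hsmul 2 two_pos 0
    rw [smul_zero] at this; linarith
  obtain ⟨G, -, hG⟩ := exists_extension_of_le_sublinear (E := C(Sph n, ℝ)) ⟨⊥, 0⟩ (majorant V)
      hsmul hadd (by
        rintro ⟨x, hx⟩; obtain rfl := (Submodule.mem_bot ℝ).1 hx; simp [h0])
  refine ⟨G, fun f hf => ?_, fun K => le_antisymm ?_ ?_⟩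
  · have h1 := (hG (-f)).trans (majorant_le hV (K := 0) (L := 0) (by simpa using hf))
    rw [map_neg] at h1
    linarith
  · have h1 := (hG (suppC K)).trans (majorant_le hV (K := K) (L := 0) (fun v => by simp))
    rw [hV.zero] at h1; linarith
  · have h1 := (hG (-suppC K)).trans (majorant_le hV (K := 0) (L := K) (fun v => by simp))
    rw [hV.zero, map_neg] at h1; linarith

lemma exists_measure {V : ConvexBody (En n) → ℝ} (hV : IsMixedFunctional V) :
    ∃ μ : Measure (Sph n), IsFiniteMeasure μ ∧ ∀ K, ∫ v, supp K (v : En n) ∂μ = V K := by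
  obtain ⟨G, hpos, hG⟩ := exists_positive_functional hV
  let Λ₀ : CompactlySupportedContinuousMap (Sph n) ℝ →ₗ[ℝ] ℝ :=
    { toFun := fun f => G f.toContinuousMap
      map_add' := fun f g => G.map_add _ _
      map_smul' := fun c f => G.map_smul _ _ }
  let Λ : CompactlySupportedContinuousMap (Sph n) ℝ →ₚ[ℝ] ℝ :=
    PositiveLinearMap.mk₀ Λ₀ fun f hf => hpos _ hf
  refine ⟨RealRMK.rieszMeasure Λ, inferInstance, fun K => ?_⟩
  rw [← hG K]
  exact RealRMK.integral_rieszMeasure Λ (CompactlySupportedContinuousMap.continuousMapEquiv (suppC K))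

end

section

lemma mixedVol_ball_pos : 0 < mixedVol (fun _ : Fin n => ballB n) := by
  rw [mixedVol_const]
  refine ENNReal.toReal_pos ?_ (ballB n).isCompact.measure_lt_top.ne
  exact (measure_closedBall_pos volume (0 : En n) one_pos).ne'

/-- Mixed volumes normalised so that the ball has volume one. -/
def mv (Ks : Fin n → ConvexBody (En n)) : ℝ := mixedVol Ks / mixedVol (fun _ : Fin n => ballB n)

lemma mv_ball : mv (fun _ : Fin n => ballB n) = 1 := div_self mixedVol_ball_pos.ne'

lemma mv_isMixedFunctional (Ks : Fin n → ConvexBody (En n)) (k : Fin n) :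
    IsMixedFunctional fun M => mv (Function.update Ks k M) where
  add K L := by simp only [mv, mixedVol_update_add, add_div]
  smul K c hc := by simp only [mv, mixedVol_update_scale _ _ _ hc, mul_div_assoc]
  mono K L h := div_le_div_of_nonneg_right (mixedVol_update_mono Ks k h) mixedVol_ball_pos.le

lemma mv_comp_perm (Ks : Fin n → ConvexBody (En n)) (τ : Equiv.Perm (Fin n)) :
    mv (fun k => Ks (τ k)) = mv Ks := by rw [mv, mixedVol_comp_perm, mv]

lemma mv_rotate (ρ : En n ≃ₗᵢ[ℝ] En n) (Ks : Fin n → ConvexBody (En n)) :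
    mv (fun k => rotate ρ (Ks k)) = mv Ks := by rw [mv, mixedVol_rotate, mv]

lemma continuous_supp_sph (K : ConvexBody (En n)) : Continuous fun v : Sph n => supp K (v : En n) :=
  (suppC K).continuous

lemma rotate_ballB (ρ : En n ≃ₗᵢ[ℝ] En n) : rotate ρ (ballB n) = ballB n :=
  body_ext fun x => by simp [supp_rotate]

/-- The reflection exchanging two unit vectors. -/
lemma exists_swap {u v : En n} (h : ‖u‖ = ‖v‖) :
    ∃ ρ : En n ≃ₗᵢ[ℝ] En n, ρ u = v ∧ ρ v = u := by
  have h1 := Submodule.reflection_sub h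
  refine ⟨(ℝ ∙ (u - v))ᗮ.reflection, h1, ?_⟩
  calc _ = (ℝ ∙ (u - v))ᗮ.reflection ((ℝ ∙ (u - v))ᗮ.reflection u) := by rw [h1]
    _ = u := Submodule.reflection_reflection _ _

/-- The action of a linear isometry on the sphere. -/
def sphMap (ρ : En n ≃ₗᵢ[ℝ] En n) (v : Sph n) : Sph n :=
  ⟨ρ v, by rw [mem_sphere_zero_iff_norm, ρ.norm_map, norm_eq_of_mem_sphere]⟩

@[simp] lemma coe_sphMap (ρ : En n ≃ₗᵢ[ℝ] En n) (v : Sph n) : (sphMap ρ v : En n) = ρ v := rfl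

lemma continuous_sphMap (ρ : En n ≃ₗᵢ[ℝ] En n) : Continuous (sphMap ρ) :=
  (ρ.continuous.comp continuous_subtype_val).subtype_mk _

lemma exists_sphMap (u v : Sph n) : ∃ ρ : En n ≃ₗᵢ[ℝ] En n, sphMap ρ u = v ∧ sphMap ρ v = u := by
  obtain ⟨ρ, h1, h2⟩ := exists_swap (n := n) (u := u) (v := v)
    (by rw [norm_eq_of_mem_sphere, norm_eq_of_mem_sphere])
  exact ⟨ρ, Subtype.ext h1, Subtype.ext h2⟩

lemma integrable_of_continuous {f : Sph n → ℝ} (hf : Continuous f) (μ : Measure (Sph n))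
    [IsFiniteMeasure μ] : Integrable f μ :=
  hf.integrable_of_hasCompactSupport (HasCompactSupport.of_compactSpace f)

lemma continuous_integral_C (μ : Measure (Sph n)) [IsFiniteMeasure μ] :
    Continuous fun f : C(Sph n, ℝ) => ∫ v, f v ∂μ := by
  refine LipschitzWith.continuous (K := (μ.real Set.univ).toNNReal)
    (LipschitzWith.of_dist_le_mul fun f g => ?_)
  rw [dist_eq_norm, ← integral_sub (integrable_of_continuous f.continuous μ)
    (integrable_of_continuous g.continuous μ), Real.coe_toNNReal _ measureReal_nonneg]
  refine (norm_integral_le_of_norm_le_const (C := dist f g) (Eventually.of_forall fun v => ?_)).trans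
    (mul_comm _ _).le
  rw [← dist_eq_norm]; exact ContinuousMap.dist_apply_le_dist v

lemma measure_ext_supp {μ ν : Measure (Sph n)} [IsFiniteMeasure μ] [IsFiniteMeasure ν]
    (h : ∀ K : ConvexBody (En n), ∫ v, supp K (v : En n) ∂μ = ∫ v, supp K (v : En n) ∂ν) :
    μ = ν := by
  refine ext_of_forall_integral_eq_of_IsFiniteMeasure fun f => ?_
  refine eq_of_eq_on_supp (continuous_integral_C μ) (continuous_integral_C ν) (fun K L => ?_)
    f.toContinuousMap
  simp only [ContinuousMap.sub_apply]
  rw [integral_sub (integrable_of_continuous (suppC K).continuous μ)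
    (integrable_of_continuous (suppC L).continuous μ),
    integral_sub (integrable_of_continuous (suppC K).continuous ν)
    (integrable_of_continuous (suppC L).continuous ν)]
  simp only [suppC_apply, h]

variable [NeZero n]

/-- The normalised mixed area measure of the bodies in the nonzero slots. -/
def S (Ks : Fin n → ConvexBody (En n)) : Measure (Sph n) :=
  (exists_measure (mv_isMixedFunctional Ks 0)).choose

instance (Ks : Fin n → ConvexBody (En n)) : IsFiniteMeasure (S Ks) :=
  (exists_measure (mv_isMixedFunctional Ks 0)).choose_spec.1

lemma integral_supp_S (Ks : Fin n → ConvexBody (En n)) (M : ConvexBody (En n)) :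
    ∫ v, supp M (v : En n) ∂(S Ks) = mv (Function.update Ks 0 M) :=
  (exists_measure (mv_isMixedFunctional Ks 0)).choose_spec.2 M

lemma S_update_add (Ks : Fin n → ConvexBody (En n)) {j : Fin n} (hj : j ≠ 0)
    (X Y : ConvexBody (En n)) :
    S (Function.update Ks j (X + Y)) = S (Function.update Ks j X) + S (Function.update Ks j Y) := by
  refine measure_ext_supp fun M => ?_
  rw [integral_add_measure (integrable_of_continuous (continuous_supp_sph M) _)
    (integrable_of_continuous (continuous_supp_sph M) _)]
  simp only [integral_supp_S]
  simp only [Function.update_comm hj]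
  exact (mv_isMixedFunctional _ j).add X Y

lemma S_update_scale (Ks : Fin n → ConvexBody (En n)) {j : Fin n} (hj : j ≠ 0)
    (X : ConvexBody (En n)) {c : ℝ} (hc : 0 ≤ c) :
    S (Function.update Ks j (scale c X)) = c.toNNReal • S (Function.update Ks j X) := by
  refine measure_ext_supp fun M => ?_
  rw [integral_smul_nnreal_measure, NNReal.smul_def, Real.coe_toNNReal _ hc]
  simp only [integral_supp_S]
  simp only [Function.update_comm hj]
  exact (mv_isMixedFunctional _ j).smul X c hc

lemma S_comp_perm (Ks : Fin n → ConvexBody (En n)) (τ : Equiv.Perm (Fin n)) (hτ : τ 0 = 0) :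
    S (fun k => Ks (τ k)) = S Ks := by
  refine measure_ext_supp fun M => ?_
  rw [integral_supp_S, integral_supp_S, ← mv_comp_perm (Function.update Ks 0 M) τ]
  congr 1
  funext k
  by_cases hk : k = 0
  · subst hk; simp [hτ]
  · have : τ k ≠ 0 := fun h => hk (τ.injective (h.trans hτ.symm))
    simp [hk, this]

lemma integral_supp_S_swap (Ks : Fin n → ConvexBody (En n)) {j : Fin n} (hj : j ≠ 0)
    (X M : ConvexBody (En n)) :
    ∫ v, supp M (v : En n) ∂(S (Function.update Ks j X)) =
      ∫ v, supp X (v : En n) ∂(S (Function.update Ks j M)) := by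
  rw [integral_supp_S, integral_supp_S, ← mv_comp_perm _ (Equiv.swap 0 j)]
  congr 1
  funext k
  by_cases hk : k = 0
  · subst hk; simp [hj]
  · by_cases hkj : k = j
    · subst hkj; simp [hk]
    · simp [Equiv.swap_apply_of_ne_of_ne hk hkj, hk, hkj]

lemma map_S (ρ : En n ≃ₗᵢ[ℝ] En n) (Ks : Fin n → ConvexBody (En n)) :
    (S Ks).map (sphMap ρ) = S (fun k => rotate ρ (Ks k)) := by
  have := Measure.isFiniteMeasure_map (S Ks) (sphMap ρ)
  refine measure_ext_supp fun M => ?_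
  rw [integral_map (continuous_sphMap ρ).aemeasurable
    (continuous_supp_sph M).aestronglyMeasurable, integral_supp_S,
    ← mv_rotate ρ.symm]
  have h1 : ∀ v : Sph n, supp M (sphMap ρ v : En n) = supp (rotate ρ.symm M) v := fun v => by
    rw [supp_rotate]; rfl
  simp only [h1]
  rw [integral_supp_S]
  congr 1
  funext k
  by_cases hk : k = 0
  · subst hk; simp
  · simp only [Function.update_of_ne hk]
    exact body_ext fun x => by simp [supp_rotate]

lemma integral_comp_sphMap (ρ : En n ≃ₗᵢ[ℝ] En n) (Ks : Fin n → ConvexBody (En n)) {f : Sph n → ℝ}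
    (hf : Continuous f) : ∫ v, f (sphMap ρ v) ∂(S Ks) = ∫ v, f v ∂(S (fun k => rotate ρ (Ks k))) := by
  rw [← map_S, integral_map (continuous_sphMap ρ).aemeasurable hf.aestronglyMeasurable]

lemma S_seg_ae (Ks : Fin n → ConvexBody (En n)) {j : Fin n} (hj : j ≠ 0) (u : En n)
    (hu : Ks j = seg u) : ∀ᵐ v : Sph n ∂(S Ks), ⟪u, (v : En n)⟫_ℝ = 0 := by
  have h1 : ∫ v, supp (seg u) (v : En n) ∂(S Ks) = 0 := by
    rw [integral_supp_S, mv, mixedVol_seg_seg _ hj.symm u (by simp) (by simp [hj, hu]), zero_div]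
  rw [integral_eq_zero_iff_of_nonneg (fun v => by simp)
    (integrable_of_continuous (continuous_supp_sph _) _)] at h1
  filter_upwards [h1] with v hv
  simpa using hv

/-- The normalised spherical measure. -/
def sig (n : ℕ) [NeZero n] : Measure (Sph n) := S fun _ => ballB n

instance : IsFiniteMeasure (sig n) := by unfold sig; infer_instance

instance : IsProbabilityMeasure (sig n) := ⟨by
  have h1 := integral_supp_S (fun _ => ballB n) (ballB n)
  simp only [supp_ballB, norm_eq_of_mem_sphere, integral_const, Function.update_eq_self, mv_ball,
    smul_eq_mul, mul_one] at h1
  rw [sig, ← ENNReal.toReal_eq_one_iff]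
  exact h1⟩

lemma integral_sig_comp (ρ : En n ≃ₗᵢ[ℝ] En n) {f : Sph n → ℝ}
    (hf : Continuous f) : ∫ v, f (sphMap ρ v) ∂(sig n) = ∫ v, f v ∂(sig n) := by
  have := integral_comp_sphMap ρ (fun _ => ballB n) hf
  simp only [rotate_ballB] at this
  exact this

instance : (sig n).IsOpenPosMeasure := ⟨fun U hU hne h0 => by
  obtain ⟨u, hu⟩ := hne
  choose ρ h1 h2 using fun v : Sph n => exists_sphMap u v
  have hmap : ∀ ρ : En n ≃ₗᵢ[ℝ] En n, (sig n).map (sphMap ρ) = sig n := fun ρ => by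
    rw [sig, map_S]; simp only [rotate_ballB]
  obtain ⟨t, ht⟩ := isCompact_univ.elim_finite_subcover (fun v => sphMap (ρ v) ⁻¹' U)
    (fun v => hU.preimage (continuous_sphMap _)) (fun v _ => Set.mem_iUnion.2 ⟨v, by
      change sphMap (ρ v) v ∈ U
      rw [h2]; exact hu⟩)
  have h3 : ∀ v, sig n (sphMap (ρ v) ⁻¹' U) = 0 := fun v => by
    rw [← Measure.map_apply (continuous_sphMap _).measurable hU.measurableSet, hmap, h0]
  have h4 : sig n Set.univ = 0 := measure_mono_null ht
    ((measure_biUnion_null_iff t.countable_toSet).2 fun v _ => h3 v)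
  simp at h4⟩

end

section

lemma fubini_sph {F : Sph n → Sph n → ℝ} (hF : Continuous (Function.uncurry F))
    (μ ν : Measure (Sph n)) [IsFiniteMeasure μ] [IsFiniteMeasure ν] :
    ∫ u, ∫ v, F u v ∂ν ∂μ = ∫ v, ∫ u, F u v ∂μ ∂ν :=
  integral_integral_swap
    (hF.integrable_of_hasCompactSupport (HasCompactSupport.of_compactSpace _))

lemma continuous_integral_sph {F : Sph n → Sph n → ℝ} (hF : Continuous (Function.uncurry F))
    (ν : Measure (Sph n)) [IsFiniteMeasure ν] : Continuous fun u => ∫ v, F u v ∂ν := by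
  have h1 : Continuous fun u => (⟨F u, hF.comp (Continuous.prodMk_right u)⟩ : C(Sph n, ℝ)) :=
    ContinuousMap.continuous_of_continuous_uncurry _ hF
  exact (continuous_integral_C ν).comp h1

lemma inner_sph_self (u : Sph n) : ⟪(u : En n), u⟫_ℝ = 1 := by
  rw [real_inner_self_eq_norm_sq, norm_eq_of_mem_sphere, one_pow]

lemma abs_inner_sph_le (u v : Sph n) : |⟪(u : En n), v⟫_ℝ| ≤ 1 := by
  have := abs_real_inner_le_norm (u : En n) v
  rwa [norm_eq_of_mem_sphere, norm_eq_of_mem_sphere, one_mul] at this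

/-- A measure on the sphere which is invariant under the isometries fixing `w`. -/
def IsAxial (w : Sph n) (μ : Measure (Sph n)) : Prop :=
  ∀ ρ : En n ≃ₗᵢ[ℝ] En n, ρ w = w → μ.map (sphMap ρ) = μ

lemma IsAxial.integral_comp {w : Sph n} {μ : Measure (Sph n)} (h : IsAxial w μ)
    {ρ : En n ≃ₗᵢ[ℝ] En n} (hρ : ρ w = w) {f : Sph n → ℝ} (hf : Continuous f) :
    ∫ v, f (sphMap ρ v) ∂μ = ∫ v, f v ∂μ := by
  conv_rhs => rw [← h ρ hρ]
  rw [integral_map (continuous_sphMap ρ).aemeasurable hf.aestronglyMeasurable]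

lemma inner_map_of_fixed {ρ : En n ≃ₗᵢ[ℝ] En n} {w : En n} (hρ : ρ w = w) (v : En n) :
    ⟪w, ρ v⟫_ℝ = ⟪w, v⟫_ℝ := by
  conv_lhs => rw [← hρ]
  exact ρ.inner_map_map w v

/-- Decomposition of a unit vector along an axis. -/
lemma exists_decomp (w e : Sph n) {x₀ : En n} (hx₀ : ‖x₀‖ = 1) (hwx : ⟪(w : En n), x₀⟫_ℝ = 0) :
    ∃ x : En n, ‖x‖ = 1 ∧ ⟪(w : En n), x⟫_ℝ = 0 ∧
      (e : En n) = ⟪(e : En n), w⟫_ℝ • (w : En n) + √(1 - ⟪(e : En n), w⟫_ℝ ^ 2) • x := by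
  set s := ⟪(e : En n), w⟫_ℝ with hs
  set y : En n := e - s • (w : En n) with hy
  have hwy : ⟪(w : En n), y⟫_ℝ = 0 := by
    rw [hy, inner_sub_right, real_inner_smul_right, inner_sph_self, real_inner_comm, ← hs]; ring
  have hy2 : ‖y‖ ^ 2 = 1 - s ^ 2 := by
    rw [← real_inner_self_eq_norm_sq]
    conv_lhs => rw [hy, inner_sub_left, real_inner_smul_left, ← hy, hwy, hy, inner_sub_right,
      real_inner_smul_right, inner_sph_self, ← hs]
    ring
  have hr : √(1 - s ^ 2) = ‖y‖ := by rw [← hy2, Real.sqrt_sq (norm_nonneg _)]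
  by_cases h0 : y = 0
  · refine ⟨x₀, hx₀, hwx, ?_⟩
    rw [hr, h0, norm_zero, zero_smul, add_zero]
    exact sub_eq_zero.1 h0
  · have hn : ‖y‖ ≠ 0 := norm_ne_zero_iff.2 h0
    refine ⟨‖y‖⁻¹ • y, by rw [norm_smul, norm_inv, norm_norm, inv_mul_cancel₀ hn],
      by rw [real_inner_smul_right, hwy, mul_zero], ?_⟩
    rw [hr, smul_inv_smul₀ hn, hy]; abel

lemma exists_orthogonal (hn : 2 ≤ n) (w : En n) : ∃ x : En n, ‖x‖ = 1 ∧ ⟪w, x⟫_ℝ = 0 := by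
  have h1 : 0 < Module.finrank ℝ (ℝ ∙ w)ᗮ := by
    have h2 := Submodule.finrank_add_finrank_orthogonal (ℝ ∙ w)
    have h3 : Module.finrank ℝ (ℝ ∙ w) ≤ 1 := by simpa using finrank_span_le_card (R := ℝ) ({w} : Set (En n))
    rw [finrank_euclideanSpace_fin] at h2
    omega
  have := Module.finrank_pos_iff.1 h1
  obtain ⟨⟨x, hx⟩, hne⟩ := exists_ne (0 : (ℝ ∙ w)ᗮ)
  have hx0 : x ≠ 0 := fun h => hne (Subtype.ext h)
  refine ⟨‖x‖⁻¹ • x, by rw [norm_smul, norm_inv, norm_norm, inv_mul_cancel₀ (norm_ne_zero_iff.2 hx0)], ?_⟩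
  rw [real_inner_smul_right, Submodule.mem_orthogonal_singleton_iff_inner_right.1 hx, mul_zero]

section axial

variable {w : Sph n} {μ : Measure (Sph n)} [IsFiniteMeasure μ]

omit [IsFiniteMeasure μ] in
lemma IsAxial.integral_pow_odd (h : IsAxial w μ) {F : ℝ → ℝ}
    (hF : Continuous fun v : Sph n => F ⟪(w : En n), v⟫_ℝ) {x : En n}
    (hwx : ⟪(w : En n), x⟫_ℝ = 0) {i : ℕ} (hi : Odd i) :
    ∫ v : Sph n, F ⟪(w : En n), v⟫_ℝ * ⟪x, v⟫_ℝ ^ i ∂μ = 0 := by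
  have h1 : (ℝ ∙ x)ᗮ.reflection (w : En n) = w :=
    Submodule.reflection_mem_subspace_eq_self
      (Submodule.mem_orthogonal_singleton_iff_inner_left.2 hwx)
  have h2 := h.integral_comp h1 (f := fun v : Sph n => F ⟪(w : En n), v⟫_ℝ * ⟪x, (v : En n)⟫_ℝ ^ i)
    (hF.mul (by fun_prop))
  have h3 : ∀ v : En n, ⟪x, (ℝ ∙ x)ᗮ.reflection v⟫_ℝ = -⟪x, v⟫_ℝ := fun v => by
    have h4 := ((ℝ ∙ x)ᗮ.reflection).inner_map_map x v
    rw [Submodule.reflection_orthogonalComplement_singleton_eq_neg, inner_neg_left] at h4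
    linarith
  simp only [coe_sphMap, inner_map_of_fixed h1, h3, hi.neg_pow, mul_neg] at h2
  rw [integral_neg] at h2
  linarith

omit [IsFiniteMeasure μ] in
lemma IsAxial.integral_pow_indep (h : IsAxial w μ) {F : ℝ → ℝ}
    (hF : Continuous fun v : Sph n => F ⟪(w : En n), v⟫_ℝ) {x y : En n} (hx : ‖x‖ = 1)
    (hy : ‖y‖ = 1) (hwx : ⟪(w : En n), x⟫_ℝ = 0) (hwy : ⟪(w : En n), y⟫_ℝ = 0) (i : ℕ) :
    ∫ v : Sph n, F ⟪(w : En n), v⟫_ℝ * ⟪x, v⟫_ℝ ^ i ∂μ =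
      ∫ v : Sph n, F ⟪(w : En n), v⟫_ℝ * ⟪y, v⟫_ℝ ^ i ∂μ := by
  have hxy : ‖x‖ = ‖y‖ := hx.trans hy.symm
  have h1 : (ℝ ∙ (x - y))ᗮ.reflection (w : En n) = w :=
    Submodule.reflection_mem_subspace_eq_self
      (Submodule.mem_orthogonal_singleton_iff_inner_left.2 (by rw [inner_sub_right, hwx, hwy, sub_zero]))
  have h2 := h.integral_comp h1 (f := fun v : Sph n => F ⟪(w : En n), v⟫_ℝ * ⟪y, (v : En n)⟫_ℝ ^ i)
    (hF.mul (by fun_prop))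
  have h3 : ∀ v : En n, ⟪y, (ℝ ∙ (x - y))ᗮ.reflection v⟫_ℝ = ⟪x, v⟫_ℝ := fun v => by
    rw [← Submodule.reflection_sub hxy]
    exact ((ℝ ∙ (x - (ℝ ∙ (x - y))ᗮ.reflection x))ᗮ.reflection).inner_map_map x v |> fun h5 => by
      rw [Submodule.reflection_sub hxy] at h5 ⊢
      rw [← h5, Submodule.reflection_sub hxy]
  simp only [coe_sphMap, inner_map_of_fixed h1, h3] at h2
  exact h2

/-- The restriction of an axially symmetric integral transform of a polynomial is a polynomial in
the axis variable. -/
lemma IsAxial.exists_poly_pow (hn : 2 ≤ n) (h : IsAxial w μ) {F : ℝ → ℝ}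
    (hF : Continuous fun v : Sph n => F ⟪(w : En n), v⟫_ℝ) (j : ℕ) :
    ∃ R : Polynomial ℝ, R.natDegree ≤ j ∧ ∀ e : Sph n,
      ∫ v : Sph n, F ⟪(w : En n), v⟫_ℝ * ⟪(e : En n), v⟫_ℝ ^ j ∂μ = R.eval ⟪(e : En n), w⟫_ℝ := by
  obtain ⟨x₀, hx₀, hwx₀⟩ := exists_orthogonal hn (w : En n)
  let I : ℕ → ℝ := fun i => ∫ v : Sph n, (F ⟪(w : En n), v⟫_ℝ * ⟪(w : En n), v⟫_ℝ ^ (j - i)) *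
    ⟪x₀, v⟫_ℝ ^ i ∂μ
  refine ⟨∑ i ∈ Finset.range (j + 1), Polynomial.C (if Even i then I i * j.choose i else 0) *
    (Polynomial.X ^ (j - i) * (1 - Polynomial.X ^ 2) ^ (i / 2)), ?_, fun e => ?_⟩
  · refine Polynomial.natDegree_sum_le_of_forall_le _ _ fun i hi => ?_
    refine (Polynomial.natDegree_C_mul_le _ _).trans (Polynomial.natDegree_mul_le.trans ?_)
    have h1 : ((1 - Polynomial.X ^ 2 : Polynomial ℝ) ^ (i / 2)).natDegree ≤ i / 2 * 2 :=
      Polynomial.natDegree_pow_le_of_le _ (by compute_degree)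
    have h2 : (Polynomial.X ^ (j - i) : Polynomial ℝ).natDegree ≤ j - i := by compute_degree
    have := Finset.mem_range.1 hi
    omega
  · obtain ⟨x, hx, hwx, hex⟩ := exists_decomp w e hx₀ hwx₀
    set s := ⟪(e : En n), w⟫_ℝ with hs
    have hs1 : 0 ≤ 1 - s ^ 2 := by
      have := abs_inner_sph_le e w
      rw [← hs] at this
      nlinarith [abs_nonneg s, sq_abs s]
    have hint : ∀ i, Continuous fun v : Sph n => (F ⟪(w : En n), v⟫_ℝ * ⟪(w : En n), v⟫_ℝ ^ (j - i)) *
        ⟪x, v⟫_ℝ ^ i := fun i => (hF.mul (by fun_prop)).mul (by fun_prop)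
    have h1 : ∀ v : Sph n, F ⟪(w : En n), v⟫_ℝ * ⟪(e : En n), v⟫_ℝ ^ j =
        ∑ i ∈ Finset.range (j + 1), (s ^ (j - i) * √(1 - s ^ 2) ^ i * j.choose i) *
          ((F ⟪(w : En n), v⟫_ℝ * ⟪(w : En n), v⟫_ℝ ^ (j - i)) * ⟪x, v⟫_ℝ ^ i) := fun v => by
      rw [hex, inner_add_left, real_inner_smul_left, real_inner_smul_left, add_comm, add_pow,
        Finset.mul_sum]
      refine Finset.sum_congr rfl fun i _ => ?_
      rw [mul_pow, mul_pow]; ring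
    simp only [h1]
    rw [integral_finsetSum _ fun i _ => (integrable_of_continuous (hint i) μ).const_mul _,
      Polynomial.eval_finsetSum]
    refine Finset.sum_congr rfl fun i _ => ?_
    rw [integral_const_mul]
    have hF' : Continuous fun v : Sph n => (fun t => F t * t ^ (j - i)) ⟪(w : En n), v⟫_ℝ :=
      hF.mul (by fun_prop)
    by_cases hi : Even i
    · have h2 := h.integral_pow_indep (F := fun t => F t * t ^ (j - i)) hF' hx hx₀ hwx hwx₀ i
      simp only [hi, if_true, Polynomial.eval_mul, Polynomial.eval_C, Polynomial.eval_pow,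
        Polynomial.eval_X, Polynomial.eval_sub, Polynomial.eval_one]
      rw [h2]
      have h3 : √(1 - s ^ 2) ^ i = (1 - s ^ 2) ^ (i / 2) := by
        obtain ⟨l, rfl⟩ := hi
        rw [← two_mul, pow_mul, Real.sq_sqrt hs1, Nat.mul_div_cancel_left _ two_pos]
      rw [h3]; ring
    · have h2 := h.integral_pow_odd (F := fun t => F t * t ^ (j - i)) hF' hwx (Nat.not_even_iff_odd.1 hi)
      rw [h2]; simp [hi]

lemma IsAxial.exists_poly (hn : 2 ≤ n) (h : IsAxial w μ) {F : ℝ → ℝ}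
    (hF : Continuous fun v : Sph n => F ⟪(w : En n), v⟫_ℝ) (Q : Polynomial ℝ) :
    ∃ R : Polynomial ℝ, R.natDegree ≤ Q.natDegree ∧ ∀ e : Sph n,
      ∫ v : Sph n, F ⟪(w : En n), v⟫_ℝ * Q.eval ⟪(e : En n), v⟫_ℝ ∂μ =
        R.eval ⟪(e : En n), w⟫_ℝ := by
  choose R hR1 hR2 using fun j => h.exists_poly_pow hn hF j
  refine ⟨∑ j ∈ Finset.range (Q.natDegree + 1), Polynomial.C (Q.coeff j) * R j, ?_, fun e => ?_⟩
  · refine Polynomial.natDegree_sum_le_of_forall_le _ _ fun i hi => ?_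
    exact (Polynomial.natDegree_C_mul_le _ _).trans ((hR1 i).trans (by
      have := Finset.mem_range.1 hi; omega))
  · simp only [Polynomial.eval_eq_sum_range (p := Q), Finset.mul_sum]
    have hint : ∀ j, Continuous fun v : Sph n =>
        F ⟪(w : En n), v⟫_ℝ * (Q.coeff j * ⟪(e : En n), v⟫_ℝ ^ j) :=
      fun j => hF.mul (by fun_prop)
    rw [integral_finsetSum _ fun j _ => integrable_of_continuous (hint j) μ,
      Polynomial.eval_finsetSum]
    refine Finset.sum_congr rfl fun j _ => ?_
    rw [Polynomial.eval_mul, Polynomial.eval_C, ← hR2 j e, ← integral_const_mul]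
    refine integral_congr_ae (Eventually.of_forall fun v => ?_)
    simp only; ring

end axial

section sigma

variable [NeZero n]

/-- The north pole of the sphere. -/
def e0 (n : ℕ) [NeZero n] : Sph n := ⟨EuclideanSpace.single 0 1, by simp⟩

/-- The expectation of a function of one coordinate. -/
def Es (n : ℕ) [NeZero n] (F : ℝ → ℝ) : ℝ := ∫ v : Sph n, F ⟪(e0 n : En n), v⟫_ℝ ∂(sig n)

lemma isAxial_sig (w : Sph n) : IsAxial w (sig n) := fun ρ _ => by
  rw [sig, map_S]; simp only [rotate_ballB]

omit [NeZero n] in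
lemma continuous_zonal {F : ℝ → ℝ} {w : Sph n} (hF : Continuous fun v : Sph n => F ⟪(w : En n), v⟫_ℝ)
    (u : Sph n) : Continuous fun v : Sph n => F ⟪(u : En n), v⟫_ℝ := by
  obtain ⟨ρ, h1, h2⟩ := exists_sphMap u w
  refine (hF.comp (continuous_sphMap ρ)).congr fun v => ?_
  simp only [Function.comp, coe_sphMap]
  rw [← h1, coe_sphMap, ρ.inner_map_map]

lemma integral_sig_zonal {F : ℝ → ℝ} {w : Sph n}
    (hF : Continuous fun v : Sph n => F ⟪(w : En n), v⟫_ℝ) (u : Sph n) :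
    ∫ v : Sph n, F ⟪(u : En n), v⟫_ℝ ∂(sig n) = Es n F := by
  obtain ⟨ρ, h1, h2⟩ := exists_sphMap (e0 n) u
  rw [← integral_sig_comp ρ (continuous_zonal hF u)]
  refine integral_congr_ae (Eventually.of_forall fun v => ?_)
  simp only [coe_sphMap]
  rw [← h1, coe_sphMap, ρ.inner_map_map]

end sigma

end

section

open Polynomial in
/-- The Legendre polynomials of dimension `n`, normalised by `P 1 = 1`. -/
def legP (n : ℕ) : ℕ → Polynomial ℝ
  | 0 => 1
  | 1 => X
  | k + 2 => C ((2 * k + n) / (k + n - 1) : ℝ) * (X * legP n (k + 1)) -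
      C ((k + 1) / (k + n - 1) : ℝ) * legP n k

section legendre

open Polynomial

lemma legP_zero : legP n 0 = 1 := by simp [legP]

lemma legP_one : legP n 1 = X := by simp [legP]

lemma legP_rec (hn : 2 ≤ n) (k : ℕ) :
    C ((k : ℝ) + n - 1) * legP n (k + 2) =
      C (2 * k + n : ℝ) * (X * legP n (k + 1)) - C (k + 1 : ℝ) * legP n k := by
  have h2 : (2 : ℝ) ≤ n := by exact_mod_cast hn
  have h : (k : ℝ) + n - 1 ≠ 0 := by
    have : (0 : ℝ) ≤ k := k.cast_nonneg
    linarith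
  rw [legP, mul_sub, ← mul_assoc, ← mul_assoc (C _) (C _) (legP n k), ← C_mul, ← C_mul,
    mul_div_cancel₀ _ h, mul_div_cancel₀ _ h]

lemma legP_deriv (hn : 2 ≤ n) (k : ℕ) :
    (1 - X ^ 2) * derivative (legP n (k + 1)) = C (k + 1 : ℝ) * (legP n k - X * legP n (k + 1)) ∧
    (1 - X ^ 2) * derivative (legP n k) = C (k + n - 2 : ℝ) * (X * legP n k - legP n (k + 1)) := by
  induction k with
  | zero => simp [legP_zero, legP_one]; ring
  | succ k ih =>
    obtain ⟨h1, h2⟩ := ih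
    have hr := legP_rec hn k
    have hd := congrArg derivative hr
    simp only [derivative_mul, derivative_sub, derivative_C, zero_mul, zero_add, derivative_X,
      one_mul] at hd
    have hn2 : (2 : ℝ) ≤ n := by exact_mod_cast hn
    have hne : (C ((k : ℝ) + n - 1) : ℝ[X]) ≠ 0 := by
      rw [Ne, C_eq_zero]
      have : (0 : ℝ) ≤ k := k.cast_nonneg
      linarith
    simp only [C_add, C_sub, C_mul, C_1, C_ofNat, map_natCast, Nat.cast_add, Nat.cast_one] at *
    constructor
    · apply mul_left_cancel₀ hne
      linear_combination (1 - X ^ 2) * hd + (2 * (k : ℝ[X]) + n) * X * h1 - ((k : ℝ[X]) + 1) * h2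
        + ((k : ℝ[X]) + 2) * X * hr
    · linear_combination h1 + hr

/-- The Legendre differential operator. -/
def legD (n : ℕ) (F : ℝ[X]) : ℝ[X] :=
  (1 - X ^ 2) * derivative (derivative F) - C (n - 1 : ℝ) * (X * derivative F)

lemma legD_legP (hn : 2 ≤ n) (k : ℕ) :
    legD n (legP n k) = - C (k * (k + n - 2) : ℝ) * legP n k := by
  cases k with
  | zero => simp [legP_zero, legD]
  | succ k =>
    obtain ⟨h1, h2⟩ := legP_deriv hn k
    have hd := congrArg derivative h1
    have hne : (1 - X ^ 2 : ℝ[X]) ≠ 0 := fun h => by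
      have := congrArg (eval 0) h
      simp at this
    simp only [derivative_mul, derivative_sub, derivative_C, zero_mul, zero_add, derivative_X,
      one_mul, derivative_one, derivative_X_pow, legD] at hd ⊢
    simp only [C_add, C_sub, C_mul, C_1, C_ofNat, map_natCast, Nat.cast_add, Nat.cast_one,
      Nat.add_one_sub_one, pow_one, Nat.cast_ofNat] at *
    apply mul_left_cancel₀ hne
    linear_combination (1 - X ^ 2) * hd + ((k : ℝ[X]) + 1) * h2
       + (-(k : ℝ[X]) - n + 2) * X * h1 

lemma legP_eval_one (hn : 2 ≤ n) (k : ℕ) : (legP n k).eval 1 = 1 := by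
  have h := congrArg (eval 1) (legP_deriv hn k).2
  have hn2 : (2 : ℝ) ≤ n := by exact_mod_cast hn
  have key : ∀ k, (legP n k).eval 1 = 1 ∧ (legP n (k + 1)).eval 1 = 1 := fun k => by
    induction k with
    | zero => simp [legP_zero, legP_one]
    | succ k ih =>
      refine ⟨ih.2, ?_⟩
      have hr := congrArg (eval 1) (legP_rec hn k)
      simp only [eval_mul, eval_sub, eval_C, eval_X, ih.1, ih.2] at hr
      have : (0 : ℝ) ≤ k := k.cast_nonneg
      have hne : (k : ℝ) + n - 1 ≠ 0 := by linarith
      apply mul_left_cancel₀ hne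
      linarith
  exact (key k).1

lemma legP_comp_neg (k : ℕ) (t : ℝ) :
    (legP n (2 * k)).eval (-t) = (legP n (2 * k)).eval t ∧
      (legP n (2 * k + 1)).eval (-t) = -(legP n (2 * k + 1)).eval t := by
  induction k with
  | zero => simp [legP_zero, legP_one]
  | succ k ih =>
    have h1 : (legP n (2 * (k + 1))).eval (-t) = (legP n (2 * (k + 1))).eval t := by
      rw [mul_add, mul_one, legP]
      simp only [eval_sub, eval_mul, eval_C, eval_X, ih.1, ih.2]; ring
    refine ⟨h1, ?_⟩
    rw [show 2 * (k + 1) + 1 = (2 * k + 1) + 2 by ring, legP]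
    simp only [eval_sub, eval_mul, eval_C, eval_X, ih.2]
    rw [show 2 * k + 1 + 1 = 2 * (k + 1) by ring, h1]; ring

lemma legP_eval_zero_ne (hn : 2 ≤ n) (k : ℕ) : (legP n (2 * k)).eval 0 ≠ 0 := by
  induction k with
  | zero => simp [legP_zero]
  | succ k ih =>
    have hn2 : (2 : ℝ) ≤ n := by exact_mod_cast hn
    have : (0 : ℝ) ≤ k := k.cast_nonneg
    rw [mul_add, mul_one, legP]
    simp only [eval_sub, eval_mul, eval_C, eval_X, zero_mul, mul_zero, zero_sub, Ne, neg_eq_zero,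
      mul_eq_zero, not_or]
    refine ⟨(div_pos ?_ ?_).ne', ih⟩ <;> push_cast <;> linarith

/-- Even Legendre polynomials have no linear term. -/
lemma legP_even_decomp (k : ℕ) : ∃ H : ℝ[X],
    legP n (2 * k) = C ((legP n (2 * k)).eval 0) + X ^ 2 * H := by
  set F := legP n (2 * k) with hF
  refine ⟨F.divX.divX, ?_⟩
  have h0 : F.comp (-X) = F := Polynomial.funext fun t => by
    rw [eval_comp, eval_neg, eval_X]; exact (legP_comp_neg k t).1
  have h1 : F.coeff 1 = 0 := by
    have h2 := congrArg (fun p => eval 0 (derivative p)) h0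
    simp only [derivative_comp, eval_mul, eval_comp, eval_neg, eval_X, neg_zero, derivative_neg,
      derivative_X, eval_one] at h2
    have h3 : (derivative F).eval 0 = F.coeff 1 := by
      rw [← coeff_zero_eq_eval_zero, coeff_derivative]; simp
    rw [h3] at h2
    linarith
  have h4 : F.divX.coeff 0 = 0 := by rw [coeff_divX]; exact h1
  conv_lhs => rw [← divX_mul_X_add F, ← divX_mul_X_add F.divX, h4]
  rw [coeff_zero_eq_eval_zero, C_0]; ring

/-- Powers are combinations of Legendre polynomials of smaller degree. -/
lemma X_mul_legP (hn : 2 ≤ n) (k : ℕ) :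
    X * legP n (k + 1) = C ((k + n - 1) / (2 * k + n) : ℝ) * legP n (k + 2) +
      C ((k + 1) / (2 * k + n) : ℝ) * legP n k := by
  have hn2 : (2 : ℝ) ≤ n := by exact_mod_cast hn
  have : (0 : ℝ) ≤ k := k.cast_nonneg
  have h : (2 * k + n : ℝ) ≠ 0 := by linarith
  have hne : (C (2 * (k : ℝ) + n) : ℝ[X]) ≠ 0 := C_ne_zero.2 h
  apply mul_left_cancel₀ hne
  rw [mul_add, ← mul_assoc (C _) (C _), ← mul_assoc (C _) (C _), ← C_mul, ← C_mul,
    mul_div_cancel₀ _ h, mul_div_cancel₀ _ h, legP_rec hn k]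
  ring

lemma exists_legP_sum (hn : 2 ≤ n) (k : ℕ) (Q : ℝ[X]) (hQ : Q.natDegree ≤ k) :
    ∃ c : ℕ → ℝ, Q = ∑ j ∈ Finset.range (k + 1), C (c j) * legP n j := by
  have key : ∀ j, X ^ j ∈ Submodule.span ℝ (legP n '' Set.Iic j) := fun j => by
    induction j with
    | zero => exact Submodule.subset_span ⟨0, by simp, by simp [legP_zero]⟩
    | succ j ih =>
      rw [pow_succ']
      refine Submodule.span_induction (p := fun q _ => X * q ∈ Submodule.span ℝ (legP n '' Set.Iic (j + 1)))
        ?_ (by simp) (fun x y _ _ hx hy => by rw [mul_add]; exact add_mem hx hy)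
        (fun a x _ hx => by rw [mul_smul_comm]; exact Submodule.smul_mem _ _ hx) ih
      rintro _ ⟨l, hl, rfl⟩
      have hl' : l ≤ j := hl
      cases l with
      | zero => exact Submodule.subset_span ⟨1, by simp, by simp [legP_zero, legP_one]⟩
      | succ l =>
        rw [X_mul_legP hn, ← smul_eq_C_mul, ← smul_eq_C_mul]
        exact add_mem
          (Submodule.smul_mem _ _ (Submodule.subset_span ⟨_, Set.mem_Iic.2 (by omega), rfl⟩))
          (Submodule.smul_mem _ _ (Submodule.subset_span ⟨_, Set.mem_Iic.2 (by omega), rfl⟩))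
  have hQ2 : Q ∈ Submodule.span ℝ (legP n '' (Finset.range (k + 1) : Set ℕ)) := by
    rw [Q.as_sum_range_C_mul_X_pow]
    refine Submodule.sum_mem _ fun j hj => ?_
    rw [← smul_eq_C_mul]
    refine Submodule.smul_mem _ _ (Submodule.span_mono (Set.image_mono fun l hl => ?_) (key j))
    have := Finset.mem_range.1 hj
    have : l ≤ j := hl
    simp; omega
  obtain ⟨c, hc⟩ := Submodule.mem_span_image_finset_iff_exists_fun ℝ |>.1 hQ2
  refine ⟨fun j => if h : j ∈ Finset.range (k + 1) then c ⟨j, h⟩ else 0, ?_⟩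
  rw [← hc, ← Finset.sum_coe_sort (Finset.range (k + 1))]
  refine Finset.sum_congr rfl fun j _ => ?_
  beta_reduce
  rw [dif_pos j.2, smul_eq_C_mul]

open scoped NNReal in
/-- Even powers are nonnegative combinations of even Legendre polynomials. -/
lemma exists_legP_nonneg_sum (hn : 2 ≤ n) (m : ℕ) :
    ∃ (s : Finset ℕ) (c : ℕ → ℝ), (∀ l, 0 ≤ c l) ∧
      X ^ (2 * m) = ∑ l ∈ s, C (c l) * legP n (2 * l) := by
  have hn2 : (2 : ℝ) ≤ n := by exact_mod_cast hn
  have hp : ∀ k : ℕ, 0 ≤ ((k + n - 1) / (2 * k + n) : ℝ) ∧ 0 ≤ ((k + 1) / (2 * k + n) : ℝ) := by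
    intro k
    have : (0 : ℝ) ≤ k := k.cast_nonneg
    constructor
    · exact div_nonneg (by linarith) (by linarith)
    · positivity
  have hodd : ∀ k q, q ∈ Submodule.span ℝ≥0 (Set.range fun l => legP n (2 * l + k)) →
      ∀ r, (∀ l, X * legP n (2 * l + k) ∈ Submodule.span ℝ≥0 (Set.range fun l => legP n (2 * l + r))) →
      X * q ∈ Submodule.span ℝ≥0 (Set.range fun l => legP n (2 * l + r)) := by
    intro k q hq r hr
    refine Submodule.span_induction (p := fun q _ => X * q ∈ Submodule.span ℝ≥0
      (Set.range fun l => legP n (2 * l + r)))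
        ?_ (by simp) (fun x y _ _ hx hy => by rw [mul_add]; exact add_mem hx hy)
        (fun a x _ hx => by rw [mul_smul_comm]; exact Submodule.smul_mem _ _ hx) hq
    rintro _ ⟨l, rfl⟩
    exact hr l
  have hC : ∀ (a : ℝ) (ha : 0 ≤ a) (q : ℝ[X]), C a * q = (⟨a, ha⟩ : ℝ≥0) • q := fun a ha q => by
    rw [← smul_eq_C_mul]; rfl
  have key : ∀ m : ℕ, X ^ (2 * m) ∈ Submodule.span ℝ≥0 (Set.range fun l => legP n (2 * l + 0)) := by
    intro m
    induction m with
    | zero => exact Submodule.subset_span ⟨0, by simp [legP_zero]⟩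
    | succ m ih =>
      rw [mul_add, mul_one, pow_succ', pow_succ']
      refine hodd 1 _ (hodd 0 _ ih 1 fun l => ?_) 0 fun l => ?_
      · cases l with
        | zero => exact Submodule.subset_span ⟨0, by simp [legP_zero, legP_one]⟩
        | succ l =>
          rw [show 2 * (l + 1) + 0 = (2 * l + 1) + 1 by ring, X_mul_legP hn, hC _ (hp _).1,
            hC _ (hp _).2]
          exact add_mem
            (Submodule.smul_mem _ _ (Submodule.subset_span ⟨l + 1, by ring_nf⟩))
            (Submodule.smul_mem _ _ (Submodule.subset_span ⟨l, rfl⟩))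
      · rw [X_mul_legP hn, hC _ (hp _).1, hC _ (hp _).2]
        exact add_mem
            (Submodule.smul_mem _ _ (Submodule.subset_span ⟨l + 1, by ring_nf⟩))
            (Submodule.smul_mem _ _ (Submodule.subset_span ⟨l, rfl⟩))
  obtain ⟨c, hc⟩ := (Finsupp.mem_span_range_iff_exists_finsupp).1 (key m)
  refine ⟨c.support, fun l => (c l : ℝ), fun l => (c l).2, ?_⟩
  rw [← hc, Finsupp.sum]
  refine Finset.sum_congr rfl fun l _ => ?_
  exact (hC _ (c l).2 _).symm

end legendre

end

section

section moments

variable [NeZero n]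

omit [NeZero n] in
lemma continuous_comp_inner {F : ℝ → ℝ} (hF : Continuous F) (u : En n) :
    Continuous fun v : Sph n => F ⟪u, v⟫_ℝ := by fun_prop

omit [NeZero n] in
lemma integrable_comp_inner {F : ℝ → ℝ} (hF : Continuous F) (u : En n) (μ : Measure (Sph n))
    [IsFiniteMeasure μ] : Integrable (fun v : Sph n => F ⟪u, v⟫_ℝ) μ :=
  integrable_of_continuous (continuous_comp_inner hF u) μ

lemma Es_add {F G : ℝ → ℝ} (hF : Continuous F) (hG : Continuous G) :
    Es n (fun t => F t + G t) = Es n F + Es n G :=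
  integral_add (integrable_comp_inner hF _ _) (integrable_comp_inner hG _ _)

lemma Es_sub {F G : ℝ → ℝ} (hF : Continuous F) (hG : Continuous G) :
    Es n (fun t => F t - G t) = Es n F - Es n G :=
  integral_sub (integrable_comp_inner hF _ _) (integrable_comp_inner hG _ _)

lemma Es_const_mul (c : ℝ) (F : ℝ → ℝ) : Es n (fun t => c * F t) = c * Es n F :=
  integral_const_mul _ _

lemma Es_const (c : ℝ) : Es n (fun _ => c) = c := by simp [Es]

lemma Es_mono {F G : ℝ → ℝ} (hF : Continuous F) (hG : Continuous G)
    (h : ∀ t, |t| ≤ 1 → F t ≤ G t) : Es n F ≤ Es n G :=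
  integral_mono (integrable_comp_inner hF _ _) (integrable_comp_inner hG _ _)
    fun v => h _ (abs_inner_sph_le _ v)

lemma Es_sum {ι : Type*} (s : Finset ι) {F : ι → ℝ → ℝ} (hF : ∀ i, Continuous (F i)) :
    Es n (fun t => ∑ i ∈ s, F i t) = ∑ i ∈ s, Es n (F i) :=
  integral_finsetSum _ fun i _ => integrable_comp_inner (hF i) _ _

lemma integral_coord_mul {W : ℝ → ℝ} (hW : Continuous W) {u w : En n} (hu : ‖u‖ = 1) (hw : ‖w‖ = 1)
    (huw : ⟪u, w⟫_ℝ = 0) (θ : ℝ) :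
    ∫ v : Sph n, ⟪w, v⟫_ℝ * W ⟪Real.cos θ • u + Real.sin θ • w, v⟫_ℝ ∂(sig n) =
      Real.sin θ * Es n (fun t => t * W t) := by
  have huu : ⟪u, u⟫_ℝ = 1 := by rw [real_inner_self_eq_norm_sq, hu, one_pow]
  have hww : ⟪w, w⟫_ℝ = 1 := by rw [real_inner_self_eq_norm_sq, hw, one_pow]
  have hwu : ⟪w, u⟫_ℝ = 0 := by rw [real_inner_comm, huw]
  set p : En n := Real.cos θ • u + Real.sin θ • w with hp
  have hpn : ‖p‖ = 1 := by
    rw [← sq_eq_sq₀ (norm_nonneg _) zero_le_one, ← real_inner_self_eq_norm_sq, hp]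
    simp only [inner_add_left, inner_add_right, real_inner_smul_left, real_inner_smul_right, huu, hww,
      huw, hwu]
    nlinarith [Real.sin_sq_add_cos_sq θ]
  set q : En n := Real.cos θ • w - Real.sin θ • u with hq
  have hpq : ⟪p, q⟫_ℝ = 0 := by
    simp only [hp, hq, inner_add_left, inner_sub_right, real_inner_smul_left, real_inner_smul_right, huu,
      hww, huw, hwu]
    ring
  have hwpq : w = Real.sin θ • p + Real.cos θ • q := by
    simp only [hp, hq]
    have : w = (Real.sin θ ^ 2 + Real.cos θ ^ 2) • w := by rw [Real.sin_sq_add_cos_sq, one_smul]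
    conv_lhs => rw [this]
    module
  let P : Sph n := ⟨p, by simp [hpn]⟩
  have h1 := (isAxial_sig P).integral_pow_odd (F := W) (by fun_prop) hpq odd_one
  have h2 := integral_sig_zonal (F := fun t => t * W t) (w := P) (by fun_prop) P
  have h3 : ∀ v : Sph n, ⟪w, (v : En n)⟫_ℝ * W ⟪p, (v : En n)⟫_ℝ =
      Real.sin θ * (⟪p, (v : En n)⟫_ℝ * W ⟪p, (v : En n)⟫_ℝ) +
      Real.cos θ * (W ⟪p, (v : En n)⟫_ℝ * ⟪q, (v : En n)⟫_ℝ ^ 1) := fun v => by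
    conv_lhs => rw [hwpq]
    rw [inner_add_left, real_inner_smul_left, real_inner_smul_left, pow_one]
    ring
  simp only [h3]
  rw [integral_add (Integrable.const_mul (integrable_of_continuous (by fun_prop) _) _)
    (Integrable.const_mul (integrable_of_continuous (by fun_prop) _) _), integral_const_mul,
    integral_const_mul, h1, h2]
  ring

lemma integral_coord_sq_mul {W W' : ℝ → ℝ} (hd : ∀ t, HasDerivAt W (W' t) t) (hW' : Continuous W')
    {u w : En n} (hu : ‖u‖ = 1) (hw : ‖w‖ = 1) (huw : ⟪u, w⟫_ℝ = 0) :
    ∫ v : Sph n, ⟪w, v⟫_ℝ ^ 2 * W' ⟪u, v⟫_ℝ ∂(sig n) = Es n (fun t => t * W t) := by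
  have hW : Continuous W := continuous_iff_continuousAt.2 fun t => (hd t).continuousAt
  let G : ℝ → Sph n → ℝ := fun θ v => ⟪w, v⟫_ℝ * W ⟪Real.cos θ • u + Real.sin θ • w, v⟫_ℝ
  let G' : ℝ → Sph n → ℝ := fun θ v => ⟪w, v⟫_ℝ * (W' ⟪Real.cos θ • u + Real.sin θ • w, v⟫_ℝ *
    ⟪-Real.sin θ • u + Real.cos θ • w, v⟫_ℝ)
  have hG' : Continuous (Function.uncurry G') := by
    have : Continuous fun p : ℝ × Sph n => ⟪w, (p.2 : En n)⟫_ℝ *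
      (W' ⟪Real.cos p.1 • u + Real.sin p.1 • w, (p.2 : En n)⟫_ℝ *
        ⟪-Real.sin p.1 • u + Real.cos p.1 • w, (p.2 : En n)⟫_ℝ) := by fun_prop
    exact this
  obtain ⟨C, hC⟩ := ((isCompact_Icc (a := (-1 : ℝ)) (b := 1)).prod
    (isCompact_univ (X := Sph n))).exists_bound_of_continuousOn hG'.continuousOn
  have key := hasDerivAt_integral_of_dominated_loc_of_deriv_le (μ := sig n) (F := G) (F' := G')
    (x₀ := 0) (s := Set.Icc (-1) 1) (bound := fun _ => C) (Icc_mem_nhds (by norm_num) (by norm_num))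
    (Eventually.of_forall fun θ => (Continuous.aestronglyMeasurable (by fun_prop)))
    (integrable_of_continuous (by fun_prop) _)
    (Continuous.aestronglyMeasurable (by fun_prop))
    (Eventually.of_forall fun v θ hθ => hC (θ, v) ⟨hθ, Set.mem_univ _⟩)
    (integrable_const _)
    (Eventually.of_forall fun v θ _ => by
      have h1 : HasDerivAt (fun θ : ℝ => ⟪Real.cos θ • u + Real.sin θ • w, (v : En n)⟫_ℝ)
          ⟪-Real.sin θ • u + Real.cos θ • w, (v : En n)⟫_ℝ θ := by
        simp only [inner_add_left, real_inner_smul_left]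
        exact ((Real.hasDerivAt_cos θ).mul_const _).add ((Real.hasDerivAt_sin θ).mul_const _)
      exact ((hd _).comp θ h1).const_mul _)
  have h2 : (fun θ => ∫ v, G θ v ∂(sig n)) = fun θ => Real.sin θ * Es n (fun t => t * W t) :=
    funext fun θ => integral_coord_mul hW hu hw huw θ
  rw [h2] at key
  have h3 := key.2.unique ((Real.hasDerivAt_sin 0).mul_const _)
  rw [Real.cos_zero, one_mul] at h3
  rw [← h3]
  refine integral_congr_ae (Eventually.of_forall fun v => ?_)
  simp only [G', Real.cos_zero, Real.sin_zero, one_smul, zero_smul, neg_zero, zero_add, add_zero]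
  ring

omit [NeZero n] in
lemma sum_coord_sq (v : Sph n) : ∑ j : Fin n, ⟪(EuclideanSpace.single j 1 : En n), v⟫_ℝ ^ 2 = 1 := by
  have h := EuclideanSpace.norm_sq_eq (v : En n)
  rw [norm_eq_of_mem_sphere, one_pow] at h
  simp [EuclideanSpace.inner_single_left, ← sq_abs] at h ⊢
  exact h.symm

/-- Integration by parts for zonal functions. -/
lemma Es_parts {W W' : ℝ → ℝ} (hd : ∀ t, HasDerivAt W (W' t) t) (hW' : Continuous W') :
    Es n (fun t => (1 - t ^ 2) * W' t) = (n - 1) * Es n (fun t => t * W t) := by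
  have h1 : ∀ v : Sph n, (1 - ⟪(e0 n : En n), v⟫_ℝ ^ 2) * W' ⟪(e0 n : En n), v⟫_ℝ =
      ∑ j ∈ Finset.univ.erase (0 : Fin n), ⟪(EuclideanSpace.single j 1 : En n), v⟫_ℝ ^ 2 *
        W' ⟪(e0 n : En n), v⟫_ℝ := fun v => by
    have h2 := sum_coord_sq v
    rw [← Finset.add_sum_erase _ _ (Finset.mem_univ (0 : Fin n))] at h2
    rw [← Finset.sum_mul]
    congr 1
    simp only [e0]
    linarith
  unfold Es
  simp only [h1]
  rw [integral_finsetSum _ fun j _ => integrable_of_continuous (by fun_prop) _]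
  rw [Finset.sum_congr rfl fun j hj => integral_coord_sq_mul hd hW' (u := (e0 n : En n))
    (w := EuclideanSpace.single j 1) (by simp [e0]) (by simp) (by
      simp [e0, EuclideanSpace.inner_single_left, (Finset.ne_of_mem_erase hj)])]
  rw [Finset.sum_const, Finset.card_erase_of_mem (Finset.mem_univ _), Finset.card_univ, Fintype.card_fin,
    nsmul_eq_mul, Nat.cast_sub (Nat.one_le_iff_ne_zero.2 (NeZero.ne n)), Nat.cast_one]
  rfl

open Polynomial

/-- Absolute moments. -/
lemma Es_abs_parts (G : ℝ[X]) :
    Es n (fun t => |t| * ((1 - X ^ 2) * (2 * G + X * derivative G)).eval t) =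
      (n - 1) * Es n (fun t => |t| * (X ^ 2 * G).eval t) := by
  have hd : ∀ t : ℝ, HasDerivAt (fun t => t * |t| * G.eval t)
      (2 * |t| * G.eval t + t * |t| * (derivative G).eval t) t := fun t => by
    refine HasDerivAt.mul ?_ (G.hasDerivAt t)
    rcases lt_trichotomy t 0 with h | rfl | h
    · have h2 : (fun t : ℝ => t * |t|) =ᶠ[𝓝 t] fun t => -(t ^ 2) := by
        filter_upwards [Iio_mem_nhds h] with s hs
        rw [abs_of_neg hs]; ring
      rw [h2.hasDerivAt_iff, abs_of_neg h]
      exact ((hasDerivAt_pow 2 t).neg).congr_deriv (by simp)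
    · rw [hasDerivAt_iff_isLittleO]
      simp only [abs_zero, mul_zero, sub_zero, smul_zero]
      exact (Asymptotics.isLittleO_iff.2 fun c hc => by
        filter_upwards [Metric.ball_mem_nhds (0 : ℝ) hc] with s hs
        rw [mem_ball_zero_iff] at hs
        rw [norm_mul, norm_abs_eq_norm]; exact mul_le_mul_of_nonneg_right hs.le (norm_nonneg _))
    · have h2 : (fun t : ℝ => t * |t|) =ᶠ[𝓝 t] fun t => t ^ 2 := by
        filter_upwards [Ioi_mem_nhds h] with s hs
        rw [abs_of_pos hs]; ring
      rw [h2.hasDerivAt_iff, abs_of_pos h]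
      exact (hasDerivAt_pow 2 t).congr_deriv (by simp)
  have h := Es_parts (n := n) hd (by fun_prop)
  convert h using 2
  · ext t; simp; ring
  · congr 1; ext t; simp only [eval_mul, eval_pow, eval_X]; ring

lemma Es_poly_parts (Q : ℝ[X]) :
    Es n (fun t => ((1 - X ^ 2) * derivative Q).eval t) =
      (n - 1) * Es n (fun t => (X * Q).eval t) := by
  have h := Es_parts (n := n) (fun t => Q.hasDerivAt t) (by fun_prop)
  simpa using h

lemma Es_eval_add (P Q : ℝ[X]) : Es n (fun t => (P + Q).eval t) =
    Es n (fun t => P.eval t) + Es n (fun t => Q.eval t) := by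
  rw [← Es_add (by fun_prop) (by fun_prop)]; simp

lemma Es_eval_sub (P Q : ℝ[X]) : Es n (fun t => (P - Q).eval t) =
    Es n (fun t => P.eval t) - Es n (fun t => Q.eval t) := by
  rw [← Es_sub (by fun_prop) (by fun_prop)]; simp

lemma Es_eval_C_mul (c : ℝ) (Q : ℝ[X]) : Es n (fun t => (C c * Q).eval t) =
    c * Es n (fun t => Q.eval t) := by
  rw [← Es_const_mul]; simp

lemma Es_legD (F G : ℝ[X]) : Es n (fun t => (legD n F * G).eval t) =
    - Es n (fun t => ((1 - X ^ 2) * (derivative F * derivative G)).eval t) := by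
  have h := Es_poly_parts (n := n) (derivative F * G)
  rw [derivative_mul, mul_add, Es_eval_add, ← Es_eval_C_mul] at h
  have h2 : legD n F * G = (1 - X ^ 2) * (derivative (derivative F) * G) -
      C (n - 1 : ℝ) * (X * (derivative F * G)) := by unfold legD; ring
  rw [h2, Es_eval_sub]
  linarith

lemma Es_legP_mul_legP (hn : 3 ≤ n) {j k : ℕ} (hjk : j ≠ k) :
    Es n (fun t => (legP n j * legP n k).eval t) = 0 := by
  have h1 := Es_legD (n := n) (legP n j) (legP n k)
  have h2 := Es_legD (n := n) (legP n k) (legP n j)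
  rw [mul_comm (derivative (legP n k)), ← h1, legD_legP (by omega), legD_legP (by omega), ← C_neg,
    ← C_neg, mul_assoc, mul_assoc, mul_comm (legP n k), Es_eval_C_mul, Es_eval_C_mul] at h2
  have hn3 : (3 : ℝ) ≤ n := by exact_mod_cast hn
  have h4 : (j * (j + n - 2) - k * (k + n - 2) : ℝ) * Es n (fun t => (legP n j * legP n k).eval t) = 0 := by
    linarith
  refine (mul_eq_zero.1 h4).resolve_left ?_
  have h5 : (j * (j + n - 2) - k * (k + n - 2) : ℝ) = (j - k) * (j + k + n - 2) := by ring
  rw [h5]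
  refine mul_ne_zero ?_ ?_
  · exact sub_ne_zero.2 (by exact_mod_cast hjk)
  have h6 : (0 : ℝ) ≤ j := j.cast_nonneg
  have h7 : (0 : ℝ) ≤ k := k.cast_nonneg
  linarith

/-- The squared norm of a Legendre polynomial. -/
def legE (n k : ℕ) [NeZero n] : ℝ := Es n (fun t => (legP n k * legP n k).eval t)

lemma legE_zero : legE n 0 = 1 := by simp [legE, legP_zero, Es_const]

lemma Es_sq : n * Es n (fun t => t ^ 2) = 1 := by
  have h := Es_poly_parts (n := n) X
  have h2 : Es n (fun t => ((1 - X ^ 2) * derivative X : ℝ[X]).eval t) = 1 - Es n (fun t => t ^ 2) := by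
    rw [← Es_const (n := n) 1, ← Es_sub (by fun_prop) (by fun_prop)]; simp
  rw [h2] at h
  have h3 : Es n (fun t => (X * X : ℝ[X]).eval t) = Es n (fun t => t ^ 2) := by
    congr 1; ext t; simp; ring
  rw [h3] at h
  linarith

lemma legE_one : n * legE n 1 = 1 := by
  rw [legE, legP_one, ← Es_sq (n := n)]
  congr 2; ext t; simp; ring

lemma legE_succ (hn : 3 ≤ n) (k : ℕ) :
    ((k : ℝ) + n - 1) * (2 * k + n + 2) * legE n (k + 2) = (2 * k + n) * (k + 2) * legE n (k + 1) := by
  have h1 := congrArg (fun p => p * legP n (k + 2)) (legP_rec (n := n) (by omega) k)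
  have h2 := congrArg (fun p => p * legP n (k + 1)) (legP_rec (n := n) (by omega) (k + 1))
  simp only [sub_mul, mul_assoc] at h1 h2
  have h1' := congrArg (fun p : ℝ[X] => Es n fun t => p.eval t) h1
  have h2' := congrArg (fun p : ℝ[X] => Es n fun t => p.eval t) h2
  simp only [Es_eval_sub, Es_eval_C_mul] at h1' h2'
  rw [Es_legP_mul_legP hn (show k ≠ k + 2 by omega)] at h1'
  rw [Es_legP_mul_legP hn (show k + 1 + 2 ≠ k + 1 by omega)] at h2'
  rw [show k + 1 + 1 = k + 2 by ring, mul_comm (legP n (k + 2)) (legP n (k + 1))] at h2'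
  unfold legE
  push_cast at h1' h2'
  linear_combination (2 * k + n + 2 : ℝ) * h1' - (2 * k + n : ℝ) * h2'

lemma legE_pos (hn : 3 ≤ n) (k : ℕ) : 0 < legE n k := by
  have hn3 : (3 : ℝ) ≤ n := by exact_mod_cast hn
  induction k with
  | zero => rw [legE_zero]; exact one_pos
  | succ k ih =>
    cases k with
    | zero => exact pos_of_mul_pos_right (by rw [legE_one]; exact one_pos) (by linarith)
    | succ k =>
      have h := legE_succ hn k
      have hk : (0 : ℝ) ≤ k := k.cast_nonneg
      have h1 : 0 < (2 * (k : ℝ) + n) * (k + 2) * legE n (k + 1) := by positivity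
      rw [← h] at h1
      refine pos_of_mul_pos_right h1 ?_
      have : (0 : ℝ) ≤ (k : ℝ) + n - 1 := by linarith
      positivity

/-- The multipliers of `|t|`. -/
lemma Es_abs_legP (hn : 2 ≤ n) (k : ℕ) :
    ((2 * k) * (2 * k + n - 2) - (n - 1) : ℝ) * Es n (fun t => |t| * (legP n (2 * k)).eval t) =
      - ((n - 1) * Es n (fun t => |t|) * (legP n (2 * k)).eval 0) := by
  obtain ⟨H, hH⟩ := legP_even_decomp (n := n) k
  have hD := legD_legP (n := n) hn (2 * k)
  set F := legP n (2 * k) with hF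
  set c := F.eval 0 with hc
  have hF' : derivative F = X * (2 * H + X * derivative H) := by
    conv_lhs => rw [hH]
    simp only [derivative_add, derivative_C, derivative_mul, derivative_X_pow]
    simp only [zero_add, Nat.cast_ofNat, map_ofNat, Nat.add_one_sub_one, pow_one]
    ring
  have e1 := Es_abs_parts (n := n) H
  have e2 := Es_abs_parts (n := n) (2 * H + X * derivative H)
  set G := 2 * H + X * derivative H with hG
  have hF'' : derivative (derivative F) = G + X * derivative G := by
    rw [hF', derivative_mul, derivative_X, one_mul]
  have hDF : legD n F = (1 - X ^ 2) * (G + X * derivative G) - C (n - 1 : ℝ) * (X ^ 2 * G) := by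
    rw [legD, hF'', hF']; ring
  let A : ℝ[X] → ℝ := fun Q => Es n fun t => |t| * Q.eval t
  have hadd : ∀ P Q, A (P + Q) = A P + A Q := fun P Q => by
    simp only [A]; rw [← Es_add (by fun_prop) (by fun_prop)]; simp only [eval_add, mul_add]
  have hC : ∀ (a : ℝ) Q, A (C a * Q) = a * A Q := fun a Q => by
    simp only [A]; rw [← Es_const_mul]; simp only [eval_mul, eval_C]; congr 1; ext t; ring
  have hsub : ∀ P Q, A (P - Q) = A P - A Q := fun P Q => by
    simp only [A]; rw [← Es_sub (by fun_prop) (by fun_prop)]; simp only [eval_sub, mul_sub]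
  have hc1 : A (C c) = c * Es n (fun t => |t|) := by
    rw [← mul_one (C c), hC]; simp [A]
  have hX : X ^ 2 * H = F - C c := by rw [hH]; ring
  have e3 : (1 - X ^ 2) * (2 * G + X * derivative G) = (1 - X ^ 2) * (G + X * derivative G) +
      (1 - X ^ 2) * G := by ring
  rw [e3] at e2
  rw [hX] at e1
  have hD2 := congrArg A (hDF.symm.trans hD)
  rw [hsub, hC, ← C_neg, hC] at hD2
  change A _ = _ * A _ at e1 e2
  rw [hadd] at e2
  rw [hsub, hc1] at e1
  push_cast at hD2
  change _ * A F = _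
  linarith

end moments

end

section

section FunkHecke

open Polynomial

lemma natDegree_legP_le (k : ℕ) : (legP n k).natDegree ≤ k ∧ (legP n (k + 1)).natDegree ≤ k + 1 := by
  induction k with
  | zero => simp [legP_zero, legP_one]
  | succ k ih =>
    refine ⟨ih.2, ?_⟩
    rw [show k + 1 + 1 = k + 2 by ring, legP]
    refine (natDegree_sub_le _ _).trans (max_le ?_ ?_)
    · refine (natDegree_C_mul_le _ _).trans (natDegree_mul_le.trans ?_)
      rw [natDegree_X]; omega
    · exact (natDegree_C_mul_le _ _).trans (ih.1.trans (by omega))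

variable [NeZero n]

lemma integral_sig_inner {F : ℝ → ℝ} (hF : Continuous F) (u : Sph n) :
    ∫ v : Sph n, F ⟪(u : En n), v⟫_ℝ ∂(sig n) = Es n F :=
  integral_sig_zonal (w := u) (continuous_comp_inner hF _) u

lemma integral_sig_inner' {F : ℝ → ℝ} (hF : Continuous F) (u : Sph n) :
    ∫ v : Sph n, F ⟪(v : En n), u⟫_ℝ ∂(sig n) = Es n F := by
  simp_rw [real_inner_comm (u : En n)]
  exact integral_sig_inner hF u

lemma legP_coeff_of_sum (hn : 3 ≤ n) {k : ℕ} {R : ℝ[X]} {c : ℕ → ℝ}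
    (h : R = ∑ j ∈ Finset.range (k + 1), C (c j) * legP n j) {i : ℕ} (hi : i ≤ k) :
    Es n (fun t => (R * legP n i).eval t) = c i * legE n i := by
  rw [h, Finset.sum_mul]
  simp only [eval_finsetSum]
  rw [Es_sum _ fun j => by fun_prop, Finset.sum_eq_single i]
  · rw [mul_assoc, Es_eval_C_mul]; rfl
  · intro j _ hji
    rw [mul_assoc, Es_eval_C_mul, Es_legP_mul_legP hn hji, mul_zero]
  · intro h; exact absurd (Finset.mem_range.2 (by omega)) h

lemma Es_mul_legP_of_lt (hn : 3 ≤ n) {j k : ℕ} (hjk : j < k) {R : ℝ[X]} (hR : R.natDegree ≤ j) :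
    Es n (fun t => (R * legP n k).eval t) = 0 := by
  obtain ⟨c, hc⟩ := exists_legP_sum (n := n) (by omega) j R hR
  rw [hc, Finset.sum_mul]
  simp only [eval_finsetSum]
  rw [Es_sum _ fun j => by fun_prop]
  refine Finset.sum_eq_zero fun l hl => ?_
  have := Finset.mem_range.1 hl
  rw [mul_assoc, Es_eval_C_mul, Es_legP_mul_legP hn (by omega), mul_zero]

lemma legP_conv_of_lt (hn : 3 ≤ n) {j k : ℕ} (hjk : j < k) (u v : Sph n) :
    ∫ e : Sph n, (legP n k).eval ⟪(u : En n), e⟫_ℝ * (legP n j).eval ⟪(v : En n), e⟫_ℝ ∂(sig n) = 0 := by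
  obtain ⟨R, hR, h⟩ := (isAxial_sig u).exists_poly (F := fun t => (legP n k).eval t) (by omega)
    (by fun_prop) (legP n j)
  have hRj : R.natDegree ≤ j := hR.trans (natDegree_legP_le j).1
  obtain ⟨c, hc⟩ := exists_legP_sum (n := n) (by omega) j R hRj
  rw [h]
  suffices R = 0 by rw [this, eval_zero]
  rw [hc]
  refine Finset.sum_eq_zero fun i hi => ?_
  have hij : i ≤ j := by have := Finset.mem_range.1 hi; omega
  have h1 := legP_coeff_of_sum hn hc hij
  rw [← integral_sig_inner (by fun_prop) u] at h1
  simp only [eval_mul] at h1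
  simp_rw [real_inner_comm _ (u : En n), ← h, ← integral_mul_const] at h1
  rw [fubini_sph (by fun_prop)] at h1
  obtain ⟨R', hR', h'⟩ : ∃ R' : ℝ[X], R'.natDegree ≤ j ∧ ∀ x : Sph n,
      ∫ e : Sph n, (legP n i).eval ⟪(u : En n), e⟫_ℝ * (legP n j).eval ⟪(x : En n), e⟫_ℝ ∂(sig n) =
        R'.eval ⟪(x : En n), u⟫_ℝ := by
    obtain ⟨R', h1, h2⟩ := (isAxial_sig u).exists_poly (F := fun t => (legP n i).eval t) (by omega)
      (by fun_prop) (legP n j)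
    exact ⟨R', h1.trans (natDegree_legP_le j).1, h2⟩
  have h2 : ∀ x : Sph n, ∫ e : Sph n, (legP n k).eval ⟪(u : En n), x⟫_ℝ * (legP n j).eval ⟪(e : En n), x⟫_ℝ *
      (legP n i).eval ⟪(e : En n), u⟫_ℝ ∂(sig n) = (R' * legP n k).eval ⟪(u : En n), x⟫_ℝ := fun x => by
    rw [eval_mul, real_inner_comm (x : En n) (u : En n), ← h', mul_comm, ← integral_const_mul]
    congr 1; ext e
    rw [real_inner_comm (u : En n) (e : En n), real_inner_comm (x : En n) (e : En n)]; ring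
  simp_rw [h2] at h1
  rw [integral_sig_inner (F := fun t => (R' * legP n k).eval t) (by fun_prop), Es_mul_legP_of_lt hn hjk hR'] at h1
  rw [(mul_eq_zero.1 h1.symm).resolve_right (legE_pos hn i).ne', C_0, zero_mul]

lemma legP_conv_of_ne (hn : 3 ≤ n) {j k : ℕ} (hjk : j ≠ k) (u v : Sph n) :
    ∫ e : Sph n, (legP n k).eval ⟪(u : En n), e⟫_ℝ * (legP n j).eval ⟪(v : En n), e⟫_ℝ ∂(sig n) = 0 := by
  rcases lt_or_gt_of_ne hjk with h | h
  · exact legP_conv_of_lt hn h u v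
  · rw [← legP_conv_of_lt hn h v u]
    congr 1; ext e; ring

/-- The Funk--Hecke formula. -/
lemma IsAxial.funk_hecke (hn : 3 ≤ n) {w : Sph n} {μ : Measure (Sph n)} [IsFiniteMeasure μ]
    (hμ : IsAxial w μ) {F : ℝ → ℝ} (hF : Continuous F) (k : ℕ) (e : Sph n) :
    ∫ v : Sph n, F ⟪(w : En n), v⟫_ℝ * (legP n k).eval ⟪(e : En n), v⟫_ℝ ∂μ =
      (legP n k).eval ⟪(e : En n), w⟫_ℝ *
        ∫ v : Sph n, F ⟪(w : En n), v⟫_ℝ * (legP n k).eval ⟪(w : En n), v⟫_ℝ ∂μ := by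
  obtain ⟨R, hR, h⟩ := hμ.exists_poly (F := F) (by omega) (by fun_prop) (legP n k)
  obtain ⟨c, hc⟩ := exists_legP_sum (n := n) (by omega) k R (hR.trans (natDegree_legP_le k).1)
  have hR2 : R = C (c k) * legP n k := by
    rw [hc]
    refine Finset.sum_eq_single k (fun i hi hik => ?_) (fun h => absurd (Finset.mem_range.2 (by omega)) h)
    have h1 := legP_coeff_of_sum hn hc (i := i) (by have := Finset.mem_range.1 hi; omega)
    rw [← integral_sig_inner (by fun_prop) w] at h1
    simp only [eval_mul] at h1
    simp_rw [real_inner_comm _ (w : En n), ← h, ← integral_mul_const] at h1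
    rw [fubini_sph (by fun_prop)] at h1
    have h2 : ∀ x : Sph n, ∫ e : Sph n, F ⟪(w : En n), x⟫_ℝ * (legP n k).eval ⟪(e : En n), x⟫_ℝ *
      (legP n i).eval ⟪(e : En n), w⟫_ℝ ∂(sig n) = 0 := fun x => by
      simp_rw [mul_assoc, integral_const_mul, real_inner_comm x.1, real_inner_comm w.1]
      rw [legP_conv_of_ne hn hik, mul_zero]
    simp_rw [h2, integral_zero] at h1
    rw [(mul_eq_zero.1 h1.symm).resolve_right (legE_pos hn i).ne', C_0, zero_mul]
  rw [h e, h w, hR2, inner_sph_self]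
  simp only [eval_mul, eval_C, legP_eval_one (n := n) (by omega)]
  ring

lemma funk_hecke_sig (hn : 3 ≤ n) {F : ℝ → ℝ} (hF : Continuous F) (k : ℕ) (w e : Sph n) :
    ∫ v : Sph n, F ⟪(w : En n), v⟫_ℝ * (legP n k).eval ⟪(e : En n), v⟫_ℝ ∂(sig n) =
      (legP n k).eval ⟪(e : En n), w⟫_ℝ * Es n (fun t => F t * (legP n k).eval t) := by
  rw [(isAxial_sig w).funk_hecke hn hF k e, integral_sig_inner (F := fun t => F t * (legP n k).eval t)
    (by fun_prop) w]

end FunkHecke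

section approx

variable [NeZero n]

/-- Normalised even powers. -/
def pw (n m : ℕ) [NeZero n] (t : ℝ) : ℝ := t ^ (2 * m) / Es n (fun t => t ^ (2 * m))

lemma continuous_pw (m : ℕ) : Continuous (pw n m) := by unfold pw; fun_prop

lemma Es_pow_pos (m : ℕ) : 0 < Es n (fun t => t ^ (2 * m)) := by
  have hc : Continuous fun v : Sph n => ⟪(e0 n : En n), v⟫_ℝ ^ (2 * m) := by fun_prop
  refine hc.integral_pos_of_hasCompactSupport_nonneg_nonzero (HasCompactSupport.of_compactSpace _)
    (fun v => ?_) (x := e0 n) ?_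
  · exact (even_two_mul m).pow_nonneg _
  · simp

lemma pw_nonneg (m : ℕ) (t : ℝ) : 0 ≤ pw n m t :=
  div_nonneg ((even_two_mul m).pow_nonneg _) (Es_pow_pos m).le

lemma Es_pw (m : ℕ) : Es n (pw n m) = 1 := by
  have : Es n (pw n m) = Es n (fun t => (Es n (fun t => t ^ (2 * m)))⁻¹ * t ^ (2 * m)) := by
    congr 1; ext t; rw [pw]; ring
  rw [this, Es_const_mul, inv_mul_cancel₀ (Es_pow_pos m).ne']

/-- Even powers concentrate at the ends of the interval. -/
lemma exists_pw_le {r : ℝ} (hr0 : 0 < r) (hr : r < 1) {ε : ℝ} (hε : 0 < ε) :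
    ∃ M : ℕ, ∀ m ≥ M, ∀ t : ℝ, |t| ≤ r → pw n m t ≤ ε := by
  obtain ⟨r', h1, h2⟩ := exists_between hr
  have hr' : 0 < r' := hr0.trans h1
  let U : Set (Sph n) := {v | r' < ⟪(e0 n : En n), v⟫_ℝ}
  have hU : IsOpen U := isOpen_lt continuous_const (by fun_prop)
  have hUpos : 0 < (sig n).real U := by
    rw [measureReal_def]
    exact ENNReal.toReal_pos (hU.measure_pos _ ⟨e0 n, by
      change r' < _; rwa [inner_sph_self]⟩).ne' (measure_ne_top _ _)
  have hlow : ∀ m, r' ^ (2 * m) * (sig n).real U ≤ Es n (fun t => t ^ (2 * m)) := fun m => by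
    have h3 : ∫ v in U, r' ^ (2 * m) ∂(sig n) ≤ ∫ v in U, ⟪(e0 n : En n), v⟫_ℝ ^ (2 * m) ∂(sig n) := by
      refine setIntegral_mono_on (integrable_const _).integrableOn
        (integrable_of_continuous (by fun_prop) _).integrableOn hU.measurableSet fun v hv => ?_
      exact pow_le_pow_left₀ hr'.le (le_of_lt hv) _
    rw [setIntegral_const, smul_eq_mul, mul_comm] at h3
    refine h3.trans (setIntegral_le_integral (integrable_of_continuous (by fun_prop) _)
      (Eventually.of_forall fun v => (even_two_mul m).pow_nonneg _))
  have hq : r / r' < 1 := (div_lt_one hr').2 h1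
  have ht := tendsto_pow_atTop_nhds_zero_of_lt_one (div_nonneg hr0.le hr'.le) hq
  obtain ⟨M, hM⟩ := eventually_atTop.1 (ht.eventually (gt_mem_nhds (mul_pos hε hUpos)))
  refine ⟨M, fun m hm t ht => ?_⟩
  rw [pw, div_le_iff₀ (Es_pow_pos m)]
  have h4 := hM (2 * m) (by omega)
  rw [div_pow, div_lt_iff₀ (by positivity)] at h4
  have h5 : t ^ (2 * m) ≤ r ^ (2 * m) := by
    rw [← (even_two_mul m).pow_abs]
    exact pow_le_pow_left₀ (abs_nonneg _) ht _
  calc _ ≤ ε * (r' ^ (2 * m) * (sig n).real U) := by linarith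
    _ ≤ _ := mul_le_mul_of_nonneg_left (hlow m) hε.le

/-- Smoothing by even powers. -/
def smooth (m : ℕ) (f : Sph n → ℝ) (u : Sph n) : ℝ :=
  ∫ v : Sph n, pw n m ⟪(u : En n), v⟫_ℝ * f v ∂(sig n)

lemma continuous_smooth (m : ℕ) {f : Sph n → ℝ} (hf : Continuous f) : Continuous (smooth m f) := by
  have := continuous_pw (n := n) m
  exact continuous_integral_sph (by fun_prop) _

lemma smooth_tendsto {f : Sph n → ℝ} (hf : Continuous f) (heven : ∀ v, f (-v) = f v) {ε : ℝ}
    (hε : 0 < ε) : ∃ M : ℕ, ∀ m ≥ M, ∀ u, |smooth m f u - f u| ≤ ε := by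
  obtain ⟨C, hC⟩ : ∃ C, ∀ v, |f v| ≤ C := by
    obtain ⟨C, hC⟩ := (isCompact_univ (X := Sph n)).exists_bound_of_continuousOn hf.continuousOn
    exact ⟨C, fun v => hC v (Set.mem_univ v)⟩
  have hC0 : 0 ≤ C := (abs_nonneg _).trans (hC (e0 n))
  obtain ⟨δ, hδ, hunif⟩ := Metric.uniformContinuous_iff.1
    (CompactSpace.uniformContinuous_of_continuous hf) (ε / 2) (half_pos hε)
  set d := min δ 1 with hd
  have hd0 : 0 < d := lt_min hδ one_pos
  have hd1 : d ≤ 1 := min_le_right _ _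
  have hclose : ∀ u v : Sph n, 1 - d ^ 2 / 2 < ⟪(u : En n), v⟫_ℝ → |f v - f u| ≤ ε / 2 := by
    intro u v h
    have h1 : dist v u < δ := by
      rw [Subtype.dist_eq, dist_eq_norm]
      have h2 := norm_sub_sq_real (v : En n) (u : En n)
      rw [norm_eq_of_mem_sphere, norm_eq_of_mem_sphere, real_inner_comm] at h2
      have h3 : ‖(v : En n) - u‖ < d := lt_of_pow_lt_pow_left₀ 2 hd0.le (by linarith)
      exact h3.trans_le (min_le_left _ _)
    exact (hunif h1).le
  obtain ⟨M, hM⟩ := exists_pw_le (n := n) (r := 1 - d ^ 2 / 2) (by nlinarith) (by nlinarith)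
    (ε := ε / (2 * (2 * C + 1))) (by positivity)
  refine ⟨M, fun m hm u => ?_⟩
  have hcp := continuous_pw (n := n) m
  have h1 : smooth m f u - f u = ∫ v : Sph n, pw n m ⟪(u : En n), v⟫_ℝ * (f v - f u) ∂(sig n) := by
    simp_rw [mul_sub]
    rw [integral_sub (integrable_of_continuous (by fun_prop) _) (integrable_of_continuous (by fun_prop) _),
      integral_mul_const, integral_sig_inner hcp, Es_pw, one_mul]
    rfl
  rw [h1]
  refine (abs_integral_le_integral_abs).trans ?_
  have h2 : ∀ v : Sph n, |pw n m ⟪(u : En n), v⟫_ℝ * (f v - f u)| ≤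
      (ε / 2) * pw n m ⟪(u : En n), v⟫_ℝ + ε / 2 := fun v => by
    have hp := pw_nonneg (n := n) m ⟪(u : En n), v⟫_ℝ
    rw [abs_mul, abs_of_nonneg hp]
    by_cases h : |⟪(u : En n), (v : En n)⟫_ℝ| ≤ 1 - d ^ 2 / 2
    · have h3 := hM m hm _ h
      have h4 : |f v - f u| ≤ 2 * C + 1 := (abs_sub _ _).trans (by linarith [hC v, hC u])
      calc _ ≤ ε / (2 * (2 * C + 1)) * (2 * C + 1) :=
            mul_le_mul h3 h4 (abs_nonneg _) (by positivity)
        _ = ε / 2 := by field_simp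
        _ ≤ _ := by nlinarith
    · have h4 : |f v - f u| ≤ ε / 2 := by
        rcases lt_abs.1 (not_le.1 h) with h | h
        · exact hclose u v h
        · rw [← heven v]
          exact hclose u (-v) (by simpa [inner_neg_right] using h)
      nlinarith
  refine (integral_mono (integrable_of_continuous (by fun_prop) _)
    (integrable_of_continuous (by fun_prop) _) h2).trans ?_
  rw [integral_add (integrable_of_continuous (by fun_prop) _) (integrable_of_continuous (by fun_prop) _),
    integral_const_mul, integral_sig_inner hcp, Es_pw]
  simp

end approx

end

section

section approx2

open Polynomial

variable [NeZero n]

lemma tendsto_smooth {f : Sph n → ℝ} (hf : Continuous f) (heven : ∀ v, f (-v) = f v) (u : Sph n) :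
    Tendsto (fun m => smooth m f u) atTop (𝓝 (f u)) := by
  refine Metric.tendsto_atTop.2 fun ε hε => ?_
  obtain ⟨M, hM⟩ := smooth_tendsto hf heven (half_pos hε)
  exact ⟨M, fun m hm => (hM m hm u).trans_lt (half_lt_self hε)⟩

lemma tendsto_integral_smooth {f : Sph n → ℝ} (hf : Continuous f) (heven : ∀ v, f (-v) = f v)
    (μ : Measure (Sph n)) [IsFiniteMeasure μ] :
    Tendsto (fun m => ∫ u, smooth m f u ∂μ) atTop (𝓝 (∫ u, f u ∂μ)) := by
  refine Metric.tendsto_atTop.2 fun ε hε => ?_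
  have hpos : 0 < μ.real Set.univ + 1 := by have := measureReal_nonneg (μ := μ) (s := Set.univ); linarith
  obtain ⟨M, hM⟩ := smooth_tendsto hf heven (ε := ε / (μ.real Set.univ + 1)) (by positivity)
  refine ⟨M, fun m hm => ?_⟩
  rw [Real.dist_eq, ← integral_sub (integrable_of_continuous (continuous_smooth m hf) _)
    (integrable_of_continuous hf _)]
  refine (norm_integral_le_of_norm_le_const (C := ε / (μ.real Set.univ + 1))
    (Eventually.of_forall fun v => (Real.norm_eq_abs _).trans_le (hM m hm v))).trans_lt ?_
  rw [div_mul_eq_mul_div, div_lt_iff₀ hpos]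
  nlinarith [measureReal_nonneg (μ := μ) (s := Set.univ)]

/-- Legendre coefficients of the normalised even powers. -/
def pwc (n m l : ℕ) [NeZero n] : ℝ := Es n (fun t => pw n m t * (legP n (2 * l)).eval t)

lemma pwc_zero (m : ℕ) : pwc n m 0 = 1 := by
  rw [pwc, mul_zero, legP_zero]
  simpa using Es_pw (n := n) m

lemma pw_expand (hn : 3 ≤ n) (m : ℕ) : (∀ l, 0 ≤ pwc n m l) ∧ ∃ s : Finset ℕ, (∀ l ∉ s, pwc n m l = 0) ∧
    ∀ t, pw n m t = ∑ l ∈ s, pwc n m l / legE n (2 * l) * (legP n (2 * l)).eval t := by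
  obtain ⟨s, c, hc, h⟩ := exists_legP_nonneg_sum (n := n) (by omega) m
  set M := Es n (fun t => t ^ (2 * m)) with hM
  have hM0 : 0 < M := Es_pow_pos m
  have h1 : ∀ t, pw n m t = ∑ l ∈ s, c l / M * (legP n (2 * l)).eval t := fun t => by
    have h2 := congrArg (eval t) h
    simp only [eval_pow, eval_X, eval_finsetSum, eval_mul, eval_C] at h2
    rw [pw, h2, ← hM, Finset.sum_div]
    exact Finset.sum_congr rfl fun l _ => by ring
  have h3 : ∀ l, pwc n m l = ∑ l' ∈ s, c l' / M * Es n (fun t => (legP n (2 * l') * legP n (2 * l)).eval t) := by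
    intro l
    simp only [pwc, h1, Finset.sum_mul, mul_assoc]
    rw [Es_sum _ fun j => by fun_prop]
    refine Finset.sum_congr rfl fun j _ => ?_
    rw [Es_const_mul]
    simp only [eval_mul]
  have h4 : ∀ l ∉ s, pwc n m l = 0 := fun l hl => by
    rw [h3]
    refine Finset.sum_eq_zero fun j hj => ?_
    rw [Es_legP_mul_legP hn, mul_zero]
    rintro h5
    exact hl ((show j = l by omega) ▸ hj)
  have h5 : ∀ l ∈ s, pwc n m l = c l / M * legE n (2 * l) := fun l hl => by
    rw [h3, Finset.sum_eq_single l _ fun h => absurd hl h]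
    · rfl
    · intro j _ hjl
      rw [Es_legP_mul_legP hn (by omega), mul_zero]
  refine ⟨fun l => ?_, s, h4, fun t => ?_⟩
  · by_cases hl : l ∈ s
    · rw [h5 l hl]
      exact mul_nonneg (div_nonneg (hc l) hM0.le) (legE_pos hn _).le
    · rw [h4 l hl]
  · rw [h1]
    refine Finset.sum_congr rfl fun l hl => ?_
    rw [h5 l hl, mul_div_cancel_right₀ _ (legE_pos hn _).ne']

lemma tendsto_pwc (hn : 2 ≤ n) (l : ℕ) : Tendsto (fun m => pwc n m l) atTop (𝓝 1) := by
  have h := tendsto_smooth (n := n) (f := fun v => (legP n (2 * l)).eval ⟪(e0 n : En n), v⟫_ℝ)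
    (by fun_prop) (fun v => by
      rw [coe_neg_sphere, inner_neg_right]; exact (legP_comp_neg l _).1) (e0 n)
  simp only [inner_sph_self, legP_eval_one hn] at h
  exact h

lemma smooth_expand (m : ℕ) {s : Finset ℕ} {d : ℕ → ℝ}
    (h : ∀ t, pw n m t = ∑ l ∈ s, d l * (legP n (2 * l)).eval t) {f : Sph n → ℝ}
    (hf : Continuous f) (u : Sph n) : smooth m f u =
      ∑ l ∈ s, d l * ∫ v : Sph n, (legP n (2 * l)).eval ⟪(u : En n), v⟫_ℝ * f v ∂(sig n) := by
  simp only [smooth, h, Finset.sum_mul, mul_assoc]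
  rw [integral_finsetSum _ fun l _ => integrable_of_continuous (by fun_prop) _]
  simp only [integral_const_mul]

end approx2

section S1

variable [NeZero n]

lemma fin_one_ne_zero (hn : 2 ≤ n) : (1 : Fin n) ≠ 0 := by
  have : Fact (1 < n) := ⟨hn⟩
  exact (Fin.one_eq_zero_iff.not).2 (by omega)

/-- The first order area measure, normalised. -/
def S1 (X : ConvexBody (En n)) : Measure (Sph n) := S (Function.update (fun _ => ballB n) 1 X)

instance (X : ConvexBody (En n)) : IsFiniteMeasure (S1 X) := by unfold S1; infer_instance

lemma S1_ball : S1 (ballB n) = sig n := by rw [S1, sig, Function.update_eq_self_iff.2 rfl]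

lemma S1_add (hn : 2 ≤ n) (X Y : ConvexBody (En n)) : S1 (X + Y) = S1 X + S1 Y :=
  S_update_add _ (fin_one_ne_zero hn) X Y

lemma S1_scale (hn : 2 ≤ n) (X : ConvexBody (En n)) {c : ℝ} (hc : 0 ≤ c) :
    S1 (scale c X) = c.toNNReal • S1 X := S_update_scale _ (fin_one_ne_zero hn) X hc

lemma S1_symm (hn : 2 ≤ n) (X M : ConvexBody (En n)) :
    ∫ v : Sph n, supp M v ∂(S1 X) = ∫ v : Sph n, supp X v ∂(S1 M) :=
  integral_supp_S_swap _ (fin_one_ne_zero hn) X M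

lemma S1_mass (hn : 2 ≤ n) (X : ConvexBody (En n)) :
    (S1 X).real Set.univ = ∫ v : Sph n, supp X v ∂(sig n) := by
  rw [← S1_ball, ← S1_symm hn]
  simp

lemma S1_comp (ρ : En n ≃ₗᵢ[ℝ] En n) (X : ConvexBody (En n)) {f : Sph n → ℝ} (hf : Continuous f) :
    ∫ v, f (sphMap ρ v) ∂(S1 X) = ∫ v, f v ∂(S1 (rotate ρ X)) := by
  rw [S1, integral_comp_sphMap ρ _ hf, S1]
  congr 2; funext k
  by_cases hk : k = 1
  · subst hk; simp
  · simp [hk, rotate_ballB]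

lemma S1_seg_ae (hn : 2 ≤ n) (u : En n) : ∀ᵐ v : Sph n ∂(S1 (seg u)), ⟪u, (v : En n)⟫_ℝ = 0 :=
  S_seg_ae _ (fin_one_ne_zero hn) u (by simp)

lemma S1_seg_mass (hn : 2 ≤ n) (u : Sph n) :
    (S1 (seg (u : En n))).real Set.univ = Es n (fun t => |t|) := by
  rw [S1_mass hn]
  simp only [supp_seg]
  exact integral_sig_inner (by fun_prop) u

end S1

/-- A rotation covariant family of bodies of revolution with common profile `g`. -/
structure IsZonalFamily (A : Sph n → ConvexBody (En n)) (g : ℝ → ℝ) : Prop where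
  cont : Continuous g
  even : ∀ t, g (-t) = g t
  supp_eq : ∀ u v : Sph n, supp (A v) u = g ⟪(u : En n), v⟫_ℝ

namespace IsZonalFamily

open Polynomial

variable {A : Sph n → ConvexBody (En n)} {g : ℝ → ℝ}

lemma rotate_eq (h : IsZonalFamily A g) (ρ : En n ≃ₗᵢ[ℝ] En n) (v : Sph n) :
    rotate ρ (A v) = A (sphMap ρ v) := by
  have key : ∀ u : Sph n, supp (rotate ρ (A v)) u = supp (A (sphMap ρ v)) u := fun u => by
    have h1 := h.supp_eq (sphMap ρ.symm u) v
    have h2 : ⟪ρ.symm (u : En n), (v : En n)⟫_ℝ = ⟪(u : En n), ρ v⟫_ℝ := by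
      rw [← ρ.inner_map_map, ρ.apply_symm_apply]
    rw [supp_rotate, h.supp_eq, coe_sphMap, ← h2]
    exact h1
  exact body_ext fun x => le_antisymm (supp_le_of_sphere (fun u => (key u).le) x)
    (supp_le_of_sphere (fun u => (key u).ge) x)

variable [NeZero n]

lemma integral_indep (h : IsZonalFamily A g) {F : ℝ → ℝ} (hF : Continuous F) (w : Sph n) :
    ∫ v : Sph n, F ⟪(w : En n), v⟫_ℝ ∂(S1 (A w)) =
      ∫ v : Sph n, F ⟪(e0 n : En n), v⟫_ℝ ∂(S1 (A (e0 n))) := by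
  obtain ⟨ρ, h1, h2⟩ := exists_sphMap (e0 n) w
  rw [← h1, ← h.rotate_eq, ← S1_comp ρ _ (continuous_comp_inner hF _)]
  simp only [coe_sphMap, ρ.inner_map_map]

lemma isAxial (h : IsZonalFamily A g) (w : Sph n) : IsAxial w (S1 (A w)) := fun ρ hρ => by
  have h1 : sphMap ρ w = w := Subtype.ext hρ
  have := Measure.isFiniteMeasure_map (S1 (A w)) (sphMap ρ)
  refine measure_ext_supp fun K => ?_
  rw [integral_map (continuous_sphMap ρ).aemeasurable (continuous_supp_sph K).aestronglyMeasurable,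
    S1_comp ρ _ (continuous_supp_sph K), h.rotate_eq, h1]

/-- Multipliers of the first order area measure of a zonal family. -/
def mult (A : Sph n → ConvexBody (En n)) (k : ℕ) : ℝ :=
  ∫ v : Sph n, (legP n k).eval ⟪(e0 n : En n), v⟫_ℝ ∂(S1 (A (e0 n)))

lemma integral_legP (hn : 3 ≤ n) (h : IsZonalFamily A g) (k : ℕ) (w e : Sph n) :
    ∫ v : Sph n, (legP n k).eval ⟪(e : En n), v⟫_ℝ ∂(S1 (A w)) =
      (legP n k).eval ⟪(e : En n), w⟫_ℝ * mult A k := by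
  have h1 := (h.isAxial w).funk_hecke hn (F := fun _ => 1) continuous_const k e
  simp only [one_mul] at h1
  rw [h1, h.integral_indep (F := fun t => (legP n k).eval t) (by fun_prop)]
  rfl

lemma mult_mul (hn : 3 ≤ n) (h : IsZonalFamily A g) (k : ℕ) :
    mult A k * Es n (fun t => |t| * (legP n k).eval t) =
      Es n (fun t => g t * (legP n k).eval t) * (legP n k).eval 0 * Es n (fun t => |t|) := by
  have hg := h.cont
  set u := e0 n
  have hsw : ∀ w : Sph n, ∫ v : Sph n, |⟪(w : En n), v⟫_ℝ| ∂(S1 (A u)) =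
      ∫ v : Sph n, g ⟪(w : En n), v⟫_ℝ ∂(S1 (seg (u : En n))) := fun w => by
    obtain ⟨ρ, h1, h2⟩ := exists_sphMap u w
    have h3 : ∫ v : Sph n, |⟪(w : En n), v⟫_ℝ| ∂(S1 (A u)) =
        ∫ v : Sph n, |⟪(u : En n), v⟫_ℝ| ∂(S1 (A w)) := by
      have h4 : A u = rotate ρ (A w) := by rw [h.rotate_eq, h2]
      rw [h4, ← S1_comp ρ _ (by fun_prop)]
      refine integral_congr_ae (Eventually.of_forall fun v => ?_)
      simp only [coe_sphMap]
      rw [← h1, coe_sphMap, ρ.inner_map_map]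
    have h5 := S1_symm (by omega : 2 ≤ n) (A w) (seg (u : En n))
    simp only [supp_seg] at h5
    rw [h3, h5]
    refine integral_congr_ae (Eventually.of_forall fun v => ?_)
    simp only [h.supp_eq, real_inner_comm]
  have e1 : ∫ w : Sph n, (∫ v : Sph n, |⟪(w : En n), v⟫_ℝ| ∂(S1 (A u))) * (legP n k).eval ⟪(u : En n), w⟫_ℝ
      ∂(sig n) = mult A k * Es n (fun t => |t| * (legP n k).eval t) := by
    simp_rw [← integral_mul_const]
    rw [fubini_sph (by fun_prop)]
    have h1 : ∀ v : Sph n, ∫ w : Sph n, |⟪(w : En n), v⟫_ℝ| * (legP n k).eval ⟪(u : En n), w⟫_ℝ ∂(sig n) =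
        (legP n k).eval ⟪(u : En n), v⟫_ℝ * Es n (fun t => |t| * (legP n k).eval t) := fun v => by
      rw [← funk_hecke_sig hn (F := fun t => |t|) (by fun_prop)]
      simp_rw [real_inner_comm v.1]
    simp_rw [h1]
    rw [integral_mul_const]
    rfl
  have e2 : ∫ w : Sph n, (∫ v : Sph n, g ⟪(w : En n), v⟫_ℝ ∂(S1 (seg (u : En n)))) *
      (legP n k).eval ⟪(u : En n), w⟫_ℝ ∂(sig n) =
      Es n (fun t => g t * (legP n k).eval t) * (legP n k).eval 0 * Es n (fun t => |t|) := by
    simp_rw [← integral_mul_const]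
    rw [fubini_sph (by fun_prop)]
    have h1 : ∀ v : Sph n, ∫ w : Sph n, g ⟪(w : En n), v⟫_ℝ * (legP n k).eval ⟪(u : En n), w⟫_ℝ ∂(sig n) =
        (legP n k).eval ⟪(u : En n), v⟫_ℝ * Es n (fun t => g t * (legP n k).eval t) := fun v => by
      rw [← funk_hecke_sig hn hg]
      simp_rw [real_inner_comm v.1]
    simp_rw [h1]
    have h2 : ∫ v : Sph n, (legP n k).eval ⟪(u : En n), v⟫_ℝ * Es n (fun t => g t * (legP n k).eval t)
        ∂(S1 (seg (u : En n))) = ∫ v : Sph n, (legP n k).eval 0 *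
          Es n (fun t => g t * (legP n k).eval t) ∂(S1 (seg (u : En n))) := by
      refine integral_congr_ae ?_
      filter_upwards [S1_seg_ae (by omega : 2 ≤ n) (u : En n)] with v hv
      rw [hv]
    rw [h2, integral_const, S1_seg_mass (by omega), smul_eq_mul]
    ring
  rw [← e1, ← e2]
  simp_rw [hsw]

lemma Es_abs_pos : 0 < Es n (fun t => |t|) := by
  have hc : Continuous fun v : Sph n => |⟪(e0 n : En n), v⟫_ℝ| := by fun_prop
  refine hc.integral_pos_of_hasCompactSupport_nonneg_nonzero (HasCompactSupport.of_compactSpace _)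
    (fun v => abs_nonneg _) (x := e0 n) ?_
  rw [inner_sph_self]; simp

/-- The multipliers of `S₁` in terms of those of the profile. -/
lemma mult_eq (hn : 3 ≤ n) (h : IsZonalFamily A g) (l : ℕ) :
    (n - 1) * mult A (2 * l) =
      -((2 * l - 1) * (2 * l + n - 1)) * Es n (fun t => g t * (legP n (2 * l)).eval t) := by
  have h1 := h.mult_mul hn (2 * l)
  have h2 := Es_abs_legP (n := n) (by omega) l
  have h3 := Es_abs_pos (n := n)
  have h4 := legP_eval_zero_ne (n := n) (by omega) l
  apply mul_right_cancel₀ (mul_ne_zero h3.ne' h4)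
  linear_combination (-(2 * l * (2 * l + n - 2) - (n - 1)) : ℝ) * h1 + mult A (2 * l) * h2

lemma mult_zero (hn : 3 ≤ n) (h : IsZonalFamily A g) : mult A 0 = Es n g := by
  have h1 := h.mult_eq hn 0
  simp only [mul_zero, legP_zero, eval_one, mul_one, Nat.cast_zero] at h1
  have hn3 : (3 : ℝ) ≤ n := by exact_mod_cast hn
  apply mul_left_cancel₀ (show (n - 1 : ℝ) ≠ 0 by linarith)
  rw [h1]
  change _ * Es n g = _ * Es n g
  ring

/-- The energy `V(A, A, B, …, B)`. -/
def energy (A : Sph n → ConvexBody (En n)) : ℝ :=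
  ∫ v : Sph n, supp (A (e0 n)) v ∂(S1 (A (e0 n)))

lemma energy_le (hn : 3 ≤ n) (h : IsZonalFamily A g) {l : ℕ} (hl : 1 ≤ l) :
    energy A ≤ Es n g ^ 2 + mult A (2 * l) * Es n (fun t => g t * (legP n (2 * l)).eval t) /
      legE n (2 * l) := by
  have hg := h.cont
  have hn3 : (3 : ℝ) ≤ n := by exact_mod_cast hn
  set a : ℕ → ℝ := fun l => Es n (fun t => g t * (legP n (2 * l)).eval t) with ha
  set u := e0 n
  have hev : ∀ v : Sph n, g ⟪(u : En n), (-v : Sph n)⟫_ℝ = g ⟪(u : En n), v⟫_ℝ := fun v => by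
    rw [coe_neg_sphere, inner_neg_right, h.even]
  have hE : energy A = ∫ v : Sph n, g ⟪(u : En n), v⟫_ℝ ∂(S1 (A u)) := by
    refine integral_congr_ae (Eventually.of_forall fun v => ?_)
    simp only [h.supp_eq, real_inner_comm]
    rfl
  have hneg : ∀ l, 1 ≤ l → mult A (2 * l) * a l ≤ 0 := fun l hl => by
    have h1 := h.mult_eq hn l
    have hl' : (1 : ℝ) ≤ l := by exact_mod_cast hl
    have h2 : (n - 1 : ℝ) * (mult A (2 * l) * a l) = -((2 * l - 1) * (2 * l + n - 1)) * a l ^ 2 := by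
      rw [← mul_assoc, h1]; ring
    have h3 : (0 : ℝ) ≤ (2 * l - 1) * (2 * l + n - 1) := mul_nonneg (by linarith) (by linarith)
    by_contra! h4
    have h5 : 0 < (n - 1 : ℝ) * (mult A (2 * l) * a l) := mul_pos (by linarith) h4
    nlinarith [mul_nonneg h3 (sq_nonneg (a l))]
  have ha0 : a 0 = Es n g := by
    simp only [ha, mul_zero, legP_zero, eval_one, mul_one]
  have key : ∀ m, ∫ v, smooth m (fun v : Sph n => g ⟪(u : En n), v⟫_ℝ) v ∂(S1 (A u)) ≤
      Es n g ^ 2 + pwc n m l / legE n (2 * l) * (mult A (2 * l) * a l) := fun m => by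
    obtain ⟨hpos, s, hs, hexp⟩ := pw_expand hn m
    simp_rw [smooth_expand m hexp (f := fun v : Sph n => g ⟪(u : En n), v⟫_ℝ) (by fun_prop)]
    have h1 : ∀ (l : ℕ) (v : Sph n), ∫ w : Sph n, (legP n (2 * l)).eval ⟪(v : En n), w⟫_ℝ *
        g ⟪(u : En n), w⟫_ℝ ∂(sig n) = (legP n (2 * l)).eval ⟪(u : En n), v⟫_ℝ * a l := fun l v => by
      rw [real_inner_comm (v : En n) (u : En n), ← funk_hecke_sig hn hg]
      simp_rw [mul_comm ((legP n (2 * l)).eval _)]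
    simp_rw [h1]
    rw [integral_finsetSum _ fun l _ => integrable_of_continuous (by fun_prop) _]
    simp_rw [integral_const_mul, integral_mul_const]
    have h2 : ∀ l, ∫ v : Sph n, (legP n (2 * l)).eval ⟪(u : En n), v⟫_ℝ ∂(S1 (A u)) = mult A (2 * l) :=
      fun l => rfl
    simp_rw [h2]
    set x : ℕ → ℝ := fun l => pwc n m l / legE n (2 * l) * (mult A (2 * l) * a l) with hx
    have h3 : ∑ l ∈ s, x l = ∑ l ∈ s ∪ {0, l}, x l :=
      Finset.sum_subset Finset.subset_union_left fun j _ hj => by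
        simp only [hx, hs j hj, zero_div, zero_mul]
    rw [h3]
    have h4 : ∑ l ∈ s ∪ {0, l}, x l ≤ ∑ l ∈ ({0, l} : Finset ℕ), x l := by
      rw [← Finset.sum_sdiff (Finset.subset_union_right (s₁ := s) (s₂ := {0, l}))]
      refine add_le_of_nonpos_left (Finset.sum_nonpos fun j hj => ?_)
      have hj0 : 1 ≤ j := by
        simp only [Finset.mem_sdiff, Finset.mem_insert, not_or] at hj
        omega
      exact mul_nonpos_of_nonneg_of_nonpos (div_nonneg (hpos j) (legE_pos hn _).le) (hneg j hj0)
    refine h4.trans_eq ?_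
    rw [Finset.sum_pair (by omega)]
    simp only [hx, mul_zero, pwc_zero, legE_zero, h.mult_zero hn, ha0]
    ring
  rw [hE]
  have t1 := tendsto_integral_smooth (f := fun v : Sph n => g ⟪(u : En n), v⟫_ℝ) (by fun_prop) hev
    (S1 (A u))
  have t2 := (((tendsto_pwc (n := n) (by omega) l).div_const (legE n (2 * l))).mul_const
    (mult A (2 * l) * a l)).const_add (Es n g ^ 2)
  refine (le_of_tendsto_of_tendsto' t1 t2 key).trans_eq ?_
  ring

end IsZonalFamily

end

section

section moments

open Polynomial

variable [NeZero n]

lemma Es_pow_four : (n + 2) * Es n (fun t => t ^ 4) = 3 * Es n (fun t => t ^ 2) := by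
  have h := Es_poly_parts (n := n) (X ^ 3)
  have h1 : Es n (fun t => ((1 - X ^ 2) * derivative (X ^ 3 : ℝ[X])).eval t) =
      3 * Es n (fun t => t ^ 2) - 3 * Es n (fun t => t ^ 4) := by
    rw [← Es_const_mul, ← Es_const_mul, ← Es_sub (by fun_prop) (by fun_prop)]
    congr 1; ext t; simp; ring
  have h2 : Es n (fun t => (X * X ^ 3 : ℝ[X]).eval t) = Es n (fun t => t ^ 4) := by
    congr 1; ext t; simp; ring
  rw [h1, h2] at h
  linear_combination -h

lemma Es_abs_cube : (n + 1) * Es n (fun t => |t| * t ^ 2) = 2 * Es n (fun t => |t|) := by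
  have h := Es_abs_parts (n := n) 1
  have h1 : Es n (fun t => |t| * ((1 - X ^ 2) * (2 * 1 + X * derivative (1 : ℝ[X]))).eval t) =
      2 * Es n (fun t => |t|) - 2 * Es n (fun t => |t| * t ^ 2) := by
    rw [← Es_const_mul, ← Es_const_mul, ← Es_sub (by fun_prop) (by fun_prop)]
    congr 1; ext t; simp; ring
  have h2 : Es n (fun t => |t| * (X ^ 2 * 1 : ℝ[X]).eval t) = Es n (fun t => |t| * t ^ 2) := by
    congr 1; ext t; simp
  rw [h1, h2] at h
  linear_combination -h

omit [NeZero n] in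
lemma legP_two (hn : 2 ≤ n) (t : ℝ) : ((n : ℝ) - 1) * (legP n 2).eval t = n * t ^ 2 - 1 := by
  have h := congrArg (eval t) (legP_rec (n := n) hn 0)
  simp only [eval_mul, eval_sub, eval_C, eval_X, legP_zero, zero_add, legP_one, eval_one,
    Nat.cast_zero] at h
  linear_combination h

lemma legP_six_four (t : ℝ) : 35 * (legP 6 4).eval t = 80 * t ^ 4 - 48 * t ^ 2 + 3 := by
  have h2 := legP_two (n := 6) (by omega) t
  have h3 := congrArg (eval t) (legP_rec (n := 6) (by omega) 1)
  have h4 := congrArg (eval t) (legP_rec (n := 6) (by omega) 2)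
  simp only [eval_mul, eval_sub, eval_C, eval_X, legP_one] at h2 h3 h4
  push_cast at h2 h3 h4
  norm_num at h2 h3 h4
  linear_combination 5 * h4 + (10 * t * (5 / 6)) * h3 + (10 * t * (5 / 6) * 8 / 5 * t - 3) * h2

lemma legE_two (hn : 3 ≤ n) : ((n : ℝ) - 1) * (n + 2) * legE n 2 = 2 := by
  have h := legE_succ hn 0
  have h1 := legE_one (n := n)
  simp only [Nat.cast_zero, zero_add] at h
  linear_combination h + 2 * h1

lemma legE_three (hn : 3 ≤ n) : (n : ℝ) * (n - 1) * (n + 4) * legE n 3 = 6 := by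
  have h := legE_succ hn 1
  have h1 := legE_two hn
  simp only [Nat.cast_one] at h
  linear_combination (n - 1 : ℝ) * h + 3 * h1

lemma legE_four (hn : 3 ≤ n) : (n : ℝ) * (n - 1) * (n + 1) * (n + 6) * legE n 4 = 24 := by
  have h := legE_succ hn 2
  have h1 := legE_three hn
  push_cast at h
  linear_combination (n * (n - 1) : ℝ) * h + 4 * h1

lemma legE_bound_succ (hn : 6 ≤ n) {k : ℕ} (hk : 4 ≤ k)
    (h : ((n : ℝ) - 1) * (k - 1) * (k + n - 1) * legE n k ≤ 1) :
    ((n : ℝ) - 1) * ((k + 1 : ℕ) - 1) * ((k + 1 : ℕ) + n - 1) * legE n (k + 1) ≤ 1 := by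
  obtain ⟨j, rfl⟩ := Nat.exists_eq_add_of_le' hk
  have h1 := legE_succ (n := n) (by omega) (j + 3)
  have hp := legE_pos (n := n) (by omega) (j + 4 + 1)
  have hp0 := legE_pos (n := n) (by omega) (j + 4)
  obtain ⟨b, hb⟩ := Nat.exists_eq_add_of_le' hn
  have hbr : (n : ℝ) = b + 6 := by exact_mod_cast hb
  change _ * _ * legE n (j + 4 + 1) = _ * _ * legE n (j + 4) at h1
  have hb0 : (0 : ℝ) ≤ b := b.cast_nonneg
  have hj0 : (0 : ℝ) ≤ j := j.cast_nonneg
  push_cast at h h1 ⊢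
  rw [hbr] at h h1 ⊢
  set x := (b : ℝ)
  set y := (j : ℝ)
  set e := legE n (j + 4)
  set e' := legE n (j + 4 + 1)
  set A := (y + 3 + (x + 6) - 1) * (2 * (y + 3) + (x + 6) + 2) with hA
  set B := (2 * (y + 3) + (x + 6)) * (y + 3 + 2) with hB
  have hA0 : 0 < A := mul_pos (by linarith) (by linarith)
  have hc : (x + 6 - 1) * (y + 4 + 1 - 1) * (y + 4 + 1 + (x + 6) - 1) * B ≤
      (x + 6 - 1) * (y + 4 - 1) * (y + 4 + (x + 6) - 1) * A := by
    rw [← sub_nonneg, hA, hB]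
    ring_nf
    positivity
  have h2 := mul_le_mul_of_nonneg_right hc hp0.le
  refine le_of_mul_le_mul_left ?_ hA0
  calc A * ((x + 6 - 1) * (y + 4 + 1 - 1) * (y + 4 + 1 + (x + 6) - 1) * e')
      = (x + 6 - 1) * (y + 4 + 1 - 1) * (y + 4 + 1 + (x + 6) - 1) * B * e := by
        linear_combination (x + 6 - 1) * (y + 4 + 1 - 1) * (y + 4 + 1 + (x + 6) - 1) * h1
    _ ≤ A * ((x + 6 - 1) * (y + 4 - 1) * (y + 4 + (x + 6) - 1) * e) := by linarith
    _ ≤ A * 1 := mul_le_mul_of_nonneg_left h hA0.le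

lemma legE_bound_of_seven_le (hn : 7 ≤ n) {k : ℕ} (hk : 4 ≤ k) :
    ((n : ℝ) - 1) * (k - 1) * (k + n - 1) * legE n k ≤ 1 := by
  induction k, hk using Nat.le_induction with
  | base =>
    have h := legE_four (n := n) (by omega)
    have hp := legE_pos (n := n) (by omega) 4
    have hn7 : (7 : ℝ) ≤ n := by exact_mod_cast hn
    have h1 : (72 : ℝ) * (n + 3) ≤ n * (n + 1) * (n + 6) := by nlinarith [mul_nonneg (sub_nonneg.2 hn7) (sub_nonneg.2 hn7)]
    have h2 := mul_le_mul_of_nonneg_right h1 (mul_nonneg (show (0 : ℝ) ≤ n - 1 by linarith) hp.le)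
    push_cast
    linarith
  | succ k hk ih => exact legE_bound_succ (by omega) hk ih

lemma legE_bound_six {k : ℕ} (hk : 6 ≤ k) :
    ((6 : ℕ) - 1 : ℝ) * (k - 1) * (k + (6 : ℕ) - 1) * legE 6 k ≤ 1 := by
  induction k, hk using Nat.le_induction with
  | base =>
    have h4 := legE_four (n := 6) (by omega)
    have h5 := legE_succ (n := 6) (by omega) 3
    have h6 := legE_succ (n := 6) (by omega) 4
    norm_num at h4 h5 h6 ⊢
    linarith
  | succ k hk ih => exact legE_bound_succ le_rfl (by omega) ih

end moments

end

section

namespace IsZonalFamily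

open Polynomial

variable {A : Sph n → ConvexBody (En n)} {g : ℝ → ℝ}

lemma profile_abs (h : IsZonalFamily A g) (t : ℝ) : g |t| = g t := by
  rcases abs_choice t with h1 | h1 <;> rw [h1]
  exact h.even t

lemma supp_neg (h : IsZonalFamily A g) (v : Sph n) (x : En n) : supp (A v) (-x) = supp (A v) x := by
  have key : ∀ x : En n, supp (A v) (-x) ≤ supp (A v) x := fun x => by
    have h1 : ∀ u : Sph n, supp (rotate (LinearIsometryEquiv.neg ℝ) (A v)) u ≤ supp (A v) u := fun u => by
      rw [supp_rotate]
      have h2 := h.supp_eq (-u) v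
      rw [coe_neg_sphere, inner_neg_left, h.even] at h2
      rw [h.supp_eq, ← h2]
      rfl
    have h3 := supp_le_of_sphere h1 x
    rw [supp_rotate] at h3
    exact h3
  refine le_antisymm (key x) ?_
  simpa using key (-x)

lemma profile_bounds_of_nonneg (hn : 2 ≤ n) (h : IsZonalFamily A g) (v : Sph n) {t : ℝ} (ht0 : 0 ≤ t) (ht : t ≤ 1) :
    √(1 - t ^ 2) * g 0 ≤ g t ∧ t * g 1 ≤ g t ∧ g t ≤ √(1 - t ^ 2) * g 0 + t * g 1 := by
  obtain ⟨x, hx, hvx⟩ := exists_orthogonal hn (v : En n)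
  set s := √(1 - t ^ 2) with hs
  have hs0 : 0 ≤ s := Real.sqrt_nonneg _
  have hs2 : s ^ 2 = 1 - t ^ 2 := Real.sq_sqrt (by nlinarith)
  have comb : ∀ a b : ℝ, a ^ 2 + b ^ 2 = 1 → supp (A v) (a • (v : En n) + b • x) = g a := fun a b hab => by
    have h1 : ‖a • (v : En n) + b • x‖ = 1 := by
      have : ‖a • (v : En n) + b • x‖ ^ 2 = 1 := by
        rw [norm_add_sq_real, norm_smul, norm_smul, hx, norm_eq_of_mem_sphere, real_inner_smul_left,
          real_inner_smul_right, hvx, Real.norm_eq_abs, Real.norm_eq_abs, mul_one, mul_one, sq_abs, sq_abs]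
        linarith
      rwa [pow_eq_one_iff_of_nonneg (norm_nonneg _) two_ne_zero] at this
    have h2 := h.supp_eq ⟨a • (v : En n) + b • x, by simp [h1]⟩ v
    rw [h2, inner_add_left, real_inner_smul_left, real_inner_smul_left, inner_sph_self,
      real_inner_comm, hvx, mul_one, mul_zero, add_zero]
  have g0 : supp (A v) x = g 0 := by simpa using comb 0 1 (by norm_num)
  have g1 : supp (A v) v = g 1 := by simpa using comb 1 0 (by norm_num)
  have e1 := comb t s (by linarith)
  have e2 := comb (-t) s (by rw [neg_sq]; linarith)
  rw [h.even] at e2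
  refine ⟨?_, ?_, ?_⟩
  · have h3 := supp_add_le (A v) (t • (v : En n) + s • x) ((-t) • (v : En n) + s • x)
    have h4 : t • (v : En n) + s • x + ((-t) • (v : En n) + s • x) = (2 * s) • x := by module
    rw [h4, supp_smul _ (by linarith), e1, e2, g0] at h3
    linarith
  · have h3 := supp_add_le (A v) (t • (v : En n) + s • x) (-((-t) • (v : En n) + s • x))
    have h4 : t • (v : En n) + s • x + -((-t) • (v : En n) + s • x) = (2 * t) • (v : En n) := by module
    rw [h4, supp_smul _ (by linarith), h.supp_neg, e1, e2, g1] at h3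
    linarith
  · have h3 := supp_add_le (A v) (t • (v : En n)) (s • x)
    rw [e1, supp_smul _ ht0, supp_smul _ hs0, g0, g1] at h3
    linarith

variable [NeZero n]

lemma profile_bounds (hn : 2 ≤ n) (h : IsZonalFamily A g) {t : ℝ} (ht : |t| ≤ 1) :
    √(1 - t ^ 2) * g 0 ≤ g t ∧ |t| * g 1 ≤ g t ∧ g t ≤ √(1 - t ^ 2) * g 0 + |t| * g 1 := by
  have := h.profile_bounds_of_nonneg hn (e0 n) (abs_nonneg t) ht
  rwa [sq_abs, h.profile_abs] at this

omit [NeZero n] in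
lemma profile_nonneg (h : IsZonalFamily A g) (v u : Sph n) : 0 ≤ g ⟪(u : En n), v⟫_ℝ := by
  have h1 := supp_add_le (A v) u (-u)
  rw [add_neg_cancel, supp_zero_right, h.supp_neg, h.supp_eq] at h1
  linarith

lemma profile_zero_nonneg (hn : 2 ≤ n) (h : IsZonalFamily A g) : 0 ≤ g 0 := by
  obtain ⟨x, hx, hvx⟩ := exists_orthogonal hn (e0 n : En n)
  have h1 := h.profile_nonneg (e0 n) ⟨x, by simp [hx]⟩
  rwa [real_inner_comm, hvx] at h1

lemma profile_one_nonneg (h : IsZonalFamily A g) : 0 ≤ g 1 := by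
  simpa [inner_sph_self] using h.profile_nonneg (e0 n) (e0 n)

lemma mean_nonneg (h : IsZonalFamily A g) : 0 ≤ Es n g :=
  integral_nonneg fun v => by
    rw [real_inner_comm]
    exact h.profile_nonneg (e0 n) v

lemma S1_mass_eq (hn : 3 ≤ n) (h : IsZonalFamily A g) : (S1 (A (e0 n))).real Set.univ = Es n g := by
  rw [← h.mult_zero hn, mult]
  simp [legP_zero]

lemma mult_eq_two (hn : 3 ≤ n) (h : IsZonalFamily A g) :
    ((n : ℝ) - 1) ^ 2 * mult A 2 = -(n + 1) * (n * Es n (fun t => g t * t ^ 2) - Es n g) := by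
  have hg := h.cont
  have h1 := h.mult_eq hn 1
  have h2 : ((n : ℝ) - 1) * Es n (fun t => g t * (legP n 2).eval t) =
      n * Es n (fun t => g t * t ^ 2) - Es n g := by
    rw [← Es_const_mul, ← Es_const_mul, ← Es_sub (by fun_prop) hg]
    congr 1; ext t
    linear_combination g t * legP_two (n := n) (by omega) t
  norm_num at h1
  linear_combination (n - 1 : ℝ) * h1 - (n + 1 : ℝ) * h2

lemma mean_le (hn : 2 ≤ n) (h : IsZonalFamily A g) :
    Es n g ≤ Es n (fun t => √(1 - t ^ 2)) * g 0 + Es n (fun t => |t|) * g 1 := by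
  have hg := h.cont
  rw [mul_comm, mul_comm _ (g 1), ← Es_const_mul, ← Es_const_mul, ← Es_add (by fun_prop) (by fun_prop)]
  refine Es_mono hg (by fun_prop) fun t ht => ?_
  have := (h.profile_bounds hn ht).2.2
  linarith

lemma second_moment_ge (hn : 2 ≤ n) (h : IsZonalFamily A g) :
    2 * (Es n (fun t => |t|) * g 1) ≤ (n + 1) * Es n (fun t => g t * t ^ 2) := by
  have hg := h.cont
  have h1 : g 1 * Es n (fun t => |t| * t ^ 2) ≤ Es n (fun t => g t * t ^ 2) := by
    rw [← Es_const_mul]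
    refine Es_mono (by fun_prop) (by fun_prop) fun t ht => ?_
    have := mul_le_mul_of_nonneg_right (h.profile_bounds hn ht).2.1 (sq_nonneg t)
    linarith
  have h2 := mul_le_mul_of_nonneg_left h1 (show (0 : ℝ) ≤ n + 1 by positivity)
  have h3 := Es_abs_cube (n := n)
  linear_combination h2 - g 1 * h3

lemma abs_mult_two_le (hn : 6 ≤ n) (h : IsZonalFamily A g) : ((n : ℝ) - 1) * |mult A 2| ≤ Es n g := by
  have hg := h.cont
  have hn6 : (6 : ℝ) ≤ n := by exact_mod_cast hn
  have hn1 : (0 : ℝ) < n - 1 := by linarith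
  rw [← abs_of_pos hn1, ← abs_mul, abs_le]
  constructor
  · have h1 : ∫ v : Sph n, (-1 : ℝ) ∂(S1 (A (e0 n))) ≤
        ∫ v : Sph n, ((n : ℝ) - 1) * (legP n 2).eval ⟪(e0 n : En n), v⟫_ℝ ∂(S1 (A (e0 n))) := by
      refine integral_mono (integrable_const _) (integrable_of_continuous (by fun_prop) _) fun v => ?_
      change -1 ≤ _
      rw [legP_two (by omega)]
      nlinarith [sq_nonneg ⟪(e0 n : En n), v⟫_ℝ]
    rw [integral_const, integral_const_mul, h.S1_mass_eq (by omega)] at h1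
    simpa [mult] using h1
  · have h1 := h.mult_eq_two (by omega)
    have h2 : 2 * Es n g ≤ n * (n + 1) * Es n (fun t => g t * t ^ 2) := by
      have h3 := h.mean_le (by omega)
      have hs : Es n (fun t => √(1 - t ^ 2)) ≤ 1 := by
        refine (Es_mono (G := fun _ => 1) (by fun_prop) (by fun_prop) fun t _ => ?_).trans_eq (Es_const 1)
        exact Real.sqrt_le_one.2 (by nlinarith [sq_nonneg t])
      have h4 := h.second_moment_ge (by omega)
      have h5 := mul_le_mul_of_nonneg_right hs (h.profile_zero_nonneg (by omega))
      have h6 : ((n : ℝ) - 1) * g 0 ≤ n * (n + 2) * Es n (fun t => g t * t ^ 2) := by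
        have h7 : g 0 * Es n (fun t => t ^ 2 - t ^ 4) ≤ Es n (fun t => g t * t ^ 2) := by
          rw [← Es_const_mul]
          refine Es_mono (by fun_prop) (by fun_prop) fun t ht => ?_
          have h8 : 1 - t ^ 2 ≤ √(1 - t ^ 2) := by
            have h9 : 0 ≤ 1 - t ^ 2 := by nlinarith [abs_nonneg t, sq_abs t]
            refine Real.le_sqrt_of_sq_le ?_
            nlinarith [sq_nonneg t]
          have h10 := mul_le_mul_of_nonneg_right ((mul_le_mul_of_nonneg_right h8
            (h.profile_zero_nonneg (by omega))).trans (h.profile_bounds (by omega) ht).1) (sq_nonneg t)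
          linarith
        rw [Es_sub (by fun_prop) (by fun_prop)] at h7
        have h8 := Es_pow_four (n := n)
        have h9 := Es_sq (n := n)
        have h10 := mul_le_mul_of_nonneg_left h7 (show (0 : ℝ) ≤ n * (n + 2) by positivity)
        linear_combination h10 + (n : ℝ) * g 0 * h8 - (n - 1 : ℝ) * g 0 * h9
      have hM : 0 ≤ Es n (fun t => g t * t ^ 2) := by
        have : 0 ≤ Es n (fun t => |t|) * g 1 := mul_nonneg Es_abs_pos.le h.profile_one_nonneg
        by_contra! h9
        nlinarith
      set M := Es n (fun t => g t * t ^ 2)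
      rcases le_total (Es n g) (2 * g 0) with h7 | h7
      · have h8 : ((n : ℝ) - 1) * Es n g ≤ 2 * (n * (n + 2) * M) := by nlinarith
        have h9 : (n - 1) * (2 * Es n g) ≤ (n - 1) * (n * (n + 1) * M) := by
          have : (0 : ℝ) ≤ n * ((n - 1) * (n + 1) - 4 * (n + 2)) := mul_nonneg (by linarith) (by nlinarith)
          nlinarith [mul_nonneg this hM]
        exact le_of_mul_le_mul_left h9 hn1
      · have h8 : Es n g ≤ (n + 1) * M := by linarith
        have h9 : 0 ≤ (n - 2) * ((n + 1) * M) := mul_nonneg (by linarith) (mul_nonneg (by linarith) hM)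
        nlinarith
    have h3 : ((n : ℝ) - 1) * ((n - 1) * mult A 2) ≤ (n - 1) * Es n g := by linarith
    exact le_of_mul_le_mul_left h3 hn1

lemma energy_nonneg (h : IsZonalFamily A g) : 0 ≤ energy A :=
  integral_nonneg fun v => by
    rw [h.supp_eq]
    exact h.profile_nonneg _ _

lemma abs_mult_le_of_legE (hn : 3 ≤ n) (h : IsZonalFamily A g) {l : ℕ} (hl : 1 ≤ l)
    (hE : ((n : ℝ) - 1) * ((2 * l : ℕ) - 1) * ((2 * l : ℕ) + n - 1) * legE n (2 * l) ≤ 1) :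
    ((n : ℝ) - 1) * |mult A (2 * l)| ≤ Es n g := by
  have hn3 : (3 : ℝ) ≤ n := by exact_mod_cast hn
  have hl1 : (1 : ℝ) ≤ l := by exact_mod_cast hl
  have hn1 : (0 : ℝ) < n - 1 := by linarith
  have h1 := h.energy_nonneg.trans (h.energy_le hn hl)
  have h2 := h.mult_eq hn l
  have hp := legE_pos hn (2 * l)
  push_cast at hE
  set α := mult A (2 * l)
  set a := Es n (fun t => g t * (legP n (2 * l)).eval t)
  set N := legE n (2 * l)
  set β : ℝ := (2 * l - 1) * (2 * l + n - 1) with hβ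
  have hβ0 : 0 < β := mul_pos (by linarith) (by linarith)
  have h3 : (n - 1) * α ^ 2 ≤ Es n g ^ 2 * (β * N) := by
    have h4 : α * a / N * (β * N) = - ((n - 1) * α ^ 2) := by
      field_simp
      linear_combination α * h2
    have h5 := mul_le_mul_of_nonneg_right h1 (mul_pos hβ0 hp).le
    rw [add_mul, h4] at h5
    linarith
  rw [← abs_of_pos hn1, ← abs_mul]
  refine abs_le_of_sq_le_sq ?_ h.mean_nonneg
  have h6 := mul_le_mul_of_nonneg_left hE (sq_nonneg (Es n g))
  have h7 := mul_le_mul_of_nonneg_left h3 hn1.le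
  rw [hβ] at h7
  linarith

end IsZonalFamily

end

section

namespace IsZonalFamily

open Polynomial

lemma energy_ge [NeZero n] {A : Sph n → ConvexBody (En n)} {g : ℝ → ℝ} (hn : 3 ≤ n) (h : IsZonalFamily A g) :
    g 0 * (Es n g - Es n (fun t => |t|) * g 0) ≤ energy A := by
  have hg := h.cont
  set u := e0 n
  have h1 : ∫ v : Sph n, |⟪(u : En n), v⟫_ℝ| ∂(S1 (A u)) = Es n (fun t => |t|) * g 0 := by
    have h2 := S1_symm (by omega : 2 ≤ n) (A u) (seg (u : En n))
    simp only [supp_seg] at h2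
    rw [h2, ← S1_seg_mass (by omega) u, ← smul_eq_mul, ← integral_const]
    refine integral_congr_ae ?_
    filter_upwards [S1_seg_ae (by omega : 2 ≤ n) (u : En n)] with v hv
    rw [h.supp_eq, real_inner_comm, hv]
  have h2 : ∫ v : Sph n, g 0 * (1 - |⟪(u : En n), v⟫_ℝ|) ∂(S1 (A u)) ≤ energy A := by
    refine integral_mono (integrable_of_continuous (by fun_prop) _)
      (integrable_of_continuous (continuous_supp_sph _) _) fun v => ?_
    change g 0 * (1 - |⟪(u : En n), v⟫_ℝ|) ≤ supp (A u) v
    rw [h.supp_eq, real_inner_comm (u : En n) (v : En n)]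
    set t := ⟪(u : En n), (v : En n)⟫_ℝ
    have ht : |t| ≤ 1 := abs_inner_sph_le u v
    refine le_trans ?_ (h.profile_bounds (by omega) ht).1
    rw [mul_comm]
    refine mul_le_mul_of_nonneg_right ?_ (h.profile_zero_nonneg (by omega))
    refine Real.le_sqrt_of_sq_le ?_
    nlinarith [abs_nonneg t, sq_abs t]
  rw [integral_const_mul, integral_sub (integrable_const _) (integrable_of_continuous (by fun_prop) _),
    h1, integral_const, h.S1_mass_eq hn, smul_eq_mul, mul_one] at h2
  exact h2

lemma abs_mult_four_le {A : Sph 6 → ConvexBody (En 6)} {g : ℝ → ℝ} (h : IsZonalFamily A g) :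
    5 * |mult A 4| ≤ Es 6 g := by
  have hg := h.cont
  have ha := h.mean_nonneg
  have hm := h.mult_zero (by omega)
  set a := Es 6 g
  set u := e0 6
  set μ := S1 (A u)
  have hmass : μ.real Set.univ = a := h.S1_mass_eq (by omega)
  -- second moment of the area measure
  set X := ∫ v : Sph 6, ⟪(u : En 6), v⟫_ℝ ^ 2 ∂μ with hX
  have h2 : 5 * mult A 2 = 6 * X - a := by
    rw [mult, ← integral_const_mul]
    have h3 : ∀ v : Sph 6, 5 * (legP 6 2).eval ⟪(u : En 6), v⟫_ℝ = 6 * ⟪(u : En 6), v⟫_ℝ ^ 2 - 1 := fun v => by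
      have := legP_two (n := 6) (by omega) ⟪(u : En 6), v⟫_ℝ
      push_cast at this
      linarith
    change ∫ v : Sph 6, 5 * (legP 6 2).eval ⟪(u : En 6), v⟫_ℝ ∂μ = _
    simp_rw [h3]
    rw [integral_sub (integrable_of_continuous (by fun_prop) _) (integrable_const _),
      integral_const_mul, integral_const, hmass]
    simp [hX]
  have h3 := h.mult_eq_two (by omega)
  push_cast at h3
  have hPu : 35 * mult A 4 ≤ 32 * X + 3 * a := by
    have h4 : ∫ v : Sph 6, 35 * (legP 6 4).eval ⟪(u : En 6), v⟫_ℝ ∂μ ≤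
        ∫ v : Sph 6, (32 * ⟪(u : En 6), v⟫_ℝ ^ 2 + 3) ∂μ := by
      refine integral_mono (integrable_of_continuous (by fun_prop) _)
        (integrable_of_continuous (by fun_prop) _) fun v => ?_
      have ht : |⟪(u : En 6), (v : En 6)⟫_ℝ| ≤ 1 := abs_inner_sph_le u v
      set t := ⟪(u : En 6), (v : En 6)⟫_ℝ
      change 35 * (legP 6 4).eval t ≤ 32 * t ^ 2 + 3
      rw [legP_six_four]
      have : t ^ 2 ≤ 1 := by rwa [sq_le_one_iff_abs_le_one]
      nlinarith [sq_nonneg t]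
    rw [integral_const_mul, integral_add (integrable_of_continuous (by fun_prop) _) (integrable_const _),
      integral_const_mul, integral_const, hmass, smul_eq_mul] at h4
    change 35 * mult A 4 ≤ 32 * X + _ at h4
    linarith
  have hPl : -a ≤ 5 * mult A 4 := by
    have h4 : ∫ v : Sph 6, (-1 : ℝ) ∂μ ≤ ∫ v : Sph 6, 5 * (legP 6 4).eval ⟪(u : En 6), v⟫_ℝ ∂μ := by
      refine integral_mono (integrable_const _) (integrable_of_continuous (by fun_prop) _) fun v => ?_
      set t := ⟪(u : En 6), (v : En 6)⟫_ℝ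
      change -1 ≤ 5 * (legP 6 4).eval t
      have := legP_six_four t
      nlinarith [sq_nonneg (t ^ 2 - 3 / 10)]
    rw [integral_const_mul, integral_const, hmass, smul_eq_mul] at h4
    change _ ≤ 5 * mult A 4 at h4
    linarith
  rw [← abs_of_pos (show (0 : ℝ) < 5 by norm_num), ← abs_mul, abs_le]
  refine ⟨hPl, ?_⟩
  rcases le_or_gt X (a / 8) with hXa | hXa
  · linarith
  set M := Es 6 (fun t => g t * t ^ 2)
  have hM : M ≤ 11 / 56 * a := by linarith
  have h4 := h.second_moment_ge (by omega)
  have h5 := h.mean_le (by omega)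
  set m := Es 6 (fun t => |t|)
  set s := Es 6 (fun t => √(1 - t ^ 2))
  push_cast at h4
  change 2 * (m * g 1) ≤ (6 + 1) * M at h4
  have hsq := Es_sq (n := 6)
  push_cast at hsq
  have hs : s ≤ 0.913 := by
    have h6 : 0 ≤ Es 6 (fun t => (0.913 ^ 2 + 1) - t ^ 2 - 2 * 0.913 * √(1 - t ^ 2)) := by
      rw [← Es_const (n := 6) 0]
      refine Es_mono (by fun_prop) (by fun_prop) fun t ht => ?_
      have h7 : t ^ 2 ≤ 1 := by rwa [sq_le_one_iff_abs_le_one]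
      have h8 := Real.sq_sqrt (show 0 ≤ 1 - t ^ 2 by linarith)
      nlinarith [sq_nonneg (√(1 - t ^ 2) - 0.913)]
    rw [Es_sub (by fun_prop) (by fun_prop), Es_sub (by fun_prop) (by fun_prop), Es_const, Es_const_mul] at h6
    change 0 ≤ _ - _ - _ * s at h6
    norm_num at h6 ⊢
    linarith
  have hmu : m ≤ 0.409 := by
    have h6 : 0 ≤ Es 6 (fun t => t ^ 2 + 0.409 ^ 2 - 2 * 0.409 * |t|) := by
      rw [← Es_const (n := 6) 0]
      refine Es_mono (by fun_prop) (by fun_prop) fun t ht => ?_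
      nlinarith [sq_nonneg (|t| - 0.409), sq_abs t]
    rw [Es_sub (by fun_prop) (by fun_prop), Es_add (by fun_prop) (by fun_prop), Es_const, Es_const_mul] at h6
    change 0 ≤ _ + _ - _ * m at h6
    norm_num at h6 ⊢
    linarith
  have hg0 := h.profile_zero_nonneg (by omega)
  have h6 : 0.342 * a ≤ g 0 := by
    have := mul_le_mul_of_nonneg_right hs hg0
    norm_num at this ⊢
    linarith
  have h7 : g 0 ≤ 1.2 * a := by
    have h8 : g 0 * Es 6 (fun t => 1 - t ^ 2) ≤ a := by
      rw [← Es_const_mul]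
      refine Es_mono (by fun_prop) hg fun t ht => ?_
      refine le_trans ?_ (h.profile_bounds (by omega) ht).1
      rw [mul_comm]
      refine mul_le_mul_of_nonneg_right ?_ hg0
      have h7 : t ^ 2 ≤ 1 := by rwa [sq_le_one_iff_abs_le_one]
      refine Real.le_sqrt_of_sq_le ?_
      nlinarith [sq_nonneg t]
    rw [Es_sub (by fun_prop) (by fun_prop), Es_const] at h8
    norm_num
    nlinarith
  have h8 := (h.energy_ge (by omega)).trans (h.energy_le (by omega) (l := 2) (by omega))
  have h9 := h.mult_eq (by omega) 2
  have h10 := legE_four (n := 6) (by omega)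
  norm_num at h9 h10
  have h11 : legE 6 4 = 1 / 105 := by linarith
  norm_num at h8
  change g 0 * (a - m * g 0) ≤ a ^ 2 + mult A 4 * Es 6 (fun t => g t * (legP 6 4).eval t) / legE 6 4 at h8
  set b := Es 6 (fun t => g t * (legP 6 4).eval t)
  have h12 : b = -(5 / 27) * mult A 4 := by linarith
  rw [h11, h12] at h8
  have h13 : 0.29 * a ^ 2 ≤ g 0 * (a - m * g 0) := by
    have h14 : m * g 0 ^ 2 ≤ 0.409 * g 0 ^ 2 := mul_le_mul_of_nonneg_right hmu (sq_nonneg _)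
    nlinarith [mul_nonneg (sub_nonneg.2 h6) (sub_nonneg.2 h7), mul_nonneg (sub_nonneg.2 h6) ha]
  refine le_of_sq_le_sq ?_ ha
  nlinarith

lemma abs_mult_le [NeZero n] {A : Sph n → ConvexBody (En n)} {g : ℝ → ℝ} (hn : 6 ≤ n)
    (h : IsZonalFamily A g) {l : ℕ} (hl : 1 ≤ l) : ((n : ℝ) - 1) * |mult A (2 * l)| ≤ Es n g := by
  rcases hl.eq_or_lt with rfl | hl2
  · exact h.abs_mult_two_le hn
  rcases hn.eq_or_lt with rfl | hn7
  · rcases (show 2 ≤ l from hl2).eq_or_lt with rfl | hl3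
    · have := h.abs_mult_four_le
      norm_num
      exact this
    · exact h.abs_mult_le_of_legE (by omega) hl (legE_bound_six (by omega))
  · exact h.abs_mult_le_of_legE (by omega) hl (legE_bound_of_seven_le hn7 (by omega))

end IsZonalFamily

end

section

lemma tendsto_integral_sq {F : ℕ → Sph n → ℝ} {f : Sph n → ℝ} (hF : ∀ m, Continuous (F m))
    (hu : TendstoUniformly F f atTop) (μ : Measure (Sph n)) [IsFiniteMeasure μ] :
    Tendsto (fun m => ∫ v, F m v ^ 2 ∂μ) atTop (𝓝 (∫ v, f v ^ 2 ∂μ)) := by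
  have hf : Continuous f := hu.continuous (Eventually.of_forall hF).frequently
  let G : ℕ → C(Sph n, ℝ) := fun m => ⟨F m, hF m⟩
  let G' : C(Sph n, ℝ) := ⟨f, hf⟩
  have h1 : Tendsto G atTop (𝓝 G') := ContinuousMap.tendsto_iff_tendstoUniformly.2 hu
  have h2 : Continuous fun f : C(Sph n, ℝ) => ∫ v, (f ^ 2) v ∂μ :=
    (continuous_integral_C μ).comp (continuous_pow 2)
  exact (h2.tendsto G').comp h1

section harmonic

open Polynomial

variable [NeZero n]

/-- The degree `k` component of `f`, up to normalisation. -/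
def comp (k : ℕ) (f : Sph n → ℝ) (u : Sph n) : ℝ :=
  ∫ v : Sph n, (legP n k).eval ⟪(u : En n), v⟫_ℝ * f v ∂(sig n)

lemma continuous_comp (k : ℕ) {f : Sph n → ℝ} (hf : Continuous f) : Continuous (comp k f) :=
  continuous_integral_sph (by fun_prop) _

lemma integral_comp_mul_comp (hn : 3 ≤ n) {j k : ℕ} (hjk : j ≠ k) {f : Sph n → ℝ} (hf : Continuous f) :
    ∫ u, comp j f u * comp k f u ∂(sig n) = 0 := by
  have hk := continuous_comp (n := n) k hf
  have h1 : ∀ v : Sph n, ∫ u : Sph n, (legP n j).eval ⟪(u : En n), v⟫_ℝ * comp k f u ∂(sig n) = 0 := fun v => by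
    simp only [comp, ← integral_const_mul]
    rw [fubini_sph (by fun_prop)]
    have h2 : ∀ w : Sph n, ∫ u : Sph n, (legP n j).eval ⟪(u : En n), v⟫_ℝ *
        ((legP n k).eval ⟪(u : En n), w⟫_ℝ * f w) ∂(sig n) = 0 := fun w => by
      simp_rw [← mul_assoc]
      rw [integral_mul_const]
      have h3 := legP_conv_of_ne hn hjk.symm v w
      simp_rw [real_inner_comm (_ : En n) (v : En n), real_inner_comm (_ : En n) (w : En n)] at h3
      rw [h3, zero_mul]
    simp_rw [h2, integral_zero]
  calc ∫ u, comp j f u * comp k f u ∂(sig n)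
      = ∫ u : Sph n, ∫ v : Sph n, (legP n j).eval ⟪(u : En n), v⟫_ℝ * f v * comp k f u ∂(sig n) ∂(sig n) := by
        refine integral_congr_ae (Eventually.of_forall fun u => ?_)
        simp only [integral_mul_const]
        rfl
    _ = ∫ v : Sph n, ∫ u : Sph n, (legP n j).eval ⟪(u : En n), v⟫_ℝ * f v * comp k f u ∂(sig n) ∂(sig n) :=
        fubini_sph (by fun_prop) _ _
    _ = ∫ v : Sph n, 0 ∂(sig n) := by
        refine integral_congr_ae (Eventually.of_forall fun v => ?_)
        simp only []
        simp_rw [mul_right_comm _ (f v)]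
        rw [integral_mul_const, h1 v, zero_mul]
    _ = 0 := integral_zero _ _

lemma integral_sq_sum_comp (hn : 3 ≤ n) (s : Finset ℕ) (c : ℕ → ℝ) {f : Sph n → ℝ} (hf : Continuous f) :
    ∫ u, (∑ l ∈ s, c l * comp (2 * l) f u) ^ 2 ∂(sig n) =
      ∑ l ∈ s, c l ^ 2 * ∫ u, comp (2 * l) f u ^ 2 ∂(sig n) := by
  have hc := fun k => continuous_comp (n := n) k hf
  simp_rw [sq, Finset.sum_mul_sum]
  rw [integral_finsetSum _ fun i _ => integrable_of_continuous (by fun_prop) _]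
  refine Finset.sum_congr rfl fun l hl => ?_
  rw [integral_finsetSum _ fun i _ => integrable_of_continuous (by fun_prop) _]
  rw [Finset.sum_eq_single l _ fun h => absurd hl h]
  · rw [← integral_const_mul]
    congr 1; ext u; ring
  · intro j _ hjl
    have h1 := integral_comp_mul_comp hn (show 2 * l ≠ 2 * j by omega) hf
    calc ∫ u, c l * comp (2 * l) f u * (c j * comp (2 * j) f u) ∂(sig n)
        = ∫ u, (c l * c j) * (comp (2 * l) f u * comp (2 * j) f u) ∂(sig n) := by
          congr 1; ext u; ring
      _ = 0 := by rw [integral_const_mul, h1, mul_zero]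

end harmonic

namespace IsZonalFamily

open Polynomial

variable [NeZero n] {A : Sph n → ConvexBody (En n)} {g : ℝ → ℝ}

lemma S1_mass_eq' (hn : 3 ≤ n) (h : IsZonalFamily A g) (w : Sph n) :
    (S1 (A w)).real Set.univ = Es n g := by
  rw [S1_mass (by omega)]
  simp only [h.supp_eq]
  exact integral_sig_inner' h.cont w

lemma integral_comp (hn : 3 ≤ n) (h : IsZonalFamily A g) (k : ℕ) {f : Sph n → ℝ} (hf : Continuous f)
    (w : Sph n) : ∫ u, comp k f u ∂(S1 (A w)) = mult A k * comp k f w := by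
  simp only [comp]
  rw [fubini_sph (by fun_prop), ← integral_const_mul]
  refine integral_congr_ae (Eventually.of_forall fun v => ?_)
  simp only []
  rw [integral_mul_const]
  simp_rw [real_inner_comm (v : En n)]
  rw [h.integral_legP hn]
  ring

/-- Sections of `S₁` of a zonal family act as a self-adjoint operator on functions. -/
def op (A : Sph n → ConvexBody (En n)) (f : Sph n → ℝ) (w : Sph n) : ℝ := ∫ u, f u ∂(S1 (A w))

lemma abs_op_sub_le (hn : 3 ≤ n) (h : IsZonalFamily A g) {f f' : Sph n → ℝ} (hf : Continuous f)
    (hf' : Continuous f') {ε : ℝ} (hε : ∀ u, |f u - f' u| ≤ ε) (w : Sph n) :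
    |op A f w - op A f' w| ≤ ε * Es n g := by
  rw [op, op, ← integral_sub (integrable_of_continuous hf _) (integrable_of_continuous hf' _),
    ← h.S1_mass_eq' hn w]
  exact norm_integral_le_of_norm_le_const
    (Eventually.of_forall fun u => (Real.norm_eq_abs _).trans_le (hε u))

lemma op_smooth_expand (hn : 3 ≤ n) (h : IsZonalFamily A g) (m : ℕ) {s : Finset ℕ} {d : ℕ → ℝ}
    (hd : ∀ t, pw n m t = ∑ l ∈ s, d l * (legP n (2 * l)).eval t) {f : Sph n → ℝ} (hf : Continuous f)
    (w : Sph n) : op A (smooth m f) w = ∑ l ∈ s, (d l * mult A (2 * l)) * comp (2 * l) f w := by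
  have hc := fun k => continuous_comp (n := n) k hf
  have h1 : smooth m f = fun u => ∑ l ∈ s, d l * comp (2 * l) f u := funext fun u => smooth_expand m hd hf u
  rw [op, h1, integral_finsetSum _ fun i _ => integrable_of_continuous (by fun_prop) _]
  refine Finset.sum_congr rfl fun l _ => ?_
  rw [integral_const_mul, h.integral_comp hn _ hf, mul_assoc]

lemma continuous_op_smooth (hn : 3 ≤ n) (h : IsZonalFamily A g) (m : ℕ) {f : Sph n → ℝ}
    (hf : Continuous f) : Continuous (op A (smooth m f)) := by
  have hc := fun k => continuous_comp (n := n) k hf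
  obtain ⟨-, s, -, hexp⟩ := pw_expand hn m
  rw [funext fun w => h.op_smooth_expand hn m hexp hf w]
  fun_prop

lemma tendstoUniformly_op (hn : 3 ≤ n) (h : IsZonalFamily A g) {f : Sph n → ℝ} (hf : Continuous f)
    (heven : ∀ v, f (-v) = f v) :
    TendstoUniformly (fun m => op A (smooth m f)) (op A f) atTop := by
  rw [Metric.tendstoUniformly_iff]
  intro ε hε
  have ha := h.mean_nonneg
  obtain ⟨M, hM⟩ := smooth_tendsto hf heven (ε := ε / (Es n g + 1)) (by positivity)
  filter_upwards [eventually_ge_atTop M] with m hm w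
  rw [dist_comm, Real.dist_eq]
  refine (h.abs_op_sub_le hn (continuous_smooth m hf) hf (hM m hm) w).trans_lt ?_
  rw [div_mul_eq_mul_div, div_lt_iff₀ (by positivity)]
  nlinarith

lemma continuous_op (hn : 3 ≤ n) (h : IsZonalFamily A g) {f : Sph n → ℝ} (hf : Continuous f)
    (heven : ∀ v, f (-v) = f v) : Continuous (op A f) :=
  (h.tendstoUniformly_op hn hf heven).continuous
    (Eventually.of_forall fun m => h.continuous_op_smooth hn m hf).frequently

lemma integral_op_sq_le (hn : 6 ≤ n) (h : IsZonalFamily A g) {f : Sph n → ℝ} (hf : Continuous f)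
    (heven : ∀ v, f (-v) = f v) (hmean : ∫ v, f v ∂(sig n) = 0) :
    ∫ w, op A f w ^ 2 ∂(sig n) ≤ (Es n g / (n - 1)) ^ 2 * ∫ w, f w ^ 2 ∂(sig n) := by
  have hn3 : 3 ≤ n := by omega
  have hn6 : (6 : ℝ) ≤ n := by exact_mod_cast hn
  have t1 := tendsto_integral_sq (fun m => h.continuous_op_smooth hn3 m hf)
    (h.tendstoUniformly_op hn3 hf heven) (sig n)
  have t2 : Tendsto (fun m => ∫ w, smooth m f w ^ 2 ∂(sig n)) atTop (𝓝 (∫ w, f w ^ 2 ∂(sig n))) := by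
    refine tendsto_integral_sq (fun m => continuous_smooth m hf) ?_ _
    rw [Metric.tendstoUniformly_iff]
    intro ε hε
    obtain ⟨M, hM⟩ := smooth_tendsto hf heven (half_pos hε)
    filter_upwards [eventually_ge_atTop M] with m hm w
    rw [dist_comm, Real.dist_eq]
    exact (hM m hm w).trans_lt (half_lt_self hε)
  refine le_of_tendsto_of_tendsto' t1 (t2.const_mul _) fun m => ?_
  obtain ⟨-, s, -, hexp⟩ := pw_expand hn3 m
  simp_rw [h.op_smooth_expand hn3 m hexp hf, smooth_expand m hexp hf]
  have e1 := integral_sq_sum_comp hn3 s (fun l => pwc n m l / legE n (2 * l) * mult A (2 * l)) hf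
  have e2 := integral_sq_sum_comp hn3 s (fun l => pwc n m l / legE n (2 * l)) hf
  simp only [comp] at e1 e2 ⊢
  rw [e1, e2, Finset.mul_sum]
  refine Finset.sum_le_sum fun l _ => ?_
  rcases Nat.eq_zero_or_pos l with rfl | hl
  · simp [legP_zero, hmean]
  · have h1 : |mult A (2 * l)| ≤ Es n g / (n - 1) := by
      rw [le_div_iff₀ (by linarith)]
      linarith [h.abs_mult_le hn hl]
    have h2 : mult A (2 * l) ^ 2 ≤ (Es n g / (n - 1)) ^ 2 := by
      rw [← sq_abs]
      exact pow_le_pow_left₀ (abs_nonneg _) h1 2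
    have h3 : 0 ≤ ∫ u, (comp (2 * l) f u) ^ 2 ∂(sig n) := integral_nonneg fun u => sq_nonneg _
    simp only [comp] at h3
    have h4 := mul_le_mul_of_nonneg_right h2 (mul_nonneg (sq_nonneg (pwc n m l / legE n (2 * l))) h3)
    rw [mul_pow]
    linarith

end IsZonalFamily

end

section

/-- The defect of additivity of the Euclidean norm. -/
def defect (p q : En n) : ℝ := ‖p‖ + ‖q‖ - ‖p + q‖

lemma defect_nonneg (p q : En n) : 0 ≤ defect p q := sub_nonneg.2 (norm_add_le p q)

/-- The defect of additivity of a support function. -/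
def suppDefect (K : ConvexBody (En n)) (p q : En n) : ℝ := supp K p + supp K q - supp K (p + q)

lemma suppDefect_nonneg (K : ConvexBody (En n)) (p q : En n) : 0 ≤ suppDefect K p q :=
  sub_nonneg.2 (supp_add_le K p q)

/-- `K` is within `x` of the unit ball, up to translations, in the order sense for second
derivatives of support functions. -/
def Near (K : ConvexBody (En n)) (x : ℝ) : Prop :=
  0 ≤ x ∧ ∀ p q, |suppDefect K p q - defect p q| ≤ x * defect p q

lemma Near.exists_bodies {K : ConvexBody (En n)} {x : ℝ} (h : Near K x) :
    ∃ C D : ConvexBody (En n), K + scale x (ballB n) = ballB n + C ∧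
      K + D = scale (1 + x) (ballB n) := by
  obtain ⟨hx, h⟩ := h
  obtain ⟨R, hR0, hR⟩ := exists_supp_le_norm K
  have hab := fun p q => abs_le.1 (h p q)
  simp only [suppDefect, defect] at hab
  refine ⟨ofSublinear (fun u => supp K u + (x - 1) * ‖u‖) (R + x) (fun p q => ?_) (fun c hc u => ?_)
    (fun u => ?_), ofSublinear (fun u => (1 + x) * ‖u‖ - supp K u) (1 + x + R) (fun p q => ?_)
    (fun c hc u => ?_) (fun u => ?_), body_ext fun u => ?_, body_ext fun u => ?_⟩
  · linarith [(hab p q).1]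
  · rw [supp_smul K hc.le, norm_smul, Real.norm_of_nonneg hc.le]; ring
  · nlinarith [(abs_le.1 (hR u)).2, norm_nonneg u]
  · linarith [(hab p q).2]
  · rw [supp_smul K hc.le, norm_smul, Real.norm_of_nonneg hc.le]; ring
  · nlinarith [(abs_le.1 (hR u)).1, norm_nonneg u]
  · rw [supp_add, supp_add, supp_ofSublinear, supp_scale _ hx, supp_ballB]; ring
  · rw [supp_add, supp_ofSublinear, supp_scale _ (by linarith), supp_ballB]; ring

lemma Near.abs_sub_le_of_even {K : ConvexBody (En n)} {x : ℝ} (h : Near K x)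
    (heven : ∀ u, supp K (-u) = supp K u) (u : En n) : |supp K u - ‖u‖| ≤ x * ‖u‖ := by
  have h1 := h.2 u (-u)
  simp only [suppDefect, defect, heven, add_neg_cancel, supp_zero_right, norm_neg, norm_zero] at h1
  have h2 : |2 * (supp K u - ‖u‖)| ≤ 2 * (x * ‖u‖) := by
    refine (congrArg _ ?_).trans_le (h1.trans_eq ?_) <;> ring
  rw [abs_mul, abs_two] at h2
  linarith

variable [NeZero n]

section two

variable (Ks : Fin n → ConvexBody (En n)) {j₁ j₂ : Fin n}

lemma S_swap (h₁ : j₁ ≠ 0) (h₂ : j₂ ≠ 0) (h₁₂ : j₁ ≠ j₂) (X Y : ConvexBody (En n)) :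
    S (Function.update (Function.update Ks j₁ X) j₂ Y) =
      S (Function.update (Function.update Ks j₁ Y) j₂ X) := by
  rw [← S_comp_perm _ (Equiv.swap j₁ j₂) (Equiv.swap_apply_of_ne_of_ne h₁.symm h₂.symm)]
  congr 1
  funext k
  by_cases hk : k = j₁
  · subst hk; simp [h₁₂]
  · by_cases hkj : k = j₂
    · subst hkj; simp [h₁₂]
    · simp [Equiv.swap_apply_of_ne_of_ne hk hkj, hk, hkj]

lemma integral_S_add {j : Fin n} (hj : j ≠ 0) (X Y : ConvexBody (En n)) {f : Sph n → ℝ}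
    (hf : Continuous f) : ∫ v, f v ∂(S (Function.update Ks j (X + Y))) =
      ∫ v, f v ∂(S (Function.update Ks j X)) + ∫ v, f v ∂(S (Function.update Ks j Y)) := by
  rw [S_update_add Ks hj, integral_add_measure (integrable_of_continuous hf _)
    (integrable_of_continuous hf _)]

lemma integral_S_scale {j : Fin n} (hj : j ≠ 0) (X : ConvexBody (En n)) {c : ℝ} (hc : 0 ≤ c)
    (f : Sph n → ℝ) : ∫ v, f v ∂(S (Function.update Ks j (scale c X))) =
      c * ∫ v, f v ∂(S (Function.update Ks j X)) := by
  rw [S_update_scale Ks hj _ hc, integral_smul_nnreal_measure, NNReal.smul_def,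
    Real.coe_toNNReal _ hc, smul_eq_mul]

lemma Near.first_diff {K : ConvexBody (En n)} {x : ℝ} (h : Near K x) {j : Fin n} (hj : j ≠ 0)
    {f : Sph n → ℝ} (hf : Continuous f) (hf0 : ∀ v, 0 ≤ f v) :
    |∫ v, f v ∂(S (Function.update Ks j K)) - ∫ v, f v ∂(S (Function.update Ks j (ballB n)))| ≤
      x * ∫ v, f v ∂(S (Function.update Ks j (ballB n))) := by
  obtain ⟨C, D, hC, hD⟩ := h.exists_bodies
  have hx := h.1
  have h1 := integral_S_add Ks hj K (scale x (ballB n)) hf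
  rw [hC, integral_S_add Ks hj _ _ hf, integral_S_scale Ks hj _ hx] at h1
  have h2 := integral_S_add Ks hj K D hf
  rw [hD, integral_S_scale Ks hj _ (by linarith)] at h2
  have h3 : 0 ≤ ∫ v, f v ∂(S (Function.update Ks j C)) := integral_nonneg hf0
  have h4 : 0 ≤ ∫ v, f v ∂(S (Function.update Ks j D)) := integral_nonneg hf0
  rw [abs_le]
  constructor <;> linarith

lemma Near.second_diff {K : ConvexBody (En n)} {x : ℝ} (h : Near K x) (h₁ : j₁ ≠ 0) (h₂ : j₂ ≠ 0)
    (h₁₂ : j₁ ≠ j₂) {f : Sph n → ℝ} (hf : Continuous f) (hf0 : ∀ v, 0 ≤ f v) :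
    |∫ v, f v ∂(S (Function.update (Function.update Ks j₁ K) j₂ K)) -
      2 * ∫ v, f v ∂(S (Function.update (Function.update Ks j₁ K) j₂ (ballB n))) +
      ∫ v, f v ∂(S (Function.update (Function.update Ks j₁ (ballB n)) j₂ (ballB n)))| ≤
      x ^ 2 * ∫ v, f v ∂(S (Function.update (Function.update Ks j₁ (ballB n)) j₂ (ballB n))) := by
  obtain ⟨C, D, hC, hD⟩ := h.exists_bodies
  have hx := h.1
  let s : ConvexBody (En n) → ConvexBody (En n) → ℝ := fun X Y =>
    ∫ v, f v ∂(S (Function.update (Function.update Ks j₁ X) j₂ Y))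
  have hs : ∀ X Y, s X Y = s Y X := fun X Y => by simp only [s]; rw [S_swap Ks h₁ h₂ h₁₂]
  have hadd : ∀ X Y Z, s X (Y + Z) = s X Y + s X Z := fun X Y Z => integral_S_add _ h₂ Y Z hf
  have hsc : ∀ X Y (c : ℝ), 0 ≤ c → s X (scale c Y) = c * s X Y := fun X Y c hc =>
    integral_S_scale _ h₂ Y hc f
  have hC' : ∀ X, s X C = s X K + (x - 1) * s X (ballB n) := fun X => by
    have h1 := hadd X K (scale x (ballB n))
    rw [hC, hadd, hsc _ _ _ hx] at h1
    linarith
  have hD' : ∀ X, s X D = (1 + x) * s X (ballB n) - s X K := fun X => by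
    have h1 := hadd X K D
    rw [hD, hsc _ _ _ (by linarith)] at h1
    linarith
  have hnn : ∀ X Y, 0 ≤ s X Y := fun X Y => integral_nonneg hf0
  have e1 : s C C = s K K + 2 * (x - 1) * s K (ballB n) + (x - 1) ^ 2 * s (ballB n) (ballB n) := by
    rw [hC', hs C, hs C, hC', hC', hs (ballB n) K]; ring
  have e2 : s D D = s K K - 2 * (1 + x) * s K (ballB n) + (1 + x) ^ 2 * s (ballB n) (ballB n) := by
    rw [hD', hs D, hs D, hD', hD', hs (ballB n) K]; ring
  have e3 : s D C = 2 * s K (ballB n) - s K K + (x ^ 2 - 1) * s (ballB n) (ballB n) := by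
    rw [hC', hs D, hs D, hD', hD', hs (ballB n) K]; ring
  have i1 := hnn C C
  have i2 := hnn D D
  have i3 := hnn D C
  change |s K K - 2 * s K (ballB n) + s (ballB n) (ballB n)| ≤ x ^ 2 * s (ballB n) (ballB n)
  rw [e1] at i1
  rw [e2] at i2
  rw [e3] at i3
  rw [abs_le]
  constructor <;> nlinarith

end two

omit [NeZero n] in
/-- Splitting a function into its positive and negative parts. -/
lemma abs_le_of_abs_le_nonneg {T U : (Sph n → ℝ) → ℝ}
    (hT : ∀ f g, Continuous f → Continuous g → T (fun v => f v - g v) = T f - T g)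
    (hU : ∀ f g, Continuous f → Continuous g → U (fun v => f v + g v) = U f + U g)
    (h : ∀ f, Continuous f → (∀ v, 0 ≤ f v) → |T f| ≤ U f) {f : Sph n → ℝ} (hf : Continuous f) :
    |T f| ≤ U fun v => |f v| := by
  have h1 := h (fun v => (|f v| + f v) / 2) (by fun_prop) fun v => by linarith [neg_abs_le (f v)]
  have h2 := h (fun v => (|f v| - f v) / 2) (by fun_prop) fun v => by linarith [le_abs_self (f v)]
  have h3 := hT (fun v => (|f v| + f v) / 2) (fun v => (|f v| - f v) / 2) (by fun_prop) (by fun_prop)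
  have h4 := hU (fun v => (|f v| + f v) / 2) (fun v => (|f v| - f v) / 2) (by fun_prop) (by fun_prop)
  have e1 : (fun v => (|f v| + f v) / 2 - (|f v| - f v) / 2) = f := by funext v; ring
  have e2 : (fun v => (|f v| + f v) / 2 + (|f v| - f v) / 2) = fun v => |f v| := by funext v; ring
  rw [e1] at h3
  rw [e2] at h4
  rw [h3, h4]
  exact (abs_sub _ _).trans (add_le_add h1 h2)

/-- The tuple `(K[a], B[n-1-a])`. -/
def tup (a : ℕ) (K : ConvexBody (En n)) (k : Fin n) : ConvexBody (En n) :=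
  if (k : ℕ) = 0 then ballB n else if (k : ℕ) ≤ a then K else ballB n

/-- The normalised area measure of order `a`. -/
def Sa (a : ℕ) (K : ConvexBody (En n)) : Measure (Sph n) := S (tup a K)

instance (a : ℕ) (K : ConvexBody (En n)) : IsFiniteMeasure (Sa a K) := by unfold Sa; infer_instance

omit [NeZero n] in
lemma tup_zero (K : ConvexBody (En n)) : tup 0 K = fun _ => ballB n := by
  funext k; simp only [tup]; split_ifs <;> first | rfl | omega

lemma Sa_zero (K : ConvexBody (En n)) : Sa 0 K = sig n := by rw [Sa, tup_zero, sig]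

omit [NeZero n] in
lemma update_tup (a : ℕ) (K : ConvexBody (En n)) (h : a + 1 < n) :
    Function.update (tup a K) ⟨a + 1, h⟩ (ballB n) = tup a K := by
  refine Function.update_eq_self_iff.2 ?_
  simp [tup]

omit [NeZero n] in
lemma tup_succ (a : ℕ) (K : ConvexBody (En n)) (h : a + 1 < n) :
    tup (a + 1) K = Function.update (tup a K) ⟨a + 1, h⟩ K := by
  funext k
  by_cases hk : k = ⟨a + 1, h⟩
  · subst hk; simp [tup]
  · have : (k : ℕ) ≠ a + 1 := fun h => hk (Fin.ext h)
    simp only [Function.update_of_ne hk, tup]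
    have : (k : ℕ) ≤ a + 1 ↔ (k : ℕ) ≤ a := by omega
    simp only [this]

lemma Sa_one (hn : 2 ≤ n) (K : ConvexBody (En n)) : Sa 1 K = S1 K := by
  have : (⟨0 + 1, hn⟩ : Fin n) = 1 := by
    have : Fact (1 < n) := ⟨hn⟩
    ext; simp [Nat.mod_eq_of_lt hn]
  rw [Sa, tup_succ 0 K hn, tup_zero, S1, this]

lemma Near.Sa_succ {K : ConvexBody (En n)} {x : ℝ} (h : Near K x) {a : ℕ} (ha : a + 1 < n)
    {f : Sph n → ℝ} (hf : Continuous f) (hf0 : ∀ v, 0 ≤ f v) :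
    |∫ v, f v ∂(Sa (a + 1) K) - ∫ v, f v ∂(Sa a K)| ≤ x * ∫ v, f v ∂(Sa a K) := by
  have h1 := h.first_diff (tup a K) (j := ⟨a + 1, ha⟩) (by simp [Fin.ext_iff]) hf hf0
  rwa [update_tup, ← tup_succ] at h1

lemma Near.Sa_le {K : ConvexBody (En n)} {x : ℝ} (h : Near K x) (hx : x ≤ 1)
    {f : Sph n → ℝ} (hf : Continuous f) (hf0 : ∀ v, 0 ≤ f v) {a : ℕ} (ha : a < n) :
    ∫ v, f v ∂(Sa a K) ≤ 2 ^ a * ∫ v, f v ∂(sig n) := by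
  induction a with
  | zero => rw [Sa_zero]; simp
  | succ a ih =>
    have h1 := (abs_le.1 (h.Sa_succ ha hf hf0)).2
    have h2 : 0 ≤ ∫ v, f v ∂(Sa a K) := integral_nonneg hf0
    have h3 := ih (by omega)
    rw [pow_succ]
    nlinarith [mul_le_mul_of_nonneg_right hx h2]

lemma Near.Sa_second {K : ConvexBody (En n)} {x : ℝ} (h : Near K x) {a : ℕ} (ha : a + 2 < n)
    {f : Sph n → ℝ} (hf : Continuous f) :
    |∫ v, f v ∂(Sa (a + 2) K) - 2 * ∫ v, f v ∂(Sa (a + 1) K) + ∫ v, f v ∂(Sa a K)| ≤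
      x ^ 2 * ∫ v, |f v| ∂(Sa a K) := by
  have hi := fun {f : Sph n → ℝ} (hf : Continuous f) a => integrable_of_continuous hf (Sa a K)
  refine abs_le_of_abs_le_nonneg (T := fun f => ∫ v, f v ∂(Sa (a + 2) K) -
    2 * ∫ v, f v ∂(Sa (a + 1) K) + ∫ v, f v ∂(Sa a K)) (U := fun f => x ^ 2 * ∫ v, f v ∂(Sa a K))
    (fun f g hf hg => ?_) (fun f g hf hg => ?_) (fun f hf hf0 => ?_) hf
  · simp only [integral_sub (hi hf _) (hi hg _)]; ring
  · simp only [integral_add (hi hf _) (hi hg _)]; ring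
  · have h1 := h.second_diff (tup a K) (j₁ := ⟨a + 1, by omega⟩) (j₂ := ⟨a + 2, ha⟩)
      (by simp [Fin.ext_iff]) (by simp [Fin.ext_iff]) (by simp) hf hf0
    rw [update_tup, ← tup_succ, ← tup_succ (a + 1), update_tup (a + 1)] at h1
    have e : Function.update (tup a K) ⟨a + 2, ha⟩ (ballB n) = tup a K :=
      Function.update_eq_self_iff.2 (by simp [tup])
    rw [e] at h1
    exact h1

/-- Area measures of order `a` of bodies close to the ball, to first order. -/
lemma Near.Sa_linear {K : ConvexBody (En n)} {x : ℝ} (h : Near K x) (hx : x ≤ 1)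
    {f : Sph n → ℝ} (hf : Continuous f) {a : ℕ} (ha : a < n) :
    |∫ v, f v ∂(Sa a K) - ∫ v, f v ∂(sig n) - a * (∫ v, f v ∂(S1 K) - ∫ v, f v ∂(sig n))| ≤
      n ^ 2 * 2 ^ n * x ^ 2 * ∫ v, |f v| ∂(sig n) := by
  set M := 2 ^ n * x ^ 2 * ∫ v, |f v| ∂(sig n) with hM
  have hI : 0 ≤ ∫ v, |f v| ∂(sig n) := integral_nonneg fun v => abs_nonneg _
  have hM0 : 0 ≤ M := by positivity
  have key : ∀ b : ℕ, b + 1 < n →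
      |∫ v, f v ∂(Sa (b + 1) K) - ∫ v, f v ∂(Sa b K) - (∫ v, f v ∂(S1 K) - ∫ v, f v ∂(sig n))| ≤ b * M ∧
      |∫ v, f v ∂(Sa b K) - ∫ v, f v ∂(sig n) - b * (∫ v, f v ∂(S1 K) - ∫ v, f v ∂(sig n))| ≤ b ^ 2 * M := by
    intro b
    induction b with
    | zero => intro hb; simp [Sa_zero, Sa_one hb]
    | succ b ih =>
      intro hb
      obtain ⟨h1, h2⟩ := ih (by omega)
      have h3 := h.Sa_second hb hf
      have h4 : x ^ 2 * ∫ v, |f v| ∂(Sa b K) ≤ M := by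
        have h5 := h.Sa_le hx (f := fun v => |f v|) (by fun_prop) (fun v => abs_nonneg _)
          (show b < n by omega)
        have h6 : (2 : ℝ) ^ b ≤ 2 ^ n := pow_le_pow_right₀ (by norm_num) (by omega)
        calc x ^ 2 * ∫ v, |f v| ∂(Sa b K) ≤ x ^ 2 * (2 ^ n * ∫ v, |f v| ∂(sig n)) := by
              gcongr; exact h5.trans (by gcongr)
          _ = M := by rw [hM]; ring
      rw [abs_le] at h1 h2 h3
      have hb0 : (0 : ℝ) ≤ b := b.cast_nonneg
      push_cast
      constructor <;> rw [abs_le] <;> constructor <;> nlinarith [mul_nonneg hb0 hM0]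
  have han : (a : ℝ) ^ 2 * M ≤ n ^ 2 * M := by gcongr
  rw [show (n : ℝ) ^ 2 * 2 ^ n * x ^ 2 * ∫ v, |f v| ∂(sig n) = n ^ 2 * M by rw [hM]; ring]
  refine le_trans ?_ han
  rcases a with - | a
  · simp [Sa_zero]
  · obtain ⟨h1, h2⟩ := key a ha
    rw [abs_le] at h1 h2
    have hb0 : (0 : ℝ) ≤ a := a.cast_nonneg
    push_cast
    rw [abs_le]
    constructor <;> nlinarith [mul_nonneg hb0 hM0]

end

section

variable [NeZero n]

/-- The `L²` norm with respect to the normalised spherical measure. -/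
def L2 (f : Sph n → ℝ) : ℝ := √(∫ v, f v ^ 2 ∂(sig n))

lemma L2_nonneg (f : Sph n → ℝ) : 0 ≤ L2 f := Real.sqrt_nonneg _

lemma sq_L2 (f : Sph n → ℝ) : L2 f ^ 2 = ∫ v, f v ^ 2 ∂(sig n) :=
  Real.sq_sqrt (integral_nonneg fun _ => sq_nonneg _)

lemma integral_sub_mean_sq {f : Sph n → ℝ} (hf : Continuous f) :
    ∫ v, (f v - ∫ w, f w ∂(sig n)) ^ 2 ∂(sig n) =
      ∫ v, f v ^ 2 ∂(sig n) - (∫ w, f w ∂(sig n)) ^ 2 := by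
  set m := ∫ w, f w ∂(sig n) with hm
  have h1 : ∀ v, (f v - m) ^ 2 = f v ^ 2 - (2 * m) * f v + m ^ 2 := fun v => by ring
  simp_rw [h1]
  rw [integral_add (integrable_of_continuous (by fun_prop) _) (integrable_of_continuous (by fun_prop) _),
    integral_sub (integrable_of_continuous (by fun_prop) _) (integrable_of_continuous (by fun_prop) _),
    integral_const_mul, ← hm]
  simp
  ring

lemma L2_sub_mean_le {f : Sph n → ℝ} (hf : Continuous f) :
    L2 (fun v => f v - ∫ w, f w ∂(sig n)) ≤ L2 f := by
  refine Real.sqrt_le_sqrt ?_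
  rw [integral_sub_mean_sq hf]
  linarith [sq_nonneg (∫ w, f w ∂(sig n))]

lemma integral_abs_le_L2 {f : Sph n → ℝ} (hf : Continuous f) : ∫ v, |f v| ∂(sig n) ≤ L2 f := by
  refine Real.le_sqrt_of_sq_le ?_
  have h1 := integral_sub_mean_sq (f := fun v => |f v|) (by fun_prop)
  have h2 : 0 ≤ ∫ v, (|f v| - ∫ w, |f w| ∂(sig n)) ^ 2 ∂(sig n) := integral_nonneg fun v => sq_nonneg _
  simp only [sq_abs] at h1
  linarith

lemma L2_le_of_abs_le {f : Sph n → ℝ} {c : ℝ} (hc : 0 ≤ c) (hf : Continuous f) (h : ∀ v, |f v| ≤ c) :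
    L2 f ≤ c := by
  refine Real.sqrt_le_iff.2 ⟨hc, ?_⟩
  calc ∫ v, f v ^ 2 ∂(sig n) ≤ ∫ _v : Sph n, c ^ 2 ∂(sig n) :=
        integral_mono (integrable_of_continuous (by fun_prop) _) (integrable_of_continuous (by fun_prop) _)
          fun v => sq_le_sq' (abs_le.1 (h v)).1 (abs_le.1 (h v)).2
    _ = c ^ 2 := by simp

namespace IsZonalFamily

variable {A : Sph n → ConvexBody (En n)} {g : ℝ → ℝ}

omit [NeZero n] in
lemma family_neg (h : IsZonalFamily A g) (v : Sph n) : A (-v) = A v := by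
  have key : ∀ u : Sph n, supp (A (-v)) u = supp (A v) u := fun u => by
    rw [h.supp_eq, h.supp_eq, coe_neg_sphere, inner_neg_right, h.even]
  exact body_ext fun x => le_antisymm (supp_le_of_sphere (fun u => (key u).le) x)
    (supp_le_of_sphere (fun u => (key u).ge) x)

lemma op_comp_neg (h : IsZonalFamily A g) {f : Sph n → ℝ} (hf : Continuous f) (w : Sph n) :
    op A (fun v => f (-v)) w = op A f w := by
  have h1 := S1_comp (LinearIsometryEquiv.neg ℝ) (A w) hf
  have h2 : ∀ v : Sph n, sphMap (LinearIsometryEquiv.neg ℝ) v = -v := fun v => Subtype.ext (by simp)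
  simp only [h2, h.rotate_eq, h.family_neg] at h1
  exact h1

lemma op_add {f g : Sph n → ℝ} (hf : Continuous f) (hg : Continuous g) (w : Sph n) :
    op A (fun v => f v + g v) w = op A f w + op A g w :=
  integral_add (integrable_of_continuous hf _) (integrable_of_continuous hg _)

lemma op_sub {f g : Sph n → ℝ} (hf : Continuous f) (hg : Continuous g) (w : Sph n) :
    op A (fun v => f v - g v) w = op A f w - op A g w :=
  integral_sub (integrable_of_continuous hf _) (integrable_of_continuous hg _)

lemma op_const (hn : 3 ≤ n) (h : IsZonalFamily A g) (c : ℝ) (w : Sph n) :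
    op A (fun _ => c) w = Es n g * c := by
  rw [op, integral_const, h.S1_mass_eq' hn, smul_eq_mul]

lemma continuous_op' (hn : 3 ≤ n) (h : IsZonalFamily A g) {f : Sph n → ℝ} (hf : Continuous f) :
    Continuous (op A f) := by
  have hf' : Continuous fun v : Sph n => f (-v) := hf.comp continuous_neg
  have h1 := h.continuous_op hn (f := fun v => f v + f (-v)) (by fun_prop)
    fun v => by rw [neg_neg, add_comm]
  have h2 : op A f = fun w => op A (fun v => f v + f (-v)) w / 2 := by
    funext w
    rw [op_add hf hf', h.op_comp_neg hf]
    ring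
  rw [h2]
  fun_prop

/-- The first order area measure of a body generated by a zonal family. -/
lemma integral_S1_generated (hn : 3 ≤ n) (h : IsZonalFamily A g) {K : ConvexBody (En n)}
    {ν : Measure (Sph n)} [IsFiniteMeasure ν] {c : ℝ}
    (hK : ∀ u : Sph n, supp K u = c * ∫ v : Sph n, g ⟪(u : En n), v⟫_ℝ ∂ν) {f : Sph n → ℝ}
    (hf : Continuous f) : ∫ v, f v ∂(S1 K) = c * ∫ w, op A f w ∂ν := by
  have hg := h.cont
  have hop : Continuous fun f : C(Sph n, ℝ) => ∫ w, op A f w ∂ν := by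
    refine (LipschitzWith.of_dist_le_mul (K := (Es n g * ν.real Set.univ).toNNReal) fun f f' => ?_).continuous
    rw [Real.coe_toNNReal _ (mul_nonneg h.mean_nonneg measureReal_nonneg), Real.dist_eq,
      ← integral_sub (integrable_of_continuous (h.continuous_op' hn f.continuous) _)
        (integrable_of_continuous (h.continuous_op' hn f'.continuous) _)]
    refine (norm_integral_le_of_norm_le_const (C := dist f f' * Es n g) (Eventually.of_forall fun w =>
      (Real.norm_eq_abs _).trans_le (h.abs_op_sub_le hn f.continuous f'.continuous (fun u => ?_) w))).trans_eq
      (by ring)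
    rw [← Real.dist_eq]
    exact ContinuousMap.dist_apply_le_dist u
  have hsupp : ∀ M : ConvexBody (En n), ∫ v : Sph n, supp M v ∂(S1 K) =
      c * ∫ w, op A (fun v => supp M v) w ∂ν := fun M => by
    rw [S1_symm (by omega)]
    simp only [hK, integral_const_mul]
    rw [fubini_sph (by fun_prop)]
    congr 1
    refine integral_congr_ae (Eventually.of_forall fun w => ?_)
    simp only [op]
    rw [S1_symm (by omega)]
    simp only [h.supp_eq]
  have key := eq_of_eq_on_supp (continuous_integral_C (S1 K)) (hop.const_mul c) (fun M N => ?_) ⟨f, hf⟩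
  · exact key
  · have hM := continuous_supp_sph M
    have hN := continuous_supp_sph N
    simp only [ContinuousMap.sub_apply]
    have e : ∀ w, op A (⇑(suppC M - suppC N)) w = op A (fun v => supp M v) w - op A (fun v => supp N v) w :=
      fun w => op_sub hM hN w
    simp only [e]
    rw [integral_sub (integrable_of_continuous (suppC M).continuous _)
      (integrable_of_continuous (suppC N).continuous _),
      integral_sub (integrable_of_continuous (h.continuous_op' hn hM) _)
        (integrable_of_continuous (h.continuous_op' hn hN) _), mul_sub]
    simp only [suppC_apply, hsupp]

lemma integral_op_sig (hn : 3 ≤ n) (h : IsZonalFamily A g) {f : Sph n → ℝ} (hf : Continuous f) :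
    ∫ w, op A f w ∂(sig n) = Es n g * ∫ v, f v ∂(sig n) := by
  have h1 := h.integral_S1_generated hn (K := scale (Es n g) (ballB n)) (ν := sig n) (c := 1)
    (fun u => by
      rw [supp_scale _ h.mean_nonneg, supp_ballB, norm_eq_of_mem_sphere,
        integral_sig_inner h.cont, mul_comm]) hf
  rw [S1_scale (by omega) _ h.mean_nonneg, S1_ball, integral_smul_nnreal_measure, NNReal.smul_def,
    Real.coe_toNNReal _ h.mean_nonneg, one_mul, smul_eq_mul] at h1
  exact h1.symm

end IsZonalFamily

end

section

variable [NeZero n]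

/-- The constant in the error term of `Near.Sa_linear`. -/
def errC (n : ℕ) : ℝ := n ^ 2 * 2 ^ n

omit [NeZero n] in
lemma errC_nonneg : 0 ≤ errC n := by unfold errC; positivity

/-- The first order area measure of `K` is close to the spherical measure on even functions. -/
def MeasNear (K : ConvexBody (En n)) (y : ℝ) : Prop :=
  0 ≤ y ∧ ∀ f : Sph n → ℝ, Continuous f → (∀ v, f (-v) = f v) →
    |∫ v, f v ∂(S1 K) - ∫ v, f v ∂(sig n)| ≤ y * L2 f

lemma Near.measNear (hn : 2 ≤ n) {K : ConvexBody (En n)} {x : ℝ} (h : Near K x) : MeasNear K x := by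
  refine ⟨h.1, fun f hf _ => ?_⟩
  have h1 : |∫ v, f v ∂(S1 K) - ∫ v, f v ∂(sig n)| ≤ x * ∫ v, |f v| ∂(sig n) := by
    have hi := fun {f : Sph n → ℝ} (hf : Continuous f) a => integrable_of_continuous hf (Sa a K)
    rw [← Sa_one hn, ← Sa_zero K]
    refine abs_le_of_abs_le_nonneg (T := fun f => ∫ v, f v ∂(Sa 1 K) - ∫ v, f v ∂(Sa 0 K))
      (U := fun f => x * ∫ v, f v ∂(Sa 0 K)) (fun f g hf hg => ?_) (fun f g hf hg => ?_)
      (fun f hf hf0 => h.Sa_succ hn hf hf0) hf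
    · simp only [integral_sub (hi hf _) (hi hg _)]; ring
    · simp only [integral_add (hi hf _) (hi hg _)]; ring
  exact h1.trans (mul_le_mul_of_nonneg_left (integral_abs_le_L2 hf) h.1)

section step

variable {K : ConvexBody (En n)} {x y : ℝ} {i : ℕ}

lemma Near.Sa_mass (hn : 2 ≤ n) (h : Near K x) (hx : x ≤ 1) (hmean : ∫ v : Sph n, supp K v ∂(sig n) = 1)
    (hi : i < n) : |(Sa i K).real Set.univ - 1| ≤ errC n * x ^ 2 := by
  have h1 := h.Sa_linear hx (f := fun _ => 1) continuous_const hi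
  simp only [integral_const, smul_eq_mul, mul_one, S1_mass hn, hmean, probReal_univ, sub_self, mul_zero,
    sub_zero, abs_one] at h1
  exact h1

lemma Near.Sa_even (h : Near K x) (hx : x ≤ 1) (hy : MeasNear K y) (hi : i < n) {f : Sph n → ℝ}
    (hf : Continuous f) (heven : ∀ v, f (-v) = f v) :
    |∫ v, f v ∂(Sa i K) - ∫ v, f v ∂(sig n)| ≤ (i * y + errC n * x ^ 2) * L2 f := by
  have h1 := h.Sa_linear hx hf hi
  have h2 := hy.2 f hf heven
  have h3 := mul_le_mul_of_nonneg_left (integral_abs_le_L2 hf) (mul_nonneg (errC_nonneg (n := n)) (sq_nonneg x))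
  have h4 := mul_le_mul_of_nonneg_left h2 (Nat.cast_nonneg (α := ℝ) i)
  rw [← abs_of_nonneg (Nat.cast_nonneg (α := ℝ) i), ← abs_mul, abs_of_nonneg (Nat.cast_nonneg (α := ℝ) i)] at h4
  change _ ≤ errC n * x ^ 2 * _ at h1
  have h5 := abs_add_le (∫ v, f v ∂(Sa i K) - ∫ v, f v ∂(sig n) -
    i * (∫ v, f v ∂(S1 K) - ∫ v, f v ∂(sig n))) (i * (∫ v, f v ∂(S1 K) - ∫ v, f v ∂(sig n)))
  rw [sub_add_cancel] at h5
  linarith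

end step

/-- The image of `K` under the Minkowski valuation generated by `g`, up to the factor `c`. -/
def IsImage (g : ℝ → ℝ) (i : ℕ) (K K' : ConvexBody (En n)) (c : ℝ) : Prop :=
  ∀ u : Sph n, supp K' u = c * ∫ v : Sph n, g ⟪(u : En n), v⟫_ℝ ∂(Sa i K)

namespace IsZonalFamily

variable {A A' : Sph n → ConvexBody (En n)} {g g' : ℝ → ℝ} {K K' : ConvexBody (En n)} {x y c R : ℝ} {i : ℕ}

omit [NeZero n] in
lemma continuous_supp_family (h : IsZonalFamily A g) (p : En n) : Continuous fun v => supp (A v) p := by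
  have hg := h.cont
  by_cases hp : p = 0
  · subst hp; simp only [supp_zero_right]; exact continuous_const
  · have hp0 : 0 < ‖p‖ := norm_pos_iff.2 hp
    let u : Sph n := ⟨‖p‖⁻¹ • p, by simp [norm_smul, hp0.ne']⟩
    have h1 : ∀ v, supp (A v) p = ‖p‖ * g ⟪(u : En n), v⟫_ℝ := fun v => by
      rw [← h.supp_eq, ← supp_smul _ hp0.le, smul_inv_smul₀ hp0.ne']
    simp only [h1]
    fun_prop

lemma supp_image (h : IsZonalFamily A g) (hK' : IsImage g i K K' c) (p : En n) :
    supp K' p = c * ∫ v, supp (A v) p ∂(Sa i K) := by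
  by_cases hp : p = 0
  · subst hp; simp
  · have hp0 : 0 < ‖p‖ := norm_pos_iff.2 hp
    let u : Sph n := ⟨‖p‖⁻¹ • p, by simp [norm_smul, hp0.ne']⟩
    have h0 : p = ‖p‖ • (u : En n) := (smul_inv_smul₀ hp0.ne' p).symm
    have h1 : ∀ v, supp (A v) p = ‖p‖ * g ⟪(u : En n), v⟫_ℝ := fun v => by
      rw [← h.supp_eq, ← supp_smul _ hp0.le, ← h0]
    simp only [h1, integral_const_mul]
    conv_lhs => rw [h0, supp_smul _ hp0.le, hK']
    ring

lemma integral_supp_family (h : IsZonalFamily A g) (p : En n) :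
    ∫ v, supp (A v) p ∂(sig n) = Es n g * ‖p‖ := by
  by_cases hp : p = 0
  · subst hp; simp
  · have hp0 : 0 < ‖p‖ := norm_pos_iff.2 hp
    let u : Sph n := ⟨‖p‖⁻¹ • p, by simp [norm_smul, hp0.ne']⟩
    have h0 : p = ‖p‖ • (u : En n) := (smul_inv_smul₀ hp0.ne' p).symm
    have h1 : ∀ v, supp (A v) p = ‖p‖ * g ⟪(u : En n), v⟫_ℝ := fun v => by
      rw [← h.supp_eq, ← supp_smul _ hp0.le, ← h0]
    simp only [h1, integral_const_mul, integral_sig_inner h.cont]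
    ring

lemma mean_image (h : IsZonalFamily A g) (hK' : IsImage g i K K' c) :
    ∫ v : Sph n, supp K' v ∂(sig n) = c * Es n g * (Sa i K).real Set.univ := by
  have hg := h.cont
  simp only [hK' _, integral_const_mul]
  rw [fubini_sph (by fun_prop)]
  simp only [integral_sig_inner' hg, integral_const, smul_eq_mul]
  ring

lemma image_supp_neg (h : IsZonalFamily A g) (hK' : IsImage g i K K' c) (p : En n) :
    supp K' (-p) = supp K' p := by
  simp only [h.supp_image hK', h.supp_neg]

lemma near_image (hn : 2 ≤ n) (h : IsZonalFamily A g) (hR0 : 0 ≤ R)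
    (hR : ∀ v p q, suppDefect (A v) p q ≤ R * defect p q) (hc : 0 ≤ c)
    (hK : Near K x) (hx : x ≤ 1) (hy : MeasNear K y) (hmean : ∫ v : Sph n, supp K v ∂(sig n) = 1)
    (hi : i < n) (hK' : IsImage g i K K' c) (hmean' : ∫ v : Sph n, supp K' v ∂(sig n) = 1) :
    Near K' (c * (R + Es n g) * (n * y + errC n * x ^ 2)) := by
  have ha0 := h.mean_nonneg
  have hE := errC_nonneg (n := n)
  have hy0 := hy.1
  refine ⟨by positivity, fun p q => ?_⟩
  have hd := defect_nonneg p q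
  set s := (Sa i K).real Set.univ with hs
  have hcs : c * Es n g * s = 1 := (h.mean_image hK').symm.trans hmean'
  let f : Sph n → ℝ := fun v => suppDefect (A v) p q
  have hfc : Continuous f :=
    ((h.continuous_supp_family p).add (h.continuous_supp_family q)).sub (h.continuous_supp_family _)
  have hint : ∀ (μ : Measure (Sph n)) [IsFiniteMeasure μ], ∫ v, f v ∂μ =
      ∫ v, supp (A v) p ∂μ + ∫ v, supp (A v) q ∂μ - ∫ v, supp (A v) (p + q) ∂μ := fun μ _ => by
    have hi := fun p => integrable_of_continuous (h.continuous_supp_family p) μ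
    simp only [f, suppDefect]
    rw [integral_sub (f := fun v => supp (A v) p + supp (A v) q) ((hi p).add (hi q)) (hi _),
      integral_add (hi p) (hi q)]
  have h1 : suppDefect K' p q = c * ∫ v, f v ∂(Sa i K) := by
    rw [hint, suppDefect, h.supp_image hK', h.supp_image hK', h.supp_image hK']; ring
  have h2 : ∫ v, f v ∂(sig n) = Es n g * defect p q := by
    rw [hint, h.integral_supp_family, h.integral_supp_family, h.integral_supp_family, defect]; ring
  have h3 := hK.Sa_even hx hy hi hfc fun v => by simp only [f, suppDefect, h.family_neg]
  have h4 : L2 f ≤ R * defect p q := L2_le_of_abs_le (by positivity) hfc fun v => by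
    rw [abs_of_nonneg (suppDefect_nonneg _ _ _)]; exact hR v p q
  have h5 := hK.Sa_mass hn hx hmean hi
  rw [h2] at h3
  have h6 : suppDefect K' p q - defect p q = c * ((∫ v, f v ∂(Sa i K) - Es n g * defect p q) -
      (s - 1) * (Es n g * defect p q)) := by
    rw [h1]; linear_combination (defect p q) * hcs
  rw [h6, abs_mul, abs_of_nonneg hc, mul_assoc c, mul_assoc c]
  refine mul_le_mul_of_nonneg_left ?_ hc
  have h7 : |(s - 1) * (Es n g * defect p q)| ≤ errC n * x ^ 2 * (Es n g * defect p q) := by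
    rw [abs_mul, abs_of_nonneg (mul_nonneg ha0 hd)]
    exact mul_le_mul_of_nonneg_right h5 (mul_nonneg ha0 hd)
  have h8 : (i : ℝ) ≤ n := by exact_mod_cast hi.le
  have h9 : (i * y + errC n * x ^ 2) * L2 f ≤ (n * y + errC n * x ^ 2) * (R * defect p q) :=
    mul_le_mul (by gcongr) h4 (L2_nonneg _) (by positivity)
  have h10 : 0 ≤ n * y * (Es n g * defect p q) := by positivity
  refine (abs_sub _ _).trans ((add_le_add (h3.trans h9) h7).trans ?_)
  nlinarith

lemma measNear_image (hn : 6 ≤ n) (h : IsZonalFamily A g) (h' : IsZonalFamily A' g') {ε : ℝ} (hε : 0 ≤ ε)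
    (hA : ∀ v, A v = scale ε (ballB n) + A' v) (hc : 0 ≤ c)
    (hK : Near K x) (hx : x ≤ 1) (hy : MeasNear K y)
    (hi : i + 1 ≤ n) (hK' : IsImage g i K K' c) (hmean' : ∫ v : Sph n, supp K' v ∂(sig n) = 1) :
    MeasNear K' (c * Es n g' * (y + errC n * x ^ 2)) := by
  have ha0 := h'.mean_nonneg
  have hE := errC_nonneg (n := n)
  have hy0 := hy.1
  have hn6 : (6 : ℝ) ≤ n := by exact_mod_cast hn
  have hi' : (i : ℝ) ≤ n - 1 := by
    have : (i : ℝ) + 1 ≤ n := by exact_mod_cast hi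
    linarith
  have hcs : c * Es n g * (Sa i K).real Set.univ = 1 := (h.mean_image hK').symm.trans hmean'
  refine ⟨by positivity, fun f hf heven => ?_⟩
  set m := ∫ v, f v ∂(sig n) with hm
  let f₀ : Sph n → ℝ := fun v => f v - m
  have hf₀ : Continuous f₀ := by fun_prop
  have hf₀m : ∫ v, f₀ v ∂(sig n) = 0 := by
    simp only [f₀]
    rw [integral_sub (integrable_of_continuous hf _) (integrable_of_continuous continuous_const _), ← hm]
    simp
  have hf₀e : ∀ v, f₀ (-v) = f₀ v := fun v => by simp only [f₀, heven]
  have hop : ∀ w, op A f w = op A' f₀ w + Es n g * m := fun w => by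
    have h1 : op A f w = op A f₀ w + op A (fun _ => m) w := by
      rw [← op_add hf₀ continuous_const]; simp only [f₀, sub_add_cancel]
    have h2 : op A f₀ w = op A' f₀ w := by
      rw [op, hA, S1_add (by omega), integral_add_measure (integrable_of_continuous hf₀ _)
        (integrable_of_continuous hf₀ _), S1_scale (by omega) _ hε, S1_ball, integral_smul_nnreal_measure,
        hf₀m, smul_zero, zero_add, op]
    rw [h1, h2, h.op_const (by omega)]
  have hF : Continuous (op A' f₀) := h'.continuous_op' (by omega) hf₀
  have h1 : ∫ v, f v ∂(S1 K') - m = c * ∫ w, op A' f₀ w ∂(Sa i K) := by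
    rw [h.integral_S1_generated (by omega) hK' hf]
    simp only [hop]
    rw [integral_add (integrable_of_continuous hF _) (integrable_of_continuous continuous_const _),
      integral_const, smul_eq_mul]
    linear_combination m * hcs
  have h2 := hK.Sa_even hx hy hi hF fun v => by simp only [op, h'.family_neg]
  rw [h'.integral_op_sig (by omega) hf₀, hf₀m, mul_zero, sub_zero] at h2
  have h3 : L2 (op A' f₀) ≤ Es n g' / (n - 1) * L2 f := by
    have h4 : L2 (op A' f₀) ≤ Es n g' / (n - 1) * L2 f₀ := by
      have hq : 0 ≤ Es n g' / ((n : ℝ) - 1) := div_nonneg ha0 (by linarith)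
      refine Real.sqrt_le_iff.2 ⟨mul_nonneg hq (L2_nonneg _), ?_⟩
      rw [mul_pow, sq_L2]
      exact h'.integral_op_sq_le hn hf₀ hf₀e hf₀m
    exact h4.trans (mul_le_mul_of_nonneg_left (L2_sub_mean_le hf) (div_nonneg ha0 (by linarith)))
  rw [h1, abs_mul, abs_of_nonneg hc, mul_assoc c, mul_assoc c]
  refine mul_le_mul_of_nonneg_left (h2.trans ?_) hc
  have h5 : i * y + errC n * x ^ 2 ≤ (n - 1) * (y + errC n * x ^ 2) := by
    have : 0 ≤ errC n * x ^ 2 := by positivity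
    nlinarith
  calc (i * y + errC n * x ^ 2) * L2 (op A' f₀)
      ≤ ((n - 1) * (y + errC n * x ^ 2)) * (Es n g' / (n - 1) * L2 f) :=
        mul_le_mul h5 h3 (L2_nonneg _) (mul_nonneg (by linarith) (by positivity))
    _ = Es n g' * (y + errC n * x ^ 2) * L2 f := by
        have : (n : ℝ) - 1 ≠ 0 := by linarith
        field_simp

end IsZonalFamily

end

section

omit n in
lemma exists_contraction {θ C D : ℝ} (hθ₀ : 0 ≤ θ) (hθ : θ < 1) (hC : 0 ≤ C) (hD : 0 ≤ D) :
    ∃ η > 0, ∃ z₀ > 0, ∃ r, 0 ≤ r ∧ r < 1 ∧ ∀ x y : ℝ, 0 ≤ x → 0 ≤ y → y + η * x ≤ z₀ →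
      x ≤ 1 ∧ C * x ^ 2 ≤ 1 / 2 ∧
        θ * (1 + 2 * (C * x ^ 2)) * (y + C * x ^ 2) + η * (D * (y + x ^ 2)) ≤ r * (y + η * x) := by
  obtain ⟨δ, hδ⟩ : ∃ δ, δ = (1 - θ) / 4 := ⟨_, rfl⟩
  have hδ0 : 0 < δ := by rw [hδ]; linarith
  have hδ1 : δ ≤ 1 / 4 := by rw [hδ]; linarith
  obtain ⟨η, hη⟩ : ∃ η, η = δ / (D + 1) := ⟨_, rfl⟩
  have hη0 : 0 < η := by rw [hη]; positivity
  have hηD : η * (D + 1) = δ := by rw [hη]; field_simp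
  have hηδ : η ≤ δ := by nlinarith [mul_nonneg hη0.le hD]
  have hηD' : η * D ≤ δ := by linarith
  obtain ⟨x₁, hx₁⟩ : ∃ x₁, x₁ = δ * η / (3 * C + 3) := ⟨_, rfl⟩
  have hx₁0 : 0 < x₁ := by rw [hx₁]; positivity
  have hx₁C : x₁ * (3 * C + 3) = δ * η := by rw [hx₁]; field_simp
  have hx₁' : 3 * x₁ ≤ η := by nlinarith [mul_nonneg hx₁0.le hC]
  have hx₁'' : C * x₁ ≤ δ * η / 3 := by linarith
  refine ⟨η, hη0, η * x₁, by positivity, θ + 2 * δ, by linarith, by linarith, fun x y hx hy h => ?_⟩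
  have hxx : x ≤ x₁ := le_of_mul_le_mul_left (by linarith) hη0
  have hx1 : x ≤ 1 := by linarith
  have hsq : x ^ 2 ≤ x₁ * x := by nlinarith
  have ht : C * x ^ 2 ≤ δ * η / 3 * x :=
    (mul_le_mul_of_nonneg_left hsq hC).trans (by nlinarith)
  obtain ⟨t, htd⟩ : ∃ t, t = C * x ^ 2 := ⟨_, rfl⟩
  rw [← htd] at ht ⊢
  have ht0 : 0 ≤ t := by rw [htd]; positivity
  have hηx : η * x ≤ 1 := by nlinarith
  have ht1 : t ≤ δ / 3 := by nlinarith
  refine ⟨hx1, by linarith, ?_⟩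
  have e1 : θ * (1 + 2 * t) ≤ θ + δ := by nlinarith
  have e2 : θ * (1 + 2 * t) * (y + t) ≤ (θ + δ) * (y + t) :=
    mul_le_mul_of_nonneg_right e1 (by linarith)
  have e3 : η * (D * (y + x ^ 2)) ≤ δ * (y + x ^ 2) := by
    rw [← mul_assoc]; exact mul_le_mul_of_nonneg_right hηD' (by positivity)
  have e4 : δ * x ^ 2 ≤ δ * (η / 3 * x) := by
    refine mul_le_mul_of_nonneg_left (hsq.trans ?_) hδ0.le
    exact mul_le_mul_of_nonneg_right (by linarith) hx
  have e5 : (θ + δ) * t ≤ t := by nlinarith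
  have e6 : 0 ≤ (θ + δ) * (η * x) := by positivity
  have e7 : 0 ≤ δ * (η * x) := by positivity
  nlinarith

variable [NeZero n]

namespace IsZonalFamily

variable {A A' : Sph n → ConvexBody (En n)} {g g' : ℝ → ℝ} {R : ℝ} {i : ℕ}

/-- Bodies sufficiently close to the unit ball converge to it under iteration. -/
lemma exists_attraction (hn : 6 ≤ n) (h : IsZonalFamily A g) (h' : IsZonalFamily A' g') {ε : ℝ} (hε : 0 < ε)
    (hA : ∀ v, A v = scale ε (ballB n) + A' v) (hR0 : 0 ≤ R)
    (hR : ∀ v p q, suppDefect (A v) p q ≤ R * defect p q) (hi : i + 1 ≤ n) :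
    ∃ x₀ > 0, ∀ (K : ℕ → ConvexBody (En n)) (c : ℕ → ℝ), (∀ m, 0 ≤ c m) →
      (∀ m, IsImage g i (K m) (K (m + 1)) (c m)) → (∀ m, ∫ v : Sph n, supp (K m) v ∂(sig n) = 1) →
      Near (K 0) x₀ → ∃ X : ℕ → ℝ, Tendsto X atTop (𝓝 0) ∧ ∀ m, Near (K m) (X m) := by
  have ha' := h'.mean_nonneg
  have hgg' : Es n g = ε + Es n g' := by
    rw [← integral_sig_inner' h.cont (e0 n), ← integral_sig_inner' h'.cont (e0 n)]
    have h1 : ∀ v : Sph n, g ⟪(v : En n), (e0 n : En n)⟫_ℝ = ε + g' ⟪(v : En n), (e0 n : En n)⟫_ℝ := fun v => by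
      rw [← h.supp_eq, ← h'.supp_eq, hA, supp_add, supp_scale _ hε.le, supp_ballB, norm_eq_of_mem_sphere,
        mul_one]
    have hg' := h'.cont
    simp only [h1]
    rw [integral_add (integrable_of_continuous (by fun_prop) _) (integrable_of_continuous (by fun_prop) _)]
    simp
  have ha : 0 < Es n g := by linarith
  have hE := errC_nonneg (n := n)
  obtain ⟨η, hη, z₀, hz₀, r, hr0, hr1, hcontr⟩ := exists_contraction (θ := Es n g' / Es n g) (C := errC n)
    (D := 2 / Es n g * (R + Es n g) * (n + errC n)) (by positivity) ((div_lt_one ha).2 (by linarith)) hE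
    (by positivity)
  refine ⟨z₀ / (1 + η), by positivity, fun K c hc himg hmean hK₀ => ?_⟩
  have key : ∀ m, ∃ x y, Near (K m) x ∧ MeasNear (K m) y ∧ y + η * x ≤ r ^ m * z₀ := by
    intro m
    induction m with
    | zero =>
      refine ⟨_, _, hK₀, hK₀.measNear (by omega), le_of_eq ?_⟩
      field_simp
    | succ m ih =>
      obtain ⟨x, y, hx, hy, hxy⟩ := ih
      have hx0 := hx.1
      have hy0 := hy.1
      have hz : r ^ m * z₀ ≤ z₀ := mul_le_of_le_one_left hz₀.le (pow_le_one₀ hr0 hr1.le)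
      obtain ⟨hx1, ht, hstep⟩ := hcontr x y hx0 hy0 (hxy.trans hz)
      refine ⟨_, _, h.near_image (by omega) hR0 hR (hc m) hx hx1 hy (hmean m) (by omega) (himg m) (hmean _),
        h.measNear_image hn h' hε.le hA (hc m) hx hx1 hy hi (himg m) (hmean _), ?_⟩
      have hs := (abs_le.1 (hx.Sa_mass (by omega) hx1 (hmean m) (show i < n by omega))).1
      set s := (Sa i (K m)).real Set.univ
      have hcs : c m * Es n g * s = 1 := (h.mean_image (himg m)).symm.trans (hmean _)
      obtain ⟨t, htd⟩ : ∃ t, t = errC n * x ^ 2 := ⟨_, rfl⟩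
      have ht0 : 0 ≤ t := by rw [htd]; positivity
      rw [← htd] at hs ht hstep ⊢
      have hb0 : 0 ≤ c m * Es n g := mul_nonneg (hc m) ha.le
      have hb2 : c m * Es n g ≤ 1 + 2 * t := by nlinarith
      have hc1 : c m ≤ (1 + 2 * t) / Es n g := (le_div_iff₀ ha).2 hb2
      have hc2 : c m ≤ 2 / Es n g := hc1.trans (by gcongr; linarith)
      calc c m * Es n g' * (y + t) + η * (c m * (R + Es n g) * (n * y + t))
          ≤ (1 + 2 * t) / Es n g * Es n g' * (y + t) +
            η * (2 / Es n g * (R + Es n g) * ((n + errC n) * (y + x ^ 2))) := by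
            have : n * y + t ≤ (n + errC n) * (y + x ^ 2) := by
              rw [htd]
              have := mul_nonneg hE hy0
              have := mul_nonneg (Nat.cast_nonneg (α := ℝ) n) (sq_nonneg x)
              nlinarith
            gcongr
        _ = Es n g' / Es n g * (1 + 2 * t) * (y + t) +
            η * (2 / Es n g * (R + Es n g) * (n + errC n) * (y + x ^ 2)) := by ring
        _ ≤ r * (y + η * x) := hstep
        _ ≤ r * (r ^ m * z₀) := mul_le_mul_of_nonneg_left hxy hr0
        _ = r ^ (m + 1) * z₀ := by ring
  choose X Y hX hY hXY using key
  refine ⟨X, squeeze_zero (fun m => (hX m).1) (g := fun m => r ^ m * z₀ / η) (fun m => ?_) ?_, hX⟩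
  · rw [le_div_iff₀ hη]
    have := hXY m
    have := (hY m).1
    linarith
  · have := ((tendsto_pow_atTop_nhds_zero_of_lt_one hr0 hr1).mul_const z₀).div_const η
    simpa using this

end IsZonalFamily

end

section

/-- A positively homogeneous function which is `C²` away from the origin. -/
structure IsC2Hom (F : En n → ℝ) : Prop where
  contDiffOn : ContDiffOn ℝ 2 F {0}ᶜ
  hom : ∀ c : ℝ, 0 < c → ∀ x, F (c • x) = c * F x

lemma hessQ_eq (F : En n → ℝ) (x w : En n) : hessQ F x w = fderiv ℝ (fderiv ℝ F) x w w := by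
  rw [hessQ, iteratedFDeriv_two_apply]; rfl

lemma isC2Hom_norm : IsC2Hom (fun x : En n => ‖x‖) where
  contDiffOn x hx := (contDiffAt_norm ℝ hx).contDiffWithinAt
  hom c hc x := by rw [norm_smul, Real.norm_of_nonneg hc.le]

lemma isC2Hom_supp {K : ConvexBody (En n)} (hK : ContDiffOn ℝ 2 (supp K) {0}ᶜ) : IsC2Hom (supp K) :=
  ⟨hK, fun _ hc x => supp_smul K hc.le x⟩

namespace IsC2Hom

variable {F G : En n → ℝ} {x : En n}

lemma contDiffAt (hF : IsC2Hom F) (hx : x ≠ 0) : ContDiffAt ℝ 2 F x :=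
  hF.contDiffOn.contDiffAt (isOpen_compl_singleton.mem_nhds hx)

lemma differentiableAt (hF : IsC2Hom F) (hx : x ≠ 0) : DifferentiableAt ℝ F x :=
  (hF.contDiffAt hx).differentiableAt (by norm_num)

lemma differentiableAt_fderiv (hF : IsC2Hom F) (hx : x ≠ 0) : DifferentiableAt ℝ (fderiv ℝ F) x :=
  ((hF.contDiffAt hx).fderiv_right (m := 1) (by norm_num)).differentiableAt (by norm_num)

lemma sub (hF : IsC2Hom F) (hG : IsC2Hom G) : IsC2Hom (F - G) :=
  ⟨hF.contDiffOn.sub hG.contDiffOn, fun c hc x => by simp [hF.hom c hc, hG.hom c hc, mul_sub]⟩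

lemma const_smul (hF : IsC2Hom F) (a : ℝ) : IsC2Hom (a • F) :=
  ⟨hF.contDiffOn.const_smul a, fun c hc x => by simp [hF.hom c hc]; ring⟩

lemma hessQ_sub (hF : IsC2Hom F) (hG : IsC2Hom G) (hx : x ≠ 0) (w : En n) :
    hessQ (F - G) x w = hessQ F x w - hessQ G x w := by
  rw [hessQ, iteratedFDeriv_sub_apply (hF.contDiffAt hx) (hG.contDiffAt hx)]; rfl

lemma hessQ_smul (hF : IsC2Hom F) (hx : x ≠ 0) (a : ℝ) (w : En n) :
    hessQ (a • F) x w = a * hessQ F x w := by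
  rw [hessQ, iteratedFDeriv_const_smul_apply (hF.contDiffAt hx)]; rfl

lemma hasDerivAt_line (hF : IsC2Hom F) {p w : En n} {t : ℝ} (h : p + t • w ≠ 0) :
    HasDerivAt (fun s : ℝ => F (p + s • w)) (fderiv ℝ F (p + t • w) w) t := by
  have h1 : HasDerivAt (fun s : ℝ => p + s • w) w t := by
    simpa using ((hasDerivAt_id t).smul_const w).const_add p
  exact (hF.differentiableAt h).hasFDerivAt.comp_hasDerivAt t h1

lemma hasDerivAt_fderiv_line (hF : IsC2Hom F) {p w : En n} {t : ℝ} (h : p + t • w ≠ 0) (v : En n) :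
    HasDerivAt (fun s : ℝ => fderiv ℝ F (p + s • w) v) (fderiv ℝ (fderiv ℝ F) (p + t • w) w v) t := by
  have h1 : HasDerivAt (fun s : ℝ => p + s • w) w t := by
    simpa using ((hasDerivAt_id t).smul_const w).const_add p
  have h2 := (hF.differentiableAt_fderiv h).hasFDerivAt.comp_hasDerivAt t h1
  exact h2.clm_apply (hasDerivAt_const t v) |>.congr_deriv (by simp)

lemma fderiv_smul (hF : IsC2Hom F) {c : ℝ} (hc : 0 < c) (hx : x ≠ 0) :
    fderiv ℝ F (c • x) = fderiv ℝ F x := by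
  have h1 := fderiv_comp_smul (𝕜 := ℝ) (f := F) (x := x) c
  have h2 : (F <| c • ·) = c • F := funext fun y => hF.hom c hc y
  rw [h2, fderiv_const_smul (hF.differentiableAt hx)] at h1
  exact (smul_right_injective _ hc.ne' h1).symm

lemma fderiv_fderiv_smul (hF : IsC2Hom F) {c : ℝ} (hc : 0 < c) (hx : x ≠ 0) :
    c • fderiv ℝ (fderiv ℝ F) (c • x) = fderiv ℝ (fderiv ℝ F) x := by
  rw [← fderiv_comp_smul]
  refine Filter.EventuallyEq.fderiv_eq ?_
  filter_upwards [isOpen_compl_singleton.mem_nhds hx] with y hy using hF.fderiv_smul hc hy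

lemma fderiv_fderiv_self (hF : IsC2Hom F) (hx : x ≠ 0) (v : En n) :
    fderiv ℝ (fderiv ℝ F) x x v = 0 := by
  have h1 := hF.hasDerivAt_fderiv_line (p := x) (w := x) (t := 0) (by simpa using hx) v
  rw [zero_smul, add_zero] at h1
  refine h1.unique ((hasDerivAt_const 0 (fderiv ℝ F x v)).congr_of_eventuallyEq ?_)
  filter_upwards [lt_mem_nhds (show (-1 : ℝ) < 0 by norm_num)] with s hs
  have h2 := hF.fderiv_smul (c := 1 + s) (by linarith) hx
  rw [add_smul, one_smul] at h2
  rw [h2]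

lemma hessQ_sub_smul (hF : IsC2Hom F) (hx : x ≠ 0) (w : En n) (a : ℝ) :
    hessQ F x (w - a • x) = hessQ F x w := by
  have hs : fderiv ℝ (fderiv ℝ F) x w x = fderiv ℝ (fderiv ℝ F) x x w :=
    (hF.contDiffAt hx).isSymmSndFDerivAt (by simp) w x
  simp [hessQ_eq, hs, hF.fderiv_fderiv_self hx]

lemma hessQ_nonneg (hF : IsC2Hom F)
    (h : ∀ u : En n, ‖u‖ = 1 → ∀ w, ⟪u, w⟫_ℝ = 0 → 0 ≤ hessQ F u w) (hx : x ≠ 0) (w : En n) :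
    0 ≤ hessQ F x w := by
  have hx' : 0 < ‖x‖⁻¹ := inv_pos.2 (norm_pos_iff.2 hx)
  have hu : ‖‖x‖⁻¹ • x‖ = 1 := norm_smul_inv_norm (𝕜 := ℝ) hx
  set u := ‖x‖⁻¹ • x with hudef
  have hu0 : u ≠ 0 := norm_ne_zero_iff.1 (by rw [hu]; norm_num)
  have h1 := h u hu (w - ⟪u, w⟫_ℝ • u) (by
    rw [inner_sub_right, real_inner_smul_right, real_inner_self_eq_norm_sq, hu]; ring)
  rw [hF.hessQ_sub_smul hu0, hessQ_eq] at h1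
  rw [hessQ_eq, ← hF.fderiv_fderiv_smul hx' hx]
  exact mul_nonneg hx'.le h1

lemma add_le_of_segment (hF : IsC2Hom F)
    (h : ∀ u : En n, ‖u‖ = 1 → ∀ w, ⟪u, w⟫_ℝ = 0 → 0 ≤ hessQ F u w) {p q : En n}
    (hpq : ∀ t ∈ Set.Icc (0 : ℝ) 1, p + t • (q - p) ≠ 0) : F (p + q) ≤ F p + F q := by
  have hI : interior (Set.Icc (0 : ℝ) 1) ⊆ Set.Icc (0 : ℝ) 1 := interior_subset
  have hconv := convexOn_of_hasDerivWithinAt2_nonneg (convex_Icc (0 : ℝ) 1)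
    (fun t ht => (hF.hasDerivAt_line (hpq t ht)).continuousAt.continuousWithinAt)
    (fun t ht => (hF.hasDerivAt_line (hpq t (hI ht))).hasDerivWithinAt)
    (fun t ht => (hF.hasDerivAt_fderiv_line (hpq t (hI ht)) (q - p)).hasDerivWithinAt)
    (fun t ht => by rw [← hessQ_eq]; exact hF.hessQ_nonneg h (hpq t (hI ht)) _)
  have h1 := hconv.2 (show (0 : ℝ) ∈ Set.Icc (0 : ℝ) 1 by simp) (show (1 : ℝ) ∈ Set.Icc (0 : ℝ) 1 by simp)
    (show (0 : ℝ) ≤ 1 / 2 by norm_num) (show (0 : ℝ) ≤ 1 / 2 by norm_num) (by norm_num)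
  have h2 : p + (1 / 2 : ℝ) • (q - p) = (1 / 2 : ℝ) • (p + q) := by module
  simp only [smul_eq_mul, mul_zero, mul_one, zero_add, h2, zero_smul, add_zero, one_smul,
    add_sub_cancel, hF.hom (1 / 2) (by norm_num)] at h1
  linarith

lemma zero (hF : IsC2Hom F) : F 0 = 0 := by
  have := hF.hom 2 two_pos 0
  rw [smul_zero] at this
  linarith

/-- A positively homogeneous function with nonnegative Hessian is subadditive. -/
lemma subadditive (hn : 2 ≤ n) (hF : IsC2Hom F) (hc : Continuous F)
    (h : ∀ u : En n, ‖u‖ = 1 → ∀ w, ⟪u, w⟫_ℝ = 0 → 0 ≤ hessQ F u w) (p q : En n) :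
    F (p + q) ≤ F p + F q := by
  rcases eq_or_ne p 0 with rfl | hp
  · simp [hF.zero]
  obtain ⟨z, hz, hzp, hzq⟩ : ∃ z : En n, ‖z‖ = 1 ∧ ⟪p, z⟫_ℝ = 0 ∧ 0 ≤ ⟪q, z⟫_ℝ := by
    obtain ⟨z, hz, hzp⟩ := exists_orthogonal hn p
    rcases le_total 0 ⟪q, z⟫_ℝ with h0 | h0
    · exact ⟨z, hz, hzp, h0⟩
    · exact ⟨-z, by simpa, by simpa, by simpa⟩
  have h1 : ∀ᶠ s in 𝓝[>] (0 : ℝ), F (p + (q + s • z)) ≤ F p + F (q + s • z) := by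
    filter_upwards [self_mem_nhdsWithin] with s hs
    refine hF.add_le_of_segment h fun t ht h0 => ?_
    have h2 := congrArg (fun y => ⟪y, z⟫_ℝ) h0
    simp only [inner_add_left, real_inner_smul_left, inner_sub_left, hzp, real_inner_self_eq_norm_sq,
      hz, inner_zero_left] at h2
    have hs' : 0 < ⟪q, z⟫_ℝ + s * 1 ^ 2 - 0 := by have : 0 < s := hs; linarith
    rw [zero_add, mul_eq_zero, or_iff_left hs'.ne'] at h2
    rw [h2, zero_smul, add_zero] at h0
    exact hp h0
  have e1 : Tendsto (fun s : ℝ => F (p + (q + s • z))) (𝓝[>] 0) (𝓝 (F (p + (q + (0 : ℝ) • z)))) :=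
    Continuous.tendsto (by fun_prop) 0 |>.mono_left nhdsWithin_le_nhds
  have e2 : Tendsto (fun s : ℝ => F p + F (q + s • z)) (𝓝[>] 0) (𝓝 (F p + F (q + (0 : ℝ) • z))) :=
    Continuous.tendsto (by fun_prop) 0 |>.mono_left nhdsWithin_le_nhds
  simpa using le_of_tendsto_of_tendsto e1 e2 h1

end IsC2Hom

lemma hessQ_norm {u w : En n} (hu : ‖u‖ = 1) (hw : ⟪u, w⟫_ℝ = 0) :
    hessQ (fun x : En n => ‖x‖) u w = ‖w‖ ^ 2 := by
  have hnz : ∀ t : ℝ, u + t • w ≠ 0 := fun t h0 => by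
    have h2 := congrArg (fun y => ⟪u, y⟫_ℝ) h0
    simp [inner_add_right, real_inner_smul_right, hw, hu] at h2
  have hnorm : ∀ t : ℝ, ‖u + t • w‖ = √(1 + t ^ 2 * ‖w‖ ^ 2) := fun t => by
    rw [← Real.sqrt_sq (norm_nonneg (u + t • w)), norm_add_sq_real, real_inner_smul_right, hw, hu,
      norm_smul, mul_pow, Real.norm_eq_abs, sq_abs]
    norm_num
  have hd : ∀ t : ℝ, HasDerivAt (fun s : ℝ => ‖u + s • w‖) (t * ‖w‖ ^ 2 / √(1 + t ^ 2 * ‖w‖ ^ 2)) t := by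
    intro t
    simp only [hnorm]
    have h1 : HasDerivAt (fun s : ℝ => 1 + s ^ 2 * ‖w‖ ^ 2) (2 * t * ‖w‖ ^ 2) t := by
      simpa using ((hasDerivAt_pow 2 t).mul_const (‖w‖ ^ 2)).const_add 1
    exact (h1.sqrt (by positivity)).congr_deriv (by field_simp)
  have h1 := isC2Hom_norm.hasDerivAt_fderiv_line (t := 0) (hnz 0) w
  have h2 : ∀ s : ℝ, fderiv ℝ (fun x : En n => ‖x‖) (u + s • w) w =
      s * (‖w‖ ^ 2 / √(1 + s ^ 2 * ‖w‖ ^ 2)) := fun s => by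
    rw [(isC2Hom_norm.hasDerivAt_line (hnz s)).unique (hd s)]; ring
  simp only [h2] at h1
  rw [← hessQ_eq, zero_smul, add_zero] at h1
  have h3 : HasDerivAt (fun s : ℝ => s * (‖w‖ ^ 2 / √(1 + s ^ 2 * ‖w‖ ^ 2))) (‖w‖ ^ 2) 0 := by
    have h5 : HasDerivAt (fun s : ℝ => 1 + s ^ 2 * ‖w‖ ^ 2) (2 * 0 * ‖w‖ ^ 2) 0 := by
      simpa using ((hasDerivAt_pow 2 (0 : ℝ)).mul_const (‖w‖ ^ 2)).const_add 1
    have h4 : DifferentiableAt ℝ (fun s : ℝ => ‖w‖ ^ 2 / √(1 + s ^ 2 * ‖w‖ ^ 2)) 0 :=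
      (differentiableAt_const _).div (h5.differentiableAt.sqrt (by norm_num)) (by simp)
    exact ((hasDerivAt_id 0).mul h4.hasDerivAt).congr_deriv (by simp)
  exact h1.unique h3

end

section

lemma hessQ_smul_right (F : En n → ℝ) (x w : En n) (c : ℝ) : hessQ F x (c • w) = c ^ 2 * hessQ F x w := by
  simp [hessQ_eq]; ring

lemma ne_zero_of_mem_sph (u : Sph n) : (u : En n) ≠ 0 := ne_zero_of_mem_unit_sphere u

namespace IsC2Hom

variable {F G : En n → ℝ}

lemma defect_le (hn : 2 ≤ n) (hF : IsC2Hom F) (hG : IsC2Hom G) (hFc : Continuous F)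
    (hGc : Continuous G)
    (h : ∀ u : En n, ‖u‖ = 1 → ∀ w, ⟪u, w⟫_ℝ = 0 → hessQ G u w ≤ hessQ F u w) (p q : En n) :
    G p + G q - G (p + q) ≤ F p + F q - F (p + q) := by
  have h1 := (hF.sub hG).subadditive hn (hFc.sub hGc) (fun u hu w hw => by
    rw [hF.hessQ_sub hG (norm_ne_zero_iff.1 (by rw [hu]; norm_num)), sub_nonneg]
    exact h u hu w hw) p q
  simp only [Pi.sub_apply] at h1
  linarith

lemma continuous_iteratedFDeriv (hF : IsC2Hom F) :
    Continuous fun u : Sph n => iteratedFDeriv ℝ 2 F (u : En n) :=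
  continuous_iff_continuousAt.2 fun u =>
    ContinuousAt.comp (f := fun u : Sph n => (u : En n))
      ((hF.contDiffAt (ne_zero_of_mem_sph u)).iteratedFDeriv_right (m := 0) (i := 2)
      (by norm_num)).continuousAt continuous_subtype_val.continuousAt

lemma continuous_fderiv (hF : IsC2Hom F) : Continuous fun u : Sph n => fderiv ℝ F (u : En n) :=
  continuous_iff_continuousAt.2 fun u =>
    ContinuousAt.comp (f := fun u : Sph n => (u : En n))
      (hF.differentiableAt_fderiv (ne_zero_of_mem_sph u)).continuousAt continuous_subtype_val.continuousAt

lemma continuous_sph (hF : IsC2Hom F) : Continuous fun u : Sph n => F (u : En n) :=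
  continuous_iff_continuousAt.2 fun u =>
    ContinuousAt.comp (f := fun u : Sph n => (u : En n))
      (hF.differentiableAt (ne_zero_of_mem_sph u)).continuousAt continuous_subtype_val.continuousAt

lemma abs_hessQ_sub_le (hF : IsC2Hom F) (hG : IsC2Hom G) {u : En n} (hu : ‖u‖ = 1) (w : En n) :
    |hessQ F u w - hessQ G u w| ≤ C2dist F G * ‖w‖ ^ 2 := by
  have hb := (isCompact_range (f := fun u : Sph n => |F (u : En n) - G (u : En n)| +
    ‖fderiv ℝ F (u : En n) - fderiv ℝ G (u : En n)‖ +
    ‖iteratedFDeriv ℝ 2 F (u : En n) - iteratedFDeriv ℝ 2 G (u : En n)‖) 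
    (((hF.continuous_sph.sub hG.continuous_sph).abs.add
      (hF.continuous_fderiv.sub hG.continuous_fderiv).norm).add
      (hF.continuous_iteratedFDeriv.sub hG.continuous_iteratedFDeriv).norm)).bddAbove
  have h1 := le_ciSup hb ⟨u, by simpa using hu⟩
  have h2 : ‖iteratedFDeriv ℝ 2 F u - iteratedFDeriv ℝ 2 G u‖ ≤ C2dist F G :=
    le_trans (le_add_of_nonneg_left (by positivity)) h1
  have h3 := (iteratedFDeriv ℝ 2 F u - iteratedFDeriv ℝ 2 G u).le_of_opNorm_le h2 ![w, w]
  simpa [Fin.prod_univ_two, hessQ, sq] using h3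

lemma exists_hessQ_bounds (hn : 2 ≤ n) (hF : IsC2Hom F)
    (h : ∀ u : En n, ‖u‖ = 1 → ∀ w : En n, w ≠ 0 → ⟪u, w⟫_ℝ = 0 → 0 < hessQ F u w) :
    ∃ a R : ℝ, 0 < a ∧ 0 ≤ R ∧ ∀ u : En n, ‖u‖ = 1 → ∀ w : En n, ⟪u, w⟫_ℝ = 0 →
      a * ‖w‖ ^ 2 ≤ hessQ F u w ∧ hessQ F u w ≤ R * ‖w‖ ^ 2 := by
  let f : Sph n × Sph n → ℝ := fun x => hessQ F (x.1 : En n) (x.2 : En n)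
  have hf : Continuous f := by
    have h1 := hF.continuous_iteratedFDeriv
    have h2 : Continuous fun x : Sph n × Sph n => iteratedFDeriv ℝ 2 F (x.1 : En n) := h1.comp continuous_fst
    refine continuous_eval.comp (h2.prodMk (continuous_pi fun j => ?_))
    fin_cases j <;> exact continuous_subtype_val.comp continuous_snd
  have hcl : IsCompact {x : Sph n × Sph n | ⟪(x.1 : En n), (x.2 : En n)⟫_ℝ = 0} :=
    (isClosed_eq (by fun_prop) continuous_const).isCompact
  have hne : {x : Sph n × Sph n | ⟪(x.1 : En n), (x.2 : En n)⟫_ℝ = 0}.Nonempty := by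
    obtain ⟨x, hx, -⟩ := exists_orthogonal hn (0 : En n)
    obtain ⟨y, hy, hxy⟩ := exists_orthogonal hn x
    exact ⟨(⟨x, by simpa using hx⟩, ⟨y, by simpa using hy⟩), hxy⟩
  obtain ⟨x, hx, hxmin⟩ := hcl.exists_isMinOn hne hf.continuousOn
  obtain ⟨y, hy, hymax⟩ := hcl.exists_isMaxOn hne hf.continuousOn
  have hpos : ∀ z ∈ {x : Sph n × Sph n | ⟪(x.1 : En n), (x.2 : En n)⟫_ℝ = 0}, 0 < f z := fun z hz =>
    h _ (norm_eq_of_mem_sphere _) _ (ne_zero_of_mem_sph _) hz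
  refine ⟨f x, f y, hpos x hx, (hpos y hy).le, fun u hu w hw => ?_⟩
  rcases eq_or_ne w 0 with rfl | hw0
  · simp [hessQ_eq]
  have hv : ‖‖w‖⁻¹ • w‖ = 1 := norm_smul_inv_norm (𝕜 := ℝ) hw0
  have hw1 : w = ‖w‖ • (‖w‖⁻¹ • w) := by
    rw [smul_smul, mul_inv_cancel₀ (norm_ne_zero_iff.2 hw0), one_smul]
  have hz : ((⟨u, by simpa using hu⟩, ⟨‖w‖⁻¹ • w, by simpa using hv⟩) : Sph n × Sph n) ∈
      {x : Sph n × Sph n | ⟪(x.1 : En n), (x.2 : En n)⟫_ℝ = 0} := by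
    simp [real_inner_smul_right, hw]
  have e : hessQ F u w = ‖w‖ ^ 2 * hessQ F u (‖w‖⁻¹ • w) := by rw [← hessQ_smul_right, ← hw1]
  rw [e, mul_comm _ (‖w‖ ^ 2), mul_comm _ (‖w‖ ^ 2)]
  exact ⟨mul_le_mul_of_nonneg_left (hxmin hz) (sq_nonneg _),
    mul_le_mul_of_nonneg_left (hymax hz) (sq_nonneg _)⟩

end IsC2Hom

lemma defect_le_suppDefect (hn : 2 ≤ n) {K : ConvexBody (En n)} (hK : IsC2Hom (supp K)) {a : ℝ}
    (h : ∀ u : En n, ‖u‖ = 1 → ∀ w, ⟪u, w⟫_ℝ = 0 → a * ‖w‖ ^ 2 ≤ hessQ (supp K) u w) (p q : En n) :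
    a * defect p q ≤ suppDefect K p q := by
  have h1 := hK.defect_le hn (isC2Hom_norm.const_smul a) (continuous_supp K) (by fun_prop)
    (fun u hu w hw => by
      rw [isC2Hom_norm.hessQ_smul (norm_ne_zero_iff.1 (by rw [hu]; norm_num)), hessQ_norm hu hw]
      exact h u hu w hw) p q
  simp only [Pi.smul_apply, smul_eq_mul] at h1
  rw [defect, suppDefect]
  linarith

lemma suppDefect_le_defect (hn : 2 ≤ n) {K : ConvexBody (En n)} (hK : IsC2Hom (supp K)) {a : ℝ}
    (h : ∀ u : En n, ‖u‖ = 1 → ∀ w, ⟪u, w⟫_ℝ = 0 → hessQ (supp K) u w ≤ a * ‖w‖ ^ 2) (p q : En n) :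
    suppDefect K p q ≤ a * defect p q := by
  have h1 := (isC2Hom_norm.const_smul a).defect_le hn hK (by fun_prop) (continuous_supp K)
    (fun u hu w hw => by
      rw [isC2Hom_norm.hessQ_smul (norm_ne_zero_iff.1 (by rw [hu]; norm_num)), hessQ_norm hu hw]
      exact h u hu w hw) p q
  simp only [Pi.smul_apply, smul_eq_mul] at h1
  rw [defect, suppDefect]
  linarith

lemma near_of_C2dist (hn : 2 ≤ n) {K : ConvexBody (En n)} (hK : IsC2Hom (supp K)) {x : ℝ} (hx : 0 ≤ x)
    (h : C2dist (supp K) (supp (ballB n)) ≤ x) : Near K x := by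
  have hB : supp (ballB n) = fun u => ‖u‖ := funext fun u => supp_ballB u
  have h1 : ∀ u : En n, ‖u‖ = 1 → ∀ w, ⟪u, w⟫_ℝ = 0 → |hessQ (supp K) u w - ‖w‖ ^ 2| ≤ x * ‖w‖ ^ 2 :=
    fun u hu w hw => by
      have h2 := hK.abs_hessQ_sub_le isC2Hom_norm hu w
      rw [hessQ_norm hu hw] at h2
      rw [hB] at h
      exact h2.trans (by gcongr)
  refine ⟨hx, fun p q => abs_le.2 ⟨?_, ?_⟩⟩
  · have := defect_le_suppDefect hn hK (a := 1 - x) (fun u hu w hw => by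
      linarith [(abs_le.1 (h1 u hu w hw)).1]) p q
    linarith
  · have := suppDefect_le_defect hn hK (a := 1 + x) (fun u hu w hw => by
      linarith [(abs_le.1 (h1 u hu w hw)).2]) p q
    linarith

end

lemma suppDefect_scale (K : ConvexBody (En n)) {c : ℝ} (hc : 0 ≤ c) (p q : En n) :
    suppDefect (scale c K) p q = c * suppDefect K p q := by
  simp only [suppDefect, supp_scale K hc]; ring

lemma suppDefect_rotate (ρ : En n ≃ₗᵢ[ℝ] En n) (K : ConvexBody (En n)) (p q : En n) :
    suppDefect (rotate ρ K) p q = suppDefect K (ρ.symm p) (ρ.symm q) := by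
  simp only [suppDefect, supp_rotate, map_add]

lemma defect_map (ρ : En n ≃ₗᵢ[ℝ] En n) (p q : En n) : defect (ρ p) (ρ q) = defect p q := by
  simp only [defect, ← map_add, ρ.norm_map]

lemma Near.mono {K : ConvexBody (En n)} {x y : ℝ} (h : Near K x) (hxy : x ≤ y) : Near K y :=
  ⟨h.1.trans hxy, fun p q => (h.2 p q).trans (mul_le_mul_of_nonneg_right hxy (defect_nonneg p q))⟩

/-- A body near the ball can be rescaled to have mean support function one. -/
lemma Near.exists_normalised [NeZero n] {K : ConvexBody (En n)} {x : ℝ} (h : Near K x) (hx : x ≤ 1 / 2) :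
    ∃ c > 0, Near (scale c K) (4 * x) ∧ ∫ v : Sph n, supp (scale c K) v ∂(sig n) = 1 := by
  have hx0 := h.1
  have hK := continuous_supp_sph K
  obtain ⟨μ, hμ⟩ : ∃ μ, μ = ∫ v : Sph n, supp K v ∂(sig n) := ⟨_, rfl⟩
  have hneg : ∫ v : Sph n, supp K (-(v : En n)) ∂(sig n) = μ := by
    rw [hμ, ← integral_sig_comp (LinearIsometryEquiv.neg ℝ) hK]; rfl
  have hKn : Continuous fun v : Sph n => supp K (-(v : En n)) :=
    (continuous_supp K).comp (by fun_prop)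
  have hsum : ∫ v : Sph n, (supp K v + supp K (-(v : En n))) ∂(sig n) = 2 * μ := by
    rw [integral_add (integrable_of_continuous hK _) (integrable_of_continuous hKn _), hneg, ← hμ]
    ring
  have hpt : ∀ v : Sph n, |supp K v + supp K (-(v : En n)) - 2| ≤ x * 2 := fun v => by
    have h1 := h.2 v (-(v : En n))
    simp only [suppDefect, defect, add_neg_cancel, supp_zero_right, norm_neg, norm_zero,
      norm_eq_of_mem_sphere, sub_zero] at h1
    norm_num at h1
    exact h1
  have hsub : ∫ v : Sph n, (supp K v + supp K (-(v : En n)) - 2) ∂(sig n) = 2 * μ - 2 := by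
    rw [integral_sub (integrable_of_continuous (f := fun v : Sph n => supp K v + supp K (-(v : En n)))
      (hK.add hKn) _) (integrable_const _), hsum]
    simp
  have hμ1 : |μ - 1| ≤ x := by
    have h1 : ‖∫ v : Sph n, (supp K v + supp K (-(v : En n)) - 2) ∂(sig n)‖ ≤
        x * 2 * (sig n).real Set.univ := norm_integral_le_of_norm_le_const (Eventually.of_forall hpt)
    rw [hsub, probReal_univ, mul_one, Real.norm_eq_abs,
      show 2 * μ - 2 = 2 * (μ - 1) by ring, abs_mul, abs_two] at h1
    linarith
  have hμ2 := abs_le.1 hμ1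
  have hμ0 : 0 < μ := by linarith
  refine ⟨μ⁻¹, inv_pos.2 hμ0, ⟨by linarith, fun p q => ?_⟩, ?_⟩
  · have hd := defect_nonneg p q
    have e : suppDefect (scale μ⁻¹ K) p q - defect p q =
        ((suppDefect K p q - defect p q) - (μ - 1) * defect p q) / μ := by
      rw [suppDefect_scale K (inv_pos.2 hμ0).le]; field_simp; ring
    rw [e, abs_div, abs_of_pos hμ0, div_le_iff₀ hμ0]
    calc |suppDefect K p q - defect p q - (μ - 1) * defect p q|
        ≤ |suppDefect K p q - defect p q| + |(μ - 1) * defect p q| := abs_sub _ _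
      _ ≤ x * defect p q + x * defect p q := by
        rw [abs_mul, abs_of_nonneg hd]
        gcongr
        exact h.2 p q
      _ ≤ 4 * x * defect p q * μ := by
        have := mul_nonneg hx0 hd
        nlinarith
  · simp only [supp_scale K (inv_pos.2 hμ0).le, integral_const_mul, ← hμ]
    exact inv_mul_cancel₀ hμ0.ne'

lemma exists_dist_le_of_supp_le {K M : ConvexBody (En n)} {x : ℝ} (hx : 0 ≤ x)
    (h : ∀ u, supp K u ≤ supp M u + x * ‖u‖) {y : En n} (hy : y ∈ (K : Set (En n))) :
    ∃ z ∈ (M : Set (En n)), dist y z ≤ x := by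
  have h1 : (K : Set (En n)) ⊆ ((M + scale x (ballB n) : ConvexBody (En n)) : Set (En n)) :=
    subset_of_supp_le fun u => by rw [supp_add, supp_scale _ hx, supp_ballB]; exact h u
  have h2 := h1 hy
  rw [ConvexBody.coe_add] at h2
  obtain ⟨z, hz, w, ⟨b, hb, rfl⟩, rfl⟩ := h2
  refine ⟨z, hz, ?_⟩
  have hb' : ‖b‖ ≤ 1 := by simpa using (show b ∈ closedBall (0 : En n) 1 from hb)
  simp only [dist_eq_norm, add_sub_cancel_left, norm_smul, Real.norm_of_nonneg hx]
  nlinarith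

lemma hausdorffDist_le_of_supp {K : ConvexBody (En n)} {x : ℝ} (hx : 0 ≤ x)
    (h : ∀ u, |supp K u - ‖u‖| ≤ x * ‖u‖) :
    hausdorffDist (K : Set (En n)) (closedBall (0 : En n) 1) ≤ x := by
  have hab := fun u => abs_le.1 (h u)
  refine hausdorffDist_le_of_mem_dist hx (fun y hy => ?_) (fun y hy => ?_)
  · exact exists_dist_le_of_supp_le (M := ballB n) hx
      (fun u => by rw [supp_ballB]; linarith [(hab u).2]) hy
  · exact exists_dist_le_of_supp_le (K := ballB n) hx
      (fun u => by rw [supp_ballB]; linarith [(hab u).1]) hy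

section

section mass

variable [NeZero n]

lemma integral_S_one (Ks : Fin n → ConvexBody (En n)) :
    ∫ _, (1 : ℝ) ∂(S Ks) = mv (Function.update Ks 0 (ballB n)) := by
  rw [← integral_supp_S]
  simp [supp_ballB]

lemma integral_S_one_mono (Ks : Fin n → ConvexBody (En n)) {j : Fin n} (hj : j ≠ 0)
    {X Y : ConvexBody (En n)} (h : (X : Set (En n)) ⊆ Y) :
    ∫ _, (1 : ℝ) ∂(S (Function.update Ks j X)) ≤ ∫ _, (1 : ℝ) ∂(S (Function.update Ks j Y)) := by
  rw [integral_S_one, integral_S_one, Function.update_comm hj, Function.update_comm hj]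
  exact div_le_div_of_nonneg_right (mixedVol_update_mono _ j h) mixedVol_ball_pos.le

lemma integral_Sa_one_pos_of_ball_subset {K : ConvexBody (En n)} {r : ℝ} (hr : 0 < r)
    (h : ∀ u : Sph n, r ≤ supp K u) {a : ℕ} (ha : a < n) : 0 < ∫ _, (1 : ℝ) ∂(Sa a K) := by
  induction a with
  | zero => simp [Sa_zero]
  | succ a ih =>
    have h1 : ((scale r (ballB n) : ConvexBody (En n)) : Set (En n)) ⊆ K :=
      subset_of_supp_le fun x => supp_le_of_sphere (fun u => by
        rw [supp_scale _ hr.le, supp_ballB, norm_eq_of_mem_sphere, mul_one]; exact h u) x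
    have hj : (⟨a + 1, ha⟩ : Fin n) ≠ 0 := by simp [Fin.ext_iff]
    have h2 := integral_S_one_mono (tup a K) hj h1
    rw [integral_S_scale _ hj _ hr.le, update_tup, ← tup_succ] at h2
    exact (mul_pos hr (ih (by omega))).trans_le h2

lemma Near.integral_Sa_one_pos {K : ConvexBody (En n)} {x : ℝ} (h : Near K x) (hx : x < 1) {a : ℕ}
    (ha : a < n) : 0 < ∫ _, (1 : ℝ) ∂(Sa a K) := by
  induction a with
  | zero => simp [Sa_zero]
  | succ a ih =>
    have h1 := (abs_le.1 (h.Sa_succ ha (f := fun _ => 1) continuous_const fun _ => zero_le_one)).1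
    have h2 := ih (by omega)
    nlinarith

lemma isAreaMeasure_Sa (i : ℕ) (K : ConvexBody (En n)) :
    IsAreaMeasure i K (ENNReal.ofReal (n * mixedVol (fun _ : Fin n => ballB n)) • Sa i K) := by
  intro M
  have hV := mixedVol_ball_pos (n := n)
  rw [integral_smul_measure, ENNReal.toReal_ofReal (by positivity), Sa, integral_supp_S, smul_eq_mul,
    mv, mul_assoc, mul_div_cancel₀ _ hV.ne']
  congr 2
  funext k
  rcases eq_or_ne k 0 with rfl | hk
  · simp
  · have hk' : (k : ℕ) ≠ 0 := fun h0 => hk (Fin.ext (by simpa using h0))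
    simp [tup, Function.update_of_ne hk, hk']

lemma GeneratedBy.supp_eq {i : ℕ} {Φ : ConvexBody (En n) → ConvexBody (En n)} {g : ℝ → ℝ}
    (h : GeneratedBy i Φ g) (K : ConvexBody (En n)) (u : Sph n) :
    supp (Φ K) u = n * mixedVol (fun _ : Fin n => ballB n) * ∫ v : Sph n, g ⟪(u : En n), v⟫_ℝ ∂(Sa i K) := by
  have hV := mixedVol_ball_pos (n := n)
  rw [h K _ (isAreaMeasure_Sa i K) u (norm_eq_of_mem_sphere u), integral_smul_measure,
    ENNReal.toReal_ofReal (by positivity), smul_eq_mul]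

end mass

/-- The extension of a function on `[-1, 1]` which is constant outside. -/
def clampExt (g : ℝ → ℝ) (t : ℝ) : ℝ := g (max (-1) (min 1 t))

lemma clampExt_of_mem {g : ℝ → ℝ} {t : ℝ} (h₁ : -1 ≤ t) (h₂ : t ≤ 1) : clampExt g t = g t := by
  rw [clampExt, min_eq_right h₂, max_eq_right h₁]

lemma clampExt_inner (g : ℝ → ℝ) (u v : Sph n) :
    clampExt g ⟪(u : En n), v⟫_ℝ = g ⟪(u : En n), v⟫_ℝ := by
  have h := abs_le.1 (abs_real_inner_le_norm (u : En n) v)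
  simp only [norm_eq_of_mem_sphere, mul_one] at h
  exact clampExt_of_mem h.1 h.2

lemma norm_pole (hn : 0 < n) : ‖pole n‖ = 1 := by simp [pole, hn]

/-- The rotated copies of an even body of revolution form a zonal family. -/
lemma isZonalFamily_rotate [NeZero n] (hn : 2 ≤ n) {M : ConvexBody (En n)} {g : ℝ → ℝ}
    (heven : ∀ x, supp M (-x) = supp M x) (hg : ∀ u : En n, ‖u‖ = 1 → supp M u = g ⟪u, pole n⟫_ℝ)
    {ρ : Sph n → En n ≃ₗᵢ[ℝ] En n} (hρ : ∀ v, ρ v (pole n) = v) :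
    IsZonalFamily (fun v => rotate (ρ v) M) (clampExt g) := by
  have hp : ‖pole n‖ = 1 := norm_pole (by omega)
  obtain ⟨e, he, hpe⟩ := exists_orthogonal hn (pole n)
  let c : ℝ → ℝ := fun t => max (-1) (min 1 t)
  have hc : ∀ t, c t ^ 2 ≤ 1 := fun t => by
    rw [sq_le_one_iff_abs_le_one, abs_le]
    exact ⟨le_max_left _ _, max_le (by norm_num) (min_le_left _ _)⟩
  let x : ℝ → En n := fun t => c t • pole n + √(1 - c t ^ 2) • e
  have hx : ∀ t, ‖x t‖ = 1 := fun t => by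
    have h1 : ‖x t‖ ^ 2 = 1 := by
      rw [norm_add_sq_real, real_inner_smul_left, real_inner_smul_right, hpe, norm_smul, norm_smul, hp, he,
        mul_pow, mul_pow, Real.norm_eq_abs, Real.norm_eq_abs, sq_abs, sq_abs,
        Real.sq_sqrt (by linarith [hc t])]
      ring
    rwa [pow_eq_one_iff_of_nonneg (norm_nonneg _) two_ne_zero] at h1
  have hxp : ∀ t, ⟪x t, pole n⟫_ℝ = c t := fun t => by
    rw [inner_add_left, real_inner_smul_left, real_inner_smul_left, real_inner_self_eq_norm_sq, hp,
      real_inner_comm, hpe]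
    ring
  have hgx : ∀ t, clampExt g t = supp M (x t) := fun t => by rw [hg _ (hx t), hxp]; rfl
  refine ⟨?_, fun t => ?_, fun u v => ?_⟩
  · have h1 : Continuous x := by fun_prop
    rw [funext hgx]
    exact (continuous_supp M).comp h1
  · have hct : c (-t) = -c t := by
      simp only [c]
      rw [show (1 : ℝ) = - -1 by norm_num, min_neg_neg, max_neg_neg, min_max_distrib_left]
      norm_num
    have h2 : supp M (-x t) = g (c (-t)) := by
      rw [hg _ (by rw [norm_neg, hx]), inner_neg_left, hxp, hct]
    rw [hgx t, ← heven, h2]; rfl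
  · rw [supp_rotate, hg _ (by rw [LinearIsometryEquiv.norm_map, norm_eq_of_mem_sphere]),
      ← (ρ v).inner_map_map, LinearIsometryEquiv.apply_symm_apply, hρ, clampExt_inner]

end

lemma scale_scale (a b : ℝ) (K : ConvexBody (En n)) : scale a (scale b K) = scale (a * b) K :=
  body_ext fun x => by rw [supp_scale_gen, supp_scale_gen, supp_scale_gen, smul_smul, mul_comm]

/-- A body of class `C²₊` splits off a ball. -/
lemma exists_eq_ball_add (hn : 2 ≤ n) {L : ConvexBody (En n)} (hL : IsCkPlus 2 L) :
    ∃ a R : ℝ, ∃ L' : ConvexBody (En n), 0 < a ∧ 0 ≤ R ∧ (∀ p q, suppDefect L p q ≤ R * defect p q) ∧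
      ∀ x, supp L x = a * ‖x‖ + supp L' x := by
  have hC : IsC2Hom (supp L) := isC2Hom_supp hL.1
  obtain ⟨a, R, ha, hR, haR⟩ := hC.exists_hessQ_bounds hn hL.2
  obtain ⟨ρ, hρ0, hρ⟩ := exists_supp_le_norm L
  refine ⟨a, R, ofSublinear (fun x => supp L x - a * ‖x‖) ρ (fun p q => ?_) (fun c hc x => ?_)
    (fun x => ?_), ha, hR, suppDefect_le_defect hn hC fun u hu w hw => (haR u hu w hw).2, fun x => ?_⟩
  · have := defect_le_suppDefect hn hC (fun u hu w hw => (haR u hu w hw).1) p q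
    rw [defect, suppDefect] at this
    linarith
  · rw [supp_smul L hc.le, norm_smul, Real.norm_of_nonneg hc.le]; ring
  · have := (abs_le.1 (hρ x)).2
    have : 0 ≤ a * ‖x‖ := by positivity
    linarith
  · rw [supp_ofSublinear]; ring

/-- Local convergence of iterates for Minkowski valuations generated by an
origin-symmetric `SO(n-1)` invariant body of class `C²₊`, when `n ≥ 6`. -/
theorem iterations_converge_C2_regular
    (n i : ℕ) (hn : 6 ≤ n) (hi₁ : 2 ≤ i) (hi₂ : i ≤ n - 1)
    (Φ : ConvexBody (En n) → ConvexBody (En n))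
    (hval : IsMinkowskiValuation Φ)
    (htrans : TranslationInvariant Φ)
    (hdeg : HasDegree i Φ)
    (hrot : RotationEquivariant Φ)
    (heven : IsEven Φ)
    (L : ConvexBody (En n)) (g : ℝ → ℝ)
    (hLsym : scale (-1) L = L)
    (hLzonal : IsZonalBody L)
    (hLC2 : IsCkPlus 2 L)
    (hprof : ∀ u : En n, ‖u‖ = 1 → supp L u = g ⟪u, pole n⟫_ℝ)
    (hgen : GeneratedBy i Φ g) :
    ∃ ε > (0 : ℝ), ∀ K : ConvexBody (En n),
      ContDiffOn ℝ 2 (supp K) {0}ᶜ →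
      (∃ γ : ℝ, 0 < γ ∧ C2dist (supp (scale γ K)) (supp (ballB n)) < ε) →
      ∃ γs : ℕ → ℝ, (∀ m, 0 < γs m) ∧
        Tendsto (fun m => hausdorffDist
            ((scale (γs m) (Φ^[m] K) : ConvexBody (En n)) : Set (En n))
            (closedBall (0 : En n) 1)) atTop (𝓝 0) := by
  have hn2 : 2 ≤ n := by omega
  have : NeZero n := ⟨by omega⟩
  have hin : i < n := by omega
  have hLeven : ∀ x, supp L (-x) = supp L x := fun x => by
    conv_rhs => rw [← hLsym, supp_scale_gen, neg_smul, one_smul]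
  obtain ⟨a, R, L', ha, hR0, hR, hLL'⟩ := exists_eq_ball_add hn2 hLC2
  have hL'even : ∀ x, supp L' (-x) = supp L' x := fun x => by
    have h1 := hLL' (-x)
    rw [hLeven, hLL', norm_neg] at h1
    linarith
  have hL'0 : ∀ x, 0 ≤ supp L' x := fun x => by
    have h1 := supp_add_le L' x (-x)
    rw [add_neg_cancel, supp_zero_right, hL'even] at h1
    linarith
  choose ρ hρ _ using exists_sphMap (n := n) ⟨pole n, by simpa using norm_pole (by omega)⟩
  replace hρ : ∀ v, ρ v (pole n) = v := fun v => congrArg Subtype.val (hρ v)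
  have hA := isZonalFamily_rotate hn2 hLeven hprof hρ
  have hA' := isZonalFamily_rotate hn2 (g := fun t => g t - a) hL'even (fun u hu => by
    rw [← hprof u hu, hLL', hu]; ring) hρ
  obtain ⟨x₀, hx₀, hattr⟩ := hA.exists_attraction hn hA' ha (fun v => body_ext fun x => by
      rw [supp_add, supp_scale _ ha.le, supp_ballB, supp_rotate, supp_rotate, hLL',
        LinearIsometryEquiv.norm_map]) hR0 (fun v p q => by
      rw [suppDefect_rotate, ← defect_map (ρ v).symm]; exact hR _ _) (show i + 1 ≤ n by omega)
  set κ : ℝ := n * mixedVol (fun _ : Fin n => ballB n) with hκ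
  have hκ0 : 0 < κ := mul_pos (Nat.cast_pos.2 (by omega)) mixedVol_ball_pos
  have hΦ : ∀ K (u : Sph n), supp (Φ K) u = κ * ∫ v : Sph n, clampExt g ⟪(u : En n), v⟫_ℝ ∂(Sa i K) :=
    fun K u => by simp only [clampExt_inner, hgen.supp_eq K u, hκ]
  have hlow : ∀ u v : Sph n, a ≤ clampExt g ⟪(u : En n), v⟫_ℝ := fun u v => by
    rw [← hA.supp_eq, supp_rotate, hLL', LinearIsometryEquiv.norm_map, norm_eq_of_mem_sphere]
    linarith [hL'0 ((ρ v).symm u)]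
  let mass : ConvexBody (En n) → ℝ := fun K => ∫ _, (1 : ℝ) ∂(Sa i K)
  let mean : ConvexBody (En n) → ℝ := fun K => ∫ v : Sph n, supp K v ∂(sig n)
  have hΦlow : ∀ K (u : Sph n), κ * (a * mass K) ≤ supp (Φ K) u := fun K u => by
    have hg := hA.cont
    rw [hΦ, ← integral_const_mul a]
    refine mul_le_mul_of_nonneg_left (integral_mono (integrable_of_continuous (by fun_prop) _)
      (integrable_of_continuous (by fun_prop) _) fun v => ?_) hκ0.le
    simpa using hlow u v
  have hmean : ∀ K, 0 < mass K → 0 < mean (Φ K) := fun K hK => by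
    refine (show 0 < κ * (a * mass K) by positivity).trans_le ?_
    have h1 := integral_mono (integrable_const (κ * (a * mass K)))
      (integrable_of_continuous (continuous_supp_sph (Φ K)) (sig n)) (hΦlow K)
    simpa using h1
  let Ψ : ConvexBody (En n) → ConvexBody (En n) := fun K => scale (mean (Φ K))⁻¹ (Φ K)
  have hΨmass : ∀ K, 0 < mass K → 0 < mass (Ψ K) := fun K hK => by
    have h1 := inv_pos.2 (hmean K hK)
    refine integral_Sa_one_pos_of_ball_subset (r := (mean (Φ K))⁻¹ * (κ * (a * mass K)))
      (by positivity) (fun u => ?_) hin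
    rw [supp_scale _ h1.le]
    exact mul_le_mul_of_nonneg_left (hΦlow K u) h1.le
  refine ⟨min (1 / 8) (x₀ / 4), by positivity, fun K hK ⟨γ, hγ, hdist⟩ => ?_⟩
  have hγK : IsC2Hom (supp (scale γ K)) := by
    have : supp (scale γ K) = γ • supp K := funext fun x => supp_scale K hγ.le x
    rw [this]
    exact (isC2Hom_supp hK).const_smul γ
  have hnear := near_of_C2dist hn2 hγK (x := min (1 / 8) (x₀ / 4)) (by positivity) hdist.le
  obtain ⟨c, hc, hnear₀, hmean₀⟩ := hnear.exists_normalised ((min_le_left _ _).trans (by norm_num))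
  rw [scale_scale] at hnear₀ hmean₀
  set K₀ := scale (c * γ) K
  have hmass₀ : 0 < mass K₀ :=
    hnear₀.integral_Sa_one_pos (by linarith [min_le_left (1 / 8) (x₀ / 4)]) hin
  have hmass : ∀ m, 0 < mass (Ψ^[m] K₀) := fun m => by
    induction m with
    | zero => exact hmass₀
    | succ m ih => rw [Function.iterate_succ_apply']; exact hΨmass _ ih
  have himg : ∀ m, IsImage (clampExt g) i (Ψ^[m] K₀) (Ψ^[m + 1] K₀)
      ((mean (Φ (Ψ^[m] K₀)))⁻¹ * κ) := fun m u => by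
    rw [Function.iterate_succ_apply', supp_scale _ (inv_pos.2 (hmean _ (hmass m))).le, hΦ, ← mul_assoc]
  obtain ⟨X, hX, hXnear⟩ := hattr (fun m => Ψ^[m] K₀) (fun m => (mean (Φ (Ψ^[m] K₀)))⁻¹ * κ)
    (fun m => mul_nonneg (inv_pos.2 (hmean _ (hmass m))).le hκ0.le) himg (fun m => by
      cases m with
      | zero => exact hmean₀
      | succ m =>
        have h1 := hmean _ (hmass m)
        simp only [Function.iterate_succ_apply', Ψ, supp_scale _ (inv_pos.2 h1).le, integral_const_mul]
        exact inv_mul_cancel₀ h1.ne')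
    (hnear₀.mono (by linarith [min_le_right (1 / 8) (x₀ / 4)]))
  have hscale : ∀ m, ∃ t > 0, scale t (Φ^[m] K) = Ψ^[m] K₀ := fun m => by
    induction m with
    | zero => exact ⟨c * γ, by positivity, rfl⟩
    | succ m ih =>
      obtain ⟨t, ht, ih⟩ := ih
      have h1 := inv_pos.2 (hmean _ (hmass m))
      refine ⟨(mean (Φ (Ψ^[m] K₀)))⁻¹ * t ^ i, by positivity, ?_⟩
      rw [Function.iterate_succ_apply', Function.iterate_succ_apply', ← scale_scale, ← hdeg _ t ht.le, ih]
  choose γs hγs hγsΨ using hscale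
  refine ⟨γs, hγs, squeeze_zero' (Eventually.of_forall fun m => hausdorffDist_nonneg) ?_ hX⟩
  filter_upwards [eventually_ge_atTop 1] with m hm
  obtain ⟨m, rfl⟩ := Nat.exists_eq_add_of_le' hm
  rw [hγsΨ]
  exact hausdorffDist_le_of_supp (hXnear _).1
    ((hXnear _).abs_sub_le_of_even fun u => hA.image_supp_neg (himg m) u)

end MinkIter
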